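/- (Lagarias's criterion) The Riemann hypothesis is true if and only if the inequality σ(n) ≤ H_n + e^{H_n}·log(H_n) holds for every positive integer n. -/

import Mathlib

/-! ### Landau's lemma for Laplace transforms -/

section

open MeasureTheory ProbabilityTheory Set Filter Topology

/-- Real-analytic form of the identity theorem for functions that are complex analytic at the real
points of an interval. -/
lemma eqOn_real_of_frequently_eq {F G : ℂ → ℂ} {s : Set ℝ} (hs : IsPreconnected s)
    (hF : ∀ t ∈ s, AnalyticAt ℂ F t) (hG : ∀ t ∈ s, AnalyticAt ℂ G t) {t₀ : ℝ} (ht₀ : t₀ ∈ s)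
    (h : ∀ᶠ t : ℝ in 𝓝 t₀, F t = G t) : ∀ t ∈ s, F t = G t := by
  have key : ∀ {H : ℂ → ℂ}, (∀ t ∈ s, AnalyticAt ℂ H t) →
      AnalyticOnNhd ℝ (fun t : ℝ ↦ H t) s := fun {H} hH t ht ↦
    ((hH t ht).restrictScalars (𝕜 := ℝ)).comp (Complex.ofRealCLM.analyticAt t)
  exact (key hF).eqOn_of_preconnected_of_eventuallyEq (key hG) hs ht₀ h

lemma eventuallyEq_of_real_eventuallyEq {F G : ℂ → ℂ} {t₀ : ℝ} (hF : AnalyticAt ℂ F t₀)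
    (hG : AnalyticAt ℂ G t₀) (h : ∀ᶠ t : ℝ in 𝓝 t₀, F t = G t) : F =ᶠ[𝓝 (t₀ : ℂ)] G := by
  refine (hF.frequently_eq_iff_eventually_eq hG).1 ?_
  have ht : Tendsto (fun t : ℝ ↦ (t : ℂ)) (𝓝[≠] t₀) (𝓝[≠] (t₀ : ℂ)) := by
    refine tendsto_nhdsWithin_of_tendsto_nhds_of_eventually_within _
      ((Complex.continuous_ofReal.tendsto t₀).mono_left nhdsWithin_le_nhds) ?_
    filter_upwards [self_mem_nhdsWithin] with t ht
    simpa using ht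
  exact ht.frequently (h.filter_mono nhdsWithin_le_nhds).frequently

/-- One step of Landau's argument: analytic continuation of the transform of a positive measure past
an end point of the domain of convergence extends the domain of convergence. -/
lemma exists_gt_integrable_exp {μ : Measure ℝ} [NeZero μ] (hμ : ∀ᵐ u ∂μ, 0 ≤ u) {σ : ℝ}
    (hσ : ∀ t < σ, Integrable (fun u ↦ Real.exp (t * u)) μ) {G : ℂ → ℂ}
    (hG : AnalyticAt ℂ G σ) (hGF : ∀ t : ℝ, t < σ → complexMGF id μ t = G t) :
    ∃ t > σ, Integrable (fun u ↦ Real.exp (t * u)) μ := by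
  obtain ⟨ρ, hρ, hball⟩ : ∃ ρ > 0, DifferentiableOn ℂ G (Metric.ball (σ : ℂ) ρ) := by
    obtain ⟨ρ, hρ, h⟩ := Metric.eventually_nhds_iff_ball.1 hG.eventually_analyticAt
    exact ⟨ρ, hρ, fun z hz ↦ (h z hz).differentiableAt.differentiableWithinAt⟩
  set t₁ : ℝ := σ - ρ / 4 with ht₁
  set t₂ : ℝ := σ + ρ / 4 with ht₂
  have hsub : Metric.ball (t₁ : ℂ) (3 * ρ / 4) ⊆ Metric.ball (σ : ℂ) ρ := by
    refine Metric.ball_subset_ball' ?_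
    have : dist (t₁ : ℂ) σ = ρ / 4 := by
      rw [Complex.dist_of_im_eq (by simp)]
      simp only [ht₁, Complex.ofReal_re, Real.dist_eq]
      rw [show σ - ρ / 4 - σ = -(ρ / 4) by ring, abs_neg, abs_of_pos (by positivity)]
    linarith
  have hint : Iio σ ⊆ integrableExpSet id μ := fun t ht ↦ hσ t ht
  have hmem : ((t₁ : ℂ)).re ∈ interior (integrableExpSet id μ) := by
    refine interior_mono hint ?_
    rw [interior_Iio]
    simp [ht₁, hρ]
  have hev : complexMGF id μ =ᶠ[𝓝 (t₁ : ℂ)] G := by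
    refine eventuallyEq_of_real_eventuallyEq (analyticAt_complexMGF hmem)
      (hball.analyticAt (Metric.isOpen_ball.mem_nhds (hsub ?_))) ?_
    · exact Metric.mem_ball_self (by positivity)
    · filter_upwards [Iio_mem_nhds (show t₁ < σ by simp [ht₁, hρ])] with t ht using hGF t ht
  have hsum := Complex.hasSum_taylorSeries_on_ball (f := G) (c := (t₁ : ℂ)) (r := 3 * ρ / 4)
    (hball.mono hsub) (z := (t₂ : ℂ)) (by
      rw [Metric.mem_ball, Complex.dist_of_im_eq (by simp)]
      simp only [ht₁, ht₂, Complex.ofReal_re, Real.dist_eq]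
      rw [abs_of_pos (by linarith)]
      linarith)
  have hsub' : (t₂ : ℂ) - t₁ = ((ρ / 2 : ℝ) : ℂ) := by
    rw [ht₁, ht₂]; push_cast; ring
  set F : ℕ → ℝ → ℝ := fun n u ↦ (ρ / 2) ^ n / n.factorial * (u ^ n * Real.exp (t₁ * u)) with hF
  have hFint : ∀ n, Integrable (F n) μ := fun n ↦
    (integrable_pow_mul_exp_of_mem_interior_integrableExpSet (X := id)
      (by simpa using hmem) n).const_mul _
  have hterm : ∀ n : ℕ, ((n.factorial : ℂ)⁻¹ • (((t₂ : ℂ) - t₁) ^ n • iteratedDeriv n G t₁))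
      = ((∫ u, F n u ∂μ : ℝ) : ℂ) := by
    intro n
    rw [← hev.iteratedDeriv_eq, iteratedDeriv_complexMGF hmem, hsub', integral_const_mul]
    have : ∀ u : ℝ, ((id u : ℝ) : ℂ) ^ n * Complex.exp (t₁ * (id u : ℝ))
        = ((u ^ n * Real.exp (t₁ * u) : ℝ) : ℂ) := fun u ↦ by push_cast; simp
    simp_rw [this]
    rw [integral_complex_ofReal]
    push_cast
    simp only [smul_eq_mul]
    ring
  have hsummable : Summable fun n ↦ ∫ u, F n u ∂μ := by
    have := hsum.summable
    simp_rw [hterm] at this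
    exact_mod_cast this
  have hnn : ∀ n, ∀ᵐ u ∂μ, 0 ≤ F n u := fun n ↦ by
    filter_upwards [hμ] with u hu
    positivity
  have hS := hasSum_integral_of_summable_integral_norm hFint (by
    refine hsummable.congr fun n ↦ ?_
    refine integral_congr_ae ?_
    filter_upwards [hnn n] with u hu
    rw [Real.norm_of_nonneg hu])
  have heq : ∀ u, ∑' n, F n u = Real.exp (t₂ * u) := by
    intro u
    have h1 : t₂ * u = ρ / 2 * u + t₁ * u := by rw [ht₁, ht₂]; ring
    have h2 : Real.exp (ρ / 2 * u) = ∑' n : ℕ, (ρ / 2 * u) ^ n / n.factorial := by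
      rw [Real.exp_eq_exp_ℝ, NormedSpace.exp_eq_tsum_div]
    rw [h1, Real.exp_add, h2, ← tsum_mul_right]
    refine tsum_congr fun n ↦ ?_
    simp only [hF, mul_pow]
    ring
  simp_rw [heq] at hS
  refine ⟨t₂, by simp [ht₂, hρ], Integrable.of_integral_ne_zero (ne_of_gt ?_)⟩
  have h0 : 0 < ∫ u, F 0 u ∂μ := by
    have := mgf_pos' (X := id) (μ := μ) (t := t₁) (NeZero.ne μ) (hσ t₁ (by simp [ht₁, hρ]))
    simpa [hF, mgf] using this
  exact h0.trans_le (hS.tsum_eq ▸ hsummable.le_tsum 0 fun n _ ↦ integral_nonneg_of_ae (hnn n))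

/-- **Landau's lemma** for the (exponential) transform of a positive measure on the half line. -/
theorem integrable_exp_of_analyticAt {μ : Measure ℝ} (hμ : ∀ᵐ u ∂μ, 0 ≤ u) {a : ℝ}
    (h0 : ∀ t < 0, Integrable (fun u ↦ Real.exp (t * u)) μ) {G : ℂ → ℂ}
    (hG : ∀ t : ℝ, t < a → AnalyticAt ℂ G t)
    (hGF : ∀ t : ℝ, t < 0 → complexMGF id μ t = G t) :
    ∀ t < a, Integrable (fun u ↦ Real.exp (t * u)) μ := by
  intro t₀ ht₀
  rcases eq_or_ne μ 0 with rfl | hμ0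
  · simp
  have : NeZero μ := ⟨hμ0⟩
  by_contra hcon
  set S : Set ℝ := integrableExpSet id μ with hS
  have hconv : Convex ℝ S := convex_integrableExpSet
  have hbd : ∀ t ∈ S, t ≤ t₀ := by
    intro t ht
    by_contra! hlt
    have h1 : (min t₀ 0) - 1 ∈ S :=
      h0 _ (by have := min_le_right t₀ 0; linarith)
    exact hcon (hconv.ordConnected.out h1 ht ⟨by have := min_le_left t₀ 0; linarith, hlt.le⟩)
  have hbdd : BddAbove S := ⟨t₀, hbd⟩
  have hne : S.Nonempty := ⟨-1, h0 _ (by norm_num)⟩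
  set σ := sSup S with hσdef
  have hσ : ∀ t < σ, Integrable (fun u ↦ Real.exp (t * u)) μ := by
    intro t ht
    obtain ⟨t', ht', hlt⟩ := exists_lt_of_lt_csSup hne ht
    have h1 : (min t 0) - 1 ∈ S := h0 _ (by have := min_le_right t 0; linarith)
    exact hconv.ordConnected.out h1 ht' ⟨by have := min_le_left t 0; linarith, hlt.le⟩
  have hσa : σ < a := (csSup_le hne hbd).trans_lt ht₀
  have hσ0 : 0 ≤ σ := by
    by_contra! hneg
    have := le_csSup hbdd (show σ / 2 ∈ S from h0 _ (by linarith))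
    linarith
  have hGF' : ∀ t ∈ Iio σ, complexMGF id μ t = G t := by
    refine eqOn_real_of_frequently_eq isPreconnected_Iio (fun t ht ↦ ?_)
      (fun t ht ↦ hG t (lt_trans ht hσa)) (t₀ := -1) (by simp; linarith) ?_
    · refine analyticAt_complexMGF (interior_mono (s := Iio σ) (fun t ht ↦ hσ t ht) ?_)
      rw [interior_Iio]; simpa using ht
    · filter_upwards [Iio_mem_nhds (show (-1 : ℝ) < 0 by norm_num)] with t ht using hGF t ht
  obtain ⟨t, ht, hti⟩ := exists_gt_integrable_exp hμ hσ (hG σ hσa) hGF'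
  exact absurd (le_csSup hbdd (show t ∈ S from hti)) (not_le.2 ht)

/-- Uniqueness for Laplace transforms of nonnegative functions. -/
theorem ae_eq_of_laplace_eq {f g : ℝ → ℝ} (hf0 : ∀ u ∈ Ioi (0 : ℝ), 0 ≤ f u)
    (hg0 : ∀ u ∈ Ioi (0 : ℝ), 0 ≤ g u)
    (hf : ∀ δ > 0, IntegrableOn (fun u ↦ f u * Real.exp (-δ * u)) (Ioi 0))
    (hg : ∀ δ > 0, IntegrableOn (fun u ↦ g u * Real.exp (-δ * u)) (Ioi 0))
    (h : ∀ δ > 0, ∫ u in Ioi (0 : ℝ), f u * Real.exp (-δ * u)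
      = ∫ u in Ioi (0 : ℝ), g u * Real.exp (-δ * u)) :
    f =ᵐ[volume.restrict (Ioi 0)] g := by
  set ν : (ℝ → ℝ) → Measure ℝ := fun f ↦
    (volume.restrict (Ioi 0)).withDensity fun u ↦ ENNReal.ofReal (f u * Real.exp (-1 * u)) with hν
  have hmeas : ∀ {f : ℝ → ℝ},
      (∀ δ > 0, IntegrableOn (fun u ↦ f u * Real.exp (-δ * u)) (Ioi 0)) →
      AEMeasurable (fun u ↦ ENNReal.ofReal (f u * Real.exp (-1 * u))) (volume.restrict (Ioi 0)) :=
    fun hf ↦ (hf 1 one_pos).aestronglyMeasurable.aemeasurable.ennreal_ofReal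
  have hInt : ∀ {f : ℝ → ℝ}, (∀ u ∈ Ioi (0 : ℝ), 0 ≤ f u) →
      (∀ δ > 0, IntegrableOn (fun u ↦ f u * Real.exp (-δ * u)) (Ioi 0)) →
      ∀ t < 1, Integrable (fun u ↦ Real.exp (t * u)) (ν f) := by
    intro f hf0 hf t ht
    rw [hν, integrable_withDensity_iff_integrable_smul₀' (hmeas hf) (by simp)]
    refine (hf (1 - t) (by linarith)).congr ?_
    filter_upwards [ae_restrict_mem measurableSet_Ioi] with u hu
    rw [ENNReal.toReal_ofReal (mul_nonneg (hf0 u hu) (Real.exp_pos _).le), smul_eq_mul, mul_assoc,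
      ← Real.exp_add]
    ring_nf
  have hval : ∀ {f : ℝ → ℝ}, (∀ u ∈ Ioi (0 : ℝ), 0 ≤ f u) →
      (∀ δ > 0, IntegrableOn (fun u ↦ f u * Real.exp (-δ * u)) (Ioi 0)) →
      ∀ t : ℝ, t < 1 → complexMGF id (ν f) t
        = ((∫ u in Ioi (0 : ℝ), f u * Real.exp (-(1 - t) * u) : ℝ) : ℂ) := by
    intro f hf0 hf t ht
    rw [complexMGF_ofReal, mgf, hν,
      integral_withDensity_eq_integral_toReal_smul₀ (hmeas hf) (by simp)]
    congr 1
    refine integral_congr_ae ?_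
    filter_upwards [ae_restrict_mem measurableSet_Ioi] with u hu
    rw [ENNReal.toReal_ofReal (mul_nonneg (hf0 u hu) (Real.exp_pos _).le), smul_eq_mul, mul_assoc,
      ← Real.exp_add]
    simp only [id]
    ring_nf
  have hfin : ∀ {f : ℝ → ℝ}, (∀ u ∈ Ioi (0 : ℝ), 0 ≤ f u) →
      (∀ δ > 0, IntegrableOn (fun u ↦ f u * Real.exp (-δ * u)) (Ioi 0)) →
      IsFiniteMeasure (ν f) := by
    intro f hf0 hf
    have := hInt hf0 hf 0 (by norm_num)
    simp only [zero_mul, Real.exp_zero] at this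
    exact (integrable_const_iff_isFiniteMeasure one_ne_zero).1 this
  have hνeq : ν f = ν g := by
    have := hfin hf0 hf
    have := hfin hg0 hg
    refine Measure.ext_of_charFun (funext fun t ↦ ?_)
    rw [← complexMGF_id_mul_I, ← complexMGF_id_mul_I]
    have hA : ∀ {f : ℝ → ℝ}, (∀ u ∈ Ioi (0 : ℝ), 0 ≤ f u) →
        (∀ δ > 0, IntegrableOn (fun u ↦ f u * Real.exp (-δ * u)) (Ioi 0)) →
        AnalyticOnNhd ℂ (complexMGF id (ν f)) {z | z.re < 1} := by
      intro f hf0 hf z hz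
      refine analyticAt_complexMGF (interior_mono (s := Iio 1) (fun t ht ↦ hInt hf0 hf t ht) ?_)
      rw [interior_Iio]; exact hz
    refine (hA hf0 hf).eqOn_of_preconnected_of_eventuallyEq (hA hg0 hg)
      (convex_halfSpace_re_lt 1).isPreconnected (z₀ := ((0 : ℝ) : ℂ)) (by simp) ?_ (by simp)
    refine eventuallyEq_of_real_eventuallyEq (hA hf0 hf _ (by simp)) (hA hg0 hg _ (by simp)) ?_
    filter_upwards [Iio_mem_nhds (show (0 : ℝ) < 1 by norm_num)] with t ht
    rw [hval hf0 hf t ht, hval hg0 hg t ht, h _ (by simpa using ht)]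
  have := (withDensity_eq_iff (hmeas hf) (hmeas hg) (by
    have := (hf 1 one_pos).lintegral_lt_top
    simpa using this.ne)).1 hνeq
  filter_upwards [this, ae_restrict_mem measurableSet_Ioi] with u hu hu0
  rw [ENNReal.ofReal_eq_ofReal_iff (mul_nonneg (hf0 u hu0) (Real.exp_pos _).le)
    (mul_nonneg (hg0 u hu0) (Real.exp_pos _).le)] at hu
  exact mul_right_cancel₀ (Real.exp_pos _).ne' hu

end

/-! ### Laplace transforms of step functions -/

section

open MeasureTheory Set Filter Topology

lemma integrable_tsum_of_nonneg {α ι : Type*} [MeasurableSpace α] [Countable ι] {μ : Measure α}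
    {F : ι → α → ℝ} (hF : ∀ n, Integrable (F n) μ) (hF0 : ∀ᵐ x ∂μ, ∀ n, 0 ≤ F n x)
    (hs : ∀ᵐ x ∂μ, Summable fun n ↦ F n x) (hsum : Summable fun n ↦ ∫ x, F n x ∂μ) :
    Integrable (fun x ↦ ∑' n, F n x) μ ∧ ∫ x, ∑' n, F n x ∂μ = ∑' n, ∫ x, F n x ∂μ := by
  have hF0' : ∀ n, ∀ᵐ x ∂μ, 0 ≤ F n x := fun n ↦ hF0.mono fun x hx ↦ hx n
  have h0 : ∀ᵐ x ∂μ, 0 ≤ ∑' n, F n x := hF0.mono fun x hx ↦ tsum_nonneg hx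
  have hof : ∀ᵐ x ∂μ, ENNReal.ofReal (∑' n, F n x) = ∑' n, ENNReal.ofReal (F n x) := by
    filter_upwards [hF0, hs] with x h1 h2 using ENNReal.ofReal_tsum_of_nonneg h1 h2
  have hm : AEMeasurable (fun x ↦ ∑' n, ENNReal.ofReal (F n x)) μ :=
    AEMeasurable.tsum fun n ↦ (hF n).aestronglyMeasurable.aemeasurable.ennreal_ofReal
  refine ⟨⟨(hm.ennreal_toReal.congr ?_).aestronglyMeasurable, ?_⟩, ?_⟩
  · filter_upwards [hof, h0] with x h1 h2
    rw [← h1, ENNReal.toReal_ofReal h2]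
  · rw [hasFiniteIntegral_iff_ofReal h0, lintegral_congr_ae hof,
      lintegral_tsum fun n ↦ (hF n).aestronglyMeasurable.aemeasurable.ennreal_ofReal]
    have : ∀ n, ∫⁻ x, ENNReal.ofReal (F n x) ∂μ = ENNReal.ofReal (∫ x, F n x ∂μ) := fun n ↦
      (ofReal_integral_eq_lintegral_ofReal (hF n) (hF0' n)).symm
    simp_rw [this]
    rw [← ENNReal.ofReal_tsum_of_nonneg (fun n ↦ integral_nonneg_of_ae (hF0' n)) hsum]
    exact ENNReal.ofReal_lt_top
  · refine (hasSum_integral_of_summable_integral_norm hF (hsum.congr fun n ↦ ?_)).tsum_eq.symm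
    refine integral_congr_ae ?_
    filter_upwards [hF0' n] with x hx using (Real.norm_of_nonneg hx).symm

lemma tendsto_mul_exp_neg_mul_atTop {δ : ℝ} (hδ : 0 < δ) (a b : ℝ) :
    Tendsto (fun u ↦ (a * u + b) * Real.exp (-δ * u)) atTop (𝓝 0) := by
  have h1 := tendsto_rpow_mul_exp_neg_mul_atTop_nhds_zero 1 δ hδ
  have h2 := tendsto_rpow_mul_exp_neg_mul_atTop_nhds_zero 0 δ hδ
  simp only [Real.rpow_one, Real.rpow_zero] at h1 h2
  convert (h1.const_mul a).add (h2.const_mul b) using 2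
  · ring
  · simp

section

variable {a b δ ℓ : ℝ}

lemma hasDerivAt_linear_sub_exp (hδ : 0 < δ) (u : ℝ) :
    HasDerivAt (fun u ↦ -((a / δ * u + (a / δ ^ 2 + b / δ)) * Real.exp (-δ * u))
      + 1 / (1 + δ) * Real.exp (-(1 + δ) * u))
      ((a * u + b - Real.exp (-u)) * Real.exp (-δ * u)) u := by
  have h1 : HasDerivAt (fun u ↦ Real.exp (-δ * u)) (Real.exp (-δ * u) * (-δ)) u := by
    simpa using ((hasDerivAt_id u).const_mul (-δ)).exp
  have h2 : HasDerivAt (fun u ↦ Real.exp (-(1 + δ) * u))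
      (Real.exp (-(1 + δ) * u) * (-(1 + δ))) u := by
    simpa using ((hasDerivAt_id u).const_mul (-(1 + δ))).exp
  have h3 : HasDerivAt (fun u ↦ a / δ * u + (a / δ ^ 2 + b / δ)) (a / δ) u := by
    simpa using ((hasDerivAt_id u).const_mul (a / δ)).add_const (a / δ ^ 2 + b / δ)
  refine ((h3.mul h1).neg.add (h2.const_mul (1 / (1 + δ)))).congr_deriv ?_
  have h4 : Real.exp (-(1 + δ) * u) = Real.exp (-u) * Real.exp (-δ * u) := by
    rw [← Real.exp_add]; ring_nf
  rw [h4]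
  have : 1 + δ ≠ 0 := by positivity
  field_simp
  ring

lemma linear_sub_exp_nonneg (ha : 0 ≤ a) (hℓ : Real.exp (-ℓ) ≤ a * ℓ + b) {u : ℝ} (hu : ℓ ≤ u) :
    0 ≤ a * u + b - Real.exp (-u) := by
  have h1 : Real.exp (-u) ≤ Real.exp (-ℓ) := Real.exp_le_exp.2 (by linarith)
  have h2 : a * ℓ ≤ a * u := mul_le_mul_of_nonneg_left hu ha
  linarith

lemma tendsto_primitive_linear_sub_exp (hδ : 0 < δ) :
    Tendsto (fun u ↦ -((a / δ * u + (a / δ ^ 2 + b / δ)) * Real.exp (-δ * u))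
      + 1 / (1 + δ) * Real.exp (-(1 + δ) * u)) atTop (𝓝 0) := by
  have h1 := (tendsto_mul_exp_neg_mul_atTop hδ (a / δ) (a / δ ^ 2 + b / δ)).neg
  have h2 := tendsto_mul_exp_neg_mul_atTop (show 0 < 1 + δ by positivity) 0 (1 / (1 + δ))
  simpa using h1.add h2

lemma integrableOn_linear_sub_exp (ha : 0 ≤ a) (hδ : 0 < δ)
    (hℓ : Real.exp (-ℓ) ≤ a * ℓ + b) :
    IntegrableOn (fun u ↦ (a * u + b - Real.exp (-u)) * Real.exp (-δ * u)) (Ioi ℓ) :=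
  integrableOn_Ioi_deriv_of_nonneg' (fun u _ ↦ hasDerivAt_linear_sub_exp hδ u)
    (fun _ hu ↦ mul_nonneg (linear_sub_exp_nonneg ha hℓ (le_of_lt hu)) (Real.exp_pos _).le)
    (tendsto_primitive_linear_sub_exp hδ)

lemma integral_linear_sub_exp (ha : 0 ≤ a) (hδ : 0 < δ)
    (hℓ : Real.exp (-ℓ) ≤ a * ℓ + b) :
    ∫ u in Ioi ℓ, (a * u + b - Real.exp (-u)) * Real.exp (-δ * u)
      = Real.exp (-δ * ℓ) * (a * (ℓ / δ + 1 / δ ^ 2) + b / δ - Real.exp (-ℓ) / (1 + δ)) := by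
  rw [integral_Ioi_of_hasDerivAt_of_nonneg' (fun u _ ↦ hasDerivAt_linear_sub_exp hδ u)
    (fun _ hu ↦ mul_nonneg (linear_sub_exp_nonneg ha hℓ (le_of_lt hu)) (Real.exp_pos _).le)
    (tendsto_primitive_linear_sub_exp hδ)]
  have h4 : Real.exp (-(1 + δ) * ℓ) = Real.exp (-ℓ) * Real.exp (-δ * ℓ) := by
    rw [← Real.exp_add]; ring_nf
  rw [h4]
  have : 1 + δ ≠ 0 := by positivity
  field_simp
  ring

end

/-- Laplace transform of a sum of functions that start at the logarithms of the integers. -/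
theorem laplace_sum_floor_exp {c a b : ℕ → ℝ} (hc : ∀ n, 0 ≤ c n) (ha : ∀ n, 0 ≤ a n)
    (hab : ∀ n, c n ≠ 0 → 1 / n ≤ a n * Real.log n + b n) (hc0 : c 0 = 0)
    {δ : ℝ} (hδ : 0 < δ)
    (hs : Summable fun n : ℕ ↦ c n * (n : ℝ) ^ (-δ) *
      (a n * (Real.log n / δ + 1 / δ ^ 2) + b n / δ - 1 / n / (1 + δ))) :
    IntegrableOn (fun u ↦ (∑ n ∈ Finset.Icc 0 ⌊Real.exp u⌋₊,
      c n * (a n * u + b n - Real.exp (-u))) * Real.exp (-δ * u)) (Ioi 0) ∧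
    ∫ u in Ioi 0, (∑ n ∈ Finset.Icc 0 ⌊Real.exp u⌋₊,
      c n * (a n * u + b n - Real.exp (-u))) * Real.exp (-δ * u)
      = ∑' n : ℕ, c n * (n : ℝ) ^ (-δ) *
      (a n * (Real.log n / δ + 1 / δ ^ 2) + b n / δ - 1 / n / (1 + δ)) := by
  set F : ℕ → ℝ → ℝ := fun n ↦ (Ici (Real.log n)).indicator
    fun u ↦ c n * ((a n * u + b n - Real.exp (-u)) * Real.exp (-δ * u)) with hF
  have hn0 : ∀ n, c n ≠ 0 → n ≠ 0 := by rintro n h rfl; exact h hc0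
  have hexp : ∀ n : ℕ, n ≠ 0 → Real.exp (-Real.log n) = 1 / n := fun n hn ↦ by
    rw [Real.exp_neg, Real.exp_log (by positivity), one_div]
  have hsumeq : ∀ u, HasSum (fun n ↦ F n u) ((∑ n ∈ Finset.Icc 0 ⌊Real.exp u⌋₊,
      c n * (a n * u + b n - Real.exp (-u))) * Real.exp (-δ * u)) := by
    intro u
    have : (∑ n ∈ Finset.Icc 0 ⌊Real.exp u⌋₊,
      c n * (a n * u + b n - Real.exp (-u))) * Real.exp (-δ * u)
        = ∑ n ∈ Finset.Icc 0 ⌊Real.exp u⌋₊, F n u := by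
      rw [Finset.sum_mul]
      refine Finset.sum_congr rfl fun n hn ↦ ?_
      by_cases hcn : c n = 0
      · simp [hF, hcn]
      have h1 : (n : ℝ) ≤ Real.exp u :=
        (Nat.le_floor_iff (Real.exp_pos u).le).1 (Finset.mem_Icc.1 hn).2
      have h2 : Real.log n ≤ u := by
        rw [Real.log_le_iff_le_exp (by have := hn0 n hcn; positivity)]; exact h1
      simp only [hF]
      rw [indicator_of_mem (by exact h2)]
      ring
    rw [this]
    refine hasSum_sum_of_ne_finset_zero fun n hn ↦ ?_
    by_cases hcn : c n = 0
    · simp [hF, hcn]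
    simp only [hF]
    refine indicator_of_notMem (fun h ↦ hn ?_) _
    rw [Finset.mem_Icc]
    refine ⟨Nat.zero_le _, Nat.le_floor ?_⟩
    rw [← Real.log_le_iff_le_exp (by have := hn0 n hcn; positivity)]
    exact h
  have hF0 : ∀ n, 0 ≤ F n := by
    intro n
    by_cases hcn : c n = 0
    · exact fun u ↦ by simp [hF, hcn]
    refine fun u ↦ indicator_nonneg (fun u hu ↦ ?_) u
    refine mul_nonneg (hc n) (mul_nonneg (linear_sub_exp_nonneg (ha n) ?_ hu) (Real.exp_pos _).le)
    rw [hexp n (hn0 n hcn)]; exact hab n hcn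
  have hres : ∀ n, c n ≠ 0 → (∀ f : ℝ → ℝ, ∫ u in Ioi (0 : ℝ), (Ici (Real.log n)).indicator f u
      = ∫ u in Ioi (Real.log n), f u) ∧ ∀ f : ℝ → ℝ, IntegrableOn f (Ioi (Real.log n)) →
      IntegrableOn ((Ici (Real.log n)).indicator f) (Ioi 0) := by
    intro n hcn
    have hl : 0 ≤ Real.log n := Real.log_natCast_nonneg n
    have hae : (Ioi 0 ∩ Ici (Real.log n) : Set ℝ) =ᵐ[volume] Ioi (Real.log n) := by
      have h1 : (Ioi 0 ∩ Ici (Real.log n) : Set ℝ) =ᵐ[volume] (Ioi 0 ∩ Ioi (Real.log n) : Set ℝ) :=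
        (ae_eq_refl _).inter Ioi_ae_eq_Ici.symm
      rwa [Ioi_inter_Ioi, max_eq_right hl] at h1
    refine ⟨fun f ↦ ?_, fun f hf ↦ ?_⟩
    · rw [setIntegral_indicator measurableSet_Ici, setIntegral_congr_set hae]
    · rw [IntegrableOn, integrable_indicator_iff measurableSet_Ici, IntegrableOn,
        Measure.restrict_restrict measurableSet_Ici, inter_comm]
      exact hf.congr_set_ae hae
  have hFi : ∀ n, IntegrableOn (F n) (Ioi 0) := by
    intro n
    by_cases hcn : c n = 0
    · simp [hF, hcn]
    refine (hres n hcn).2 _ ((integrableOn_linear_sub_exp (ha n) hδ ?_).const_mul _)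
    rw [hexp n (hn0 n hcn)]; exact hab n hcn
  have hFv : ∀ n, ∫ u in Ioi 0, F n u = c n * (n : ℝ) ^ (-δ) *
      (a n * (Real.log n / δ + 1 / δ ^ 2) + b n / δ - 1 / n / (1 + δ)) := by
    intro n
    by_cases hcn : c n = 0
    · simp [hF, hcn]
    simp only [hF]
    rw [(hres n hcn).1, integral_const_mul, integral_linear_sub_exp (ha n) hδ
      (by rw [hexp n (hn0 n hcn)]; exact hab n hcn), hexp n (hn0 n hcn),
      Real.rpow_def_of_pos (by have := hn0 n hcn; positivity)]
    ring_nf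
  have hs' : Summable fun n ↦ ∫ u in Ioi 0, F n u := by simp_rw [hFv]; exact hs
  have h1 := integrable_tsum_of_nonneg hFi (Eventually.of_forall fun u n ↦ hF0 n u)
    (Eventually.of_forall fun u ↦ (hsumeq u).summable) hs'
  simp_rw [fun u ↦ (hsumeq u).tsum_eq, hFv] at h1
  exact h1

end

/-! ### Laplace transforms of sums over the von Mangoldt function -/

section

open MeasureTheory Set Filter Topology
open scoped ArithmeticFunction.vonMangoldt

/-- The entire function `δ ↦ δ ζ(1 + δ)`. -/
noncomputable def mulZeta : ℂ → ℂ := Function.update (fun δ ↦ δ * riemannZeta (1 + δ)) 0 1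

lemma mulZeta_of_ne_zero {δ : ℂ} (hδ : δ ≠ 0) : mulZeta δ = δ * riemannZeta (1 + δ) := by
  simp [mulZeta, hδ]

lemma mulZeta_zero : mulZeta 0 = 1 := by simp [mulZeta]

lemma mulZeta_eventuallyEq {δ : ℂ} (hδ : δ ≠ 0) :
    mulZeta =ᶠ[𝓝 δ] fun δ ↦ δ * riemannZeta (1 + δ) := by
  filter_upwards [isOpen_ne.mem_nhds hδ] with z hz using mulZeta_of_ne_zero hz

lemma differentiable_mulZeta : Differentiable ℂ mulZeta := by
  have h : DifferentiableOn ℂ mulZeta {0}ᶜ := by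
    intro δ hδ
    refine DifferentiableAt.differentiableWithinAt ?_
    refine DifferentiableAt.congr_of_eventuallyEq ?_ (mulZeta_eventuallyEq hδ)
    have := differentiableAt_riemannZeta (s := 1 + δ) (by simpa using hδ)
    fun_prop
  have h0 : ContinuousAt mulZeta 0 := by
    rw [mulZeta, continuousAt_update_same]
    have h1 := riemannZeta_residue_one
    have h2 : Tendsto (fun δ : ℂ ↦ 1 + δ) (𝓝[≠] 0) (𝓝[≠] 1) := by
      refine tendsto_nhdsWithin_of_tendsto_nhds_of_eventually_within _ ?_ ?_
      · have : Tendsto (fun δ : ℂ ↦ 1 + δ) (𝓝 0) (𝓝 (1 + 0)) := by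
          exact (continuous_const.add continuous_id).tendsto 0
        rw [add_zero] at this
        exact this.mono_left nhdsWithin_le_nhds
      · filter_upwards [self_mem_nhdsWithin] with δ hδ
        simpa using hδ
    simpa [Function.comp_def] using h1.comp h2
  intro δ
  rcases eq_or_ne δ 0 with rfl | hδ
  · refine (Complex.analyticAt_of_differentiable_on_punctured_nhds_of_continuousAt ?_
      h0).differentiableAt
    filter_upwards [self_mem_nhdsWithin] with δ hδ
    exact (h δ hδ).differentiableAt (isOpen_compl_singleton.mem_nhds hδ)
  · exact (h δ hδ).differentiableAt (isOpen_compl_singleton.mem_nhds hδ)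

section

variable {δ : ℝ} (hδ : 0 < δ)
include hδ

lemma summable_log_zeta : Summable fun n : ℕ ↦ Λ n / Real.log n * (n : ℝ) ^ (-(1 + δ)) := by
  have h : Summable fun n : ℕ ↦ (n : ℝ) ^ (-(1 + δ)) :=
    Real.summable_nat_rpow.2 (by linarith)
  refine Summable.of_nonneg_of_le (fun n ↦ ?_) (fun n ↦ ?_) h
  · have := ArithmeticFunction.vonMangoldt_nonneg (n := n)
    have := Real.log_natCast_nonneg n
    positivity
  · refine mul_le_of_le_one_left (by positivity) ?_
    exact div_le_one_of_le₀ ArithmeticFunction.vonMangoldt_le_log (Real.log_natCast_nonneg n)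

lemma summable_vonMangoldt : Summable fun n : ℕ ↦ Λ n * (n : ℝ) ^ (-(1 + δ)) := by
  have h := (ArithmeticFunction.LSeriesSummable_vonMangoldt (s := ((1 + δ : ℝ) : ℂ))
    (by simpa using hδ)).norm
  refine h.congr fun n ↦ ?_
  rcases eq_or_ne n 0 with rfl | hn
  · simp
  rw [LSeries.norm_term_eq, if_neg hn, Real.rpow_neg (by positivity)]
  simp [abs_of_nonneg (ArithmeticFunction.vonMangoldt_nonneg (n := n)), div_eq_mul_inv]

omit hδ in
lemma LSeries_ofReal_eq (f : ℕ → ℝ) (hf : f 0 = 0) :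
    LSeries (fun n ↦ (f n : ℂ)) ((1 + δ : ℝ) : ℂ)
      = ((∑' n : ℕ, f n * (n : ℝ) ^ (-(1 + δ)) : ℝ) : ℂ) := by
  rw [LSeries, Complex.ofReal_tsum]
  refine tsum_congr fun n ↦ ?_
  rcases eq_or_ne n 0 with rfl | hn
  · simp [hf]
  rw [LSeries.term_of_ne_zero hn, Real.rpow_neg (by positivity)]
  push_cast
  rw [Complex.ofReal_cpow (by positivity)]
  push_cast
  rw [div_eq_mul_inv]

lemma riemannZeta_one_add_eq_exp :
    riemannZeta (1 + δ) =
      ((Real.exp (∑' n : ℕ, Λ n / Real.log n * (n : ℝ) ^ (-(1 + δ))) : ℝ) : ℂ) := by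
  have h := riemannZeta_eq_exp_LSeries (s := ((1 + δ : ℝ) : ℂ)) (by simpa using hδ)
  have h2 := LSeries_ofReal_eq (δ := δ) (fun n ↦ Λ n / Real.log n) (by simp)
  push_cast at h h2 ⊢
  rw [← h2]
  exact h.symm

lemma tsum_log_zeta :
    ((∑' n : ℕ, Λ n / Real.log n * (n : ℝ) ^ (-(1 + δ)) : ℝ) : ℂ)
      = Complex.log (mulZeta δ) - Real.log δ := by
  have h := riemannZeta_one_add_eq_exp hδ
  have h0 : (δ : ℂ) ≠ 0 := by exact_mod_cast hδ.ne'
  rw [mulZeta_of_ne_zero h0, h, ← Complex.ofReal_mul, ← Complex.ofReal_log (by positivity),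
    Real.log_mul hδ.ne' (Real.exp_pos _).ne', Real.log_exp]
  push_cast; ring

lemma mulZeta_mem_slitPlane_of_pos : mulZeta δ ∈ Complex.slitPlane := by
  have h0 : (δ : ℂ) ≠ 0 := by exact_mod_cast hδ.ne'
  rw [mulZeta_of_ne_zero h0, riemannZeta_one_add_eq_exp hδ, ← Complex.ofReal_mul,
    Complex.ofReal_mem_slitPlane]
  positivity

lemma tsum_vonMangoldt :
    ((∑' n : ℕ, Λ n * (n : ℝ) ^ (-(1 + δ)) : ℝ) : ℂ) = 1 / δ - logDeriv mulZeta δ := by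
  have h0 : (δ : ℂ) ≠ 0 := by exact_mod_cast hδ.ne'
  have h := ArithmeticFunction.LSeries_vonMangoldt_eq_deriv_riemannZeta_div
    (s := ((1 + δ : ℝ) : ℂ)) (by simpa using hδ)
  rw [LSeries_ofReal_eq (fun n ↦ Λ n) (by simp)] at h
  rw [h]
  have hz : riemannZeta (1 + δ) ≠ 0 := by
    rw [riemannZeta_one_add_eq_exp hδ]; exact_mod_cast (Real.exp_pos _).ne'
  have hd : DifferentiableAt ℂ riemannZeta (1 + (δ : ℂ)) :=
    differentiableAt_riemannZeta (by simpa using h0)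
  have hd' : HasDerivAt (fun z : ℂ ↦ riemannZeta (1 + z)) (deriv riemannZeta (1 + δ)) δ :=
    hd.hasDerivAt.comp_const_add 1 (δ : ℂ)
  have hm := (hasDerivAt_id (δ : ℂ)).mul hd'
  rw [logDeriv_apply, (mulZeta_eventuallyEq h0).deriv_eq, mulZeta_of_ne_zero h0]
  have : deriv (fun z : ℂ ↦ z * riemannZeta (1 + z)) δ = _ := hm.deriv
  rw [this]
  push_cast
  simp only [id]
  field_simp
  ring

omit hδ in
lemma integral_mul_log_mul_exp_neg :
    ∫ u in Ioi (0 : ℝ), u * Real.log u * Real.exp (-u) = 1 - Real.eulerMascheroniConstant := by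
  have h := Complex.hasDerivAt_GammaIntegral (s := 2) (by simp)
  have h2 : HasDerivAt Complex.Gamma (1 - Real.eulerMascheroniConstant) 2 := by
    have h1 : HasDerivAt (fun s : ℂ ↦ s * Complex.Gamma s)
        (1 * Complex.Gamma 1 + 1 * (-Real.eulerMascheroniConstant)) 1 :=
      (hasDerivAt_id (1 : ℂ)).mul Complex.hasDerivAt_Gamma_one
    have h3 : HasDerivAt (fun s : ℂ ↦ Complex.Gamma (s + 1))
        (1 * Complex.Gamma 1 + 1 * (-Real.eulerMascheroniConstant)) 1 := by
      refine h1.congr_of_eventuallyEq ?_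
      filter_upwards [isOpen_ne.mem_nhds (one_ne_zero (α := ℂ))] with s hs
      exact Complex.Gamma_add_one s hs
    have h4 : HasDerivAt (fun s : ℂ ↦ Complex.Gamma (s - 1 + 1))
        (1 * Complex.Gamma 1 + 1 * (-Real.eulerMascheroniConstant)) 2 := by
      refine HasDerivAt.comp_sub_const (f := fun s ↦ Complex.Gamma (s + 1)) 2 1 ?_
      rw [show (2 : ℂ) - 1 = 1 by norm_num]
      exact h3
    simp only [sub_add_cancel, Complex.Gamma_one] at h4
    exact h4.congr_deriv (by ring)
  have h5 : HasDerivAt Complex.GammaIntegral (1 - Real.eulerMascheroniConstant) 2 := by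
    refine h2.congr_of_eventuallyEq ?_
    filter_upwards [(isOpen_lt continuous_const Complex.continuous_re).mem_nhds
      (show (0 : ℝ) < (2 : ℂ).re by simp)] with s hs
    exact (Complex.Gamma_eq_integral hs).symm
  have h6 := h.unique h5
  have h7 : ∫ t in Ioi (0 : ℝ), (t : ℂ) ^ ((2 : ℂ) - 1) * (Real.log t * Real.exp (-t))
      = ((∫ u in Ioi (0 : ℝ), u * Real.log u * Real.exp (-u) : ℝ) : ℂ) := by
    rw [← integral_complex_ofReal]
    refine integral_congr_ae (Eventually.of_forall fun u ↦ ?_)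
    norm_num [show (2 : ℂ) - 1 = 1 by norm_num]
    ring
  rw [h7] at h6
  exact_mod_cast h6

omit hδ in
lemma integrableOn_mul_log_mul_exp_neg :
    IntegrableOn (fun u ↦ u * Real.log u * Real.exp (-u)) (Ioi (0 : ℝ)) := by
  refine Integrable.of_integral_ne_zero ?_
  rw [integral_mul_log_mul_exp_neg]
  have := Real.eulerMascheroniConstant_lt_two_thirds
  linarith

end

end

/-! ### The Mertens remainder and its Laplace transform -/

section

open MeasureTheory Set Filter Topology
open scoped ArithmeticFunction.vonMangoldt

/-- The weighted sum `Σ_{n ≤ e^u} Λ(n) (u / (n log n) - e^{-u})`. -/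
noncomputable def mertensSum (u : ℝ) : ℝ :=
  ∑ n ∈ Finset.Icc 0 ⌊Real.exp u⌋₊, Λ n * (1 / (n * Real.log n) * u - Real.exp (-u))

/-- The remainder `u (Σ_{n ≤ e^u} Λ(n) / (n log n) - log u - γ) - (ψ(e^u) / e^u - 1)`. -/
noncomputable def mertensRemainder (u : ℝ) : ℝ :=
  mertensSum u - (u * Real.log u + Real.eulerMascheroniConstant * u - 1)

section

variable {δ : ℝ} (hδ : 0 < δ)
include hδ

lemma hasIntegral_mul_log :
    IntegrableOn (fun u ↦ u * Real.log u * Real.exp (-δ * u)) (Ioi 0) ∧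
    ∫ u in Ioi (0 : ℝ), u * Real.log u * Real.exp (-δ * u)
      = (1 - Real.eulerMascheroniConstant - Real.log δ) / δ ^ 2 := by
  have hg1 := Real.GammaIntegral_convergent (s := 2) (by norm_num)
  have hg2 : ∫ u in Ioi (0 : ℝ), Real.exp (-u) * u = 1 := by
    have := Real.Gamma_eq_integral (s := 2) (by norm_num)
    rw [Real.Gamma_two] at this
    rw [this]
    refine setIntegral_congr_fun measurableSet_Ioi fun u _ ↦ ?_
    norm_num
  have hg1' : IntegrableOn (fun u ↦ Real.exp (-u) * u) (Ioi (0 : ℝ)) := by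
    refine hg1.congr_fun (fun u _ ↦ ?_) measurableSet_Ioi
    norm_num
  have key : ∀ u ∈ Ioi (0 : ℝ), u * Real.log u * Real.exp (-δ * u)
      = (fun v ↦ (1 / δ) * (v * Real.log v * Real.exp (-v) - Real.log δ * (Real.exp (-v) * v)))
        (δ * u) := by
    intro u hu
    have hu : 0 < u := hu
    simp only
    rw [Real.log_mul hδ.ne' hu.ne']
    field_simp
    ring_nf
  have hint : IntegrableOn (fun v ↦ (1 / δ) * (v * Real.log v * Real.exp (-v) -
      Real.log δ * (Real.exp (-v) * v))) (Ioi 0) :=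
    (integrableOn_mul_log_mul_exp_neg.sub (hg1'.const_mul _)).const_mul _
  constructor
  · refine IntegrableOn.congr_fun ?_ (fun u hu ↦ (key u hu).symm) measurableSet_Ioi
    refine (integrableOn_Ioi_comp_mul_left_iff (fun v : ℝ ↦ (1 / δ) * (v * Real.log v *
      Real.exp (-v) - Real.log δ * (Real.exp (-v) * v))) 0 hδ).2 ?_
    simpa using hint
  · rw [setIntegral_congr_fun measurableSet_Ioi key, integral_comp_mul_left_Ioi
      (fun v : ℝ ↦ (1 / δ) * (v * Real.log v * Real.exp (-v) - Real.log δ * (Real.exp (-v) * v)))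
      0 hδ, mul_zero,
      integral_const_mul, integral_sub integrableOn_mul_log_mul_exp_neg (hg1'.const_mul _),
      integral_mul_log_mul_exp_neg, integral_const_mul, hg2]
    simp only [smul_eq_mul]
    field_simp

lemma hasIntegral_mul :
    IntegrableOn (fun u ↦ u * Real.exp (-δ * u)) (Ioi 0) ∧
    ∫ u in Ioi (0 : ℝ), u * Real.exp (-δ * u) = 1 / δ ^ 2 := by
  have h := Real.integral_rpow_mul_exp_neg_mul_Ioi (a := 2) (by norm_num) hδ
  have e : ∀ u ∈ Ioi (0 : ℝ), u ^ ((2 : ℝ) - 1) * Real.exp (-(δ * u)) = u * Real.exp (-δ * u) := by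
    intro u _
    norm_num
  rw [setIntegral_congr_fun measurableSet_Ioi e] at h
  have h2 : ∫ u in Ioi (0 : ℝ), u * Real.exp (-δ * u) = 1 / δ ^ 2 := by
    rw [h, Real.Gamma_two, mul_one]
    norm_num
  refine ⟨?_, h2⟩
  refine Integrable.of_integral_ne_zero ?_
  rw [h2]
  positivity

lemma hasIntegral_exp :
    IntegrableOn (fun u ↦ Real.exp (-δ * u)) (Ioi 0) ∧
    ∫ u in Ioi (0 : ℝ), Real.exp (-δ * u) = 1 / δ := by
  have h : ∫ u in Ioi (0 : ℝ), Real.exp (-δ * u) = 1 / δ := by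
    rw [integral_exp_mul_Ioi (by linarith)]
    simp
  refine ⟨?_, h⟩
  refine Integrable.of_integral_ne_zero ?_
  rw [h]
  positivity

lemma mertensSum_laplace :
    IntegrableOn (fun u ↦ mertensSum u * Real.exp (-δ * u)) (Ioi 0) ∧
    ((∫ u in Ioi 0, mertensSum u * Real.exp (-δ * u) : ℝ) : ℂ)
      = (1 / δ - logDeriv mulZeta δ) / (δ * (1 + δ))
        + (Complex.log (mulZeta δ) - Real.log δ) / δ ^ 2 := by
  have hterm : ∀ n : ℕ, Λ n * (n : ℝ) ^ (-δ) *
      (1 / (n * Real.log n) * (Real.log n / δ + 1 / δ ^ 2) + 0 / δ - 1 / n / (1 + δ))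
      = Λ n * (n : ℝ) ^ (-(1 + δ)) * (1 / (δ * (1 + δ)))
        + Λ n / Real.log n * (n : ℝ) ^ (-(1 + δ)) * (1 / δ ^ 2) := by
    intro n
    by_cases hΛ : Λ n = 0
    · simp [hΛ]
    have hn : 1 < n := by
      by_contra! hn
      interval_cases n <;> simp at hΛ
    have hlog : 0 < Real.log n := Real.log_pos (by exact_mod_cast hn)
    have hn0 : (0 : ℝ) < n := by positivity
    have : (n : ℝ) ^ (-(1 + δ)) = (n : ℝ) ^ (-δ) / n := by
      rw [neg_add, add_comm, Real.rpow_add hn0, Real.rpow_neg_one, div_eq_mul_inv]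
    rw [this]
    have : (1 + δ) ≠ 0 := by positivity
    field_simp
    ring
  have hs1 := (summable_vonMangoldt hδ).mul_right (1 / (δ * (1 + δ)))
  have hs2 := (summable_log_zeta hδ).mul_right (1 / δ ^ 2)
  have h := laplace_sum_floor_exp (c := fun n ↦ Λ n) (a := fun n ↦ 1 / (n * Real.log n))
    (b := fun _ ↦ 0) (fun n ↦ ArithmeticFunction.vonMangoldt_nonneg)
    (fun n ↦ by have := Real.log_natCast_nonneg n; positivity)
    (fun n hn ↦ by
      have h1 : 1 < n := by
        by_contra! h1
        interval_cases n <;> simp at hn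
      have hlog : 0 < Real.log n := Real.log_pos (by exact_mod_cast h1)
      rw [add_zero]
      apply le_of_eq
      field_simp)
    (by simp) hδ (by
      refine (hs1.add hs2).congr fun n ↦ ?_
      exact (hterm n).symm)
  simp only [add_zero] at h
  refine ⟨h.1, ?_⟩
  have h2 := h.2
  simp only [mertensSum]
  rw [h2]
  have : ∀ n : ℕ, Λ n * (n : ℝ) ^ (-δ) *
      (1 / (n * Real.log n) * (Real.log n / δ + 1 / δ ^ 2) + 0 / δ - 1 / n / (1 + δ)) = _ := hterm
  rw [tsum_congr this, hs1.tsum_add hs2, tsum_mul_right, tsum_mul_right]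
  rw [Complex.ofReal_add, Complex.ofReal_mul, Complex.ofReal_mul, tsum_vonMangoldt hδ,
    tsum_log_zeta hδ]
  push_cast
  ring

theorem mertensRemainder_laplace :
    IntegrableOn (fun u ↦ mertensRemainder u * Real.exp (-δ * u)) (Ioi 0) ∧
    ((∫ u in Ioi 0, mertensRemainder u * Real.exp (-δ * u) : ℝ) : ℂ)
      = 1 / (1 + δ) + Complex.log (mulZeta δ) / δ ^ 2 - logDeriv mulZeta δ / (δ * (1 + δ)) := by
  obtain ⟨i1, e1⟩ := mertensSum_laplace hδ
  obtain ⟨i2, e2⟩ := hasIntegral_mul_log hδ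
  obtain ⟨i3, e3⟩ := hasIntegral_mul hδ
  obtain ⟨i4, e4⟩ := hasIntegral_exp hδ
  have key : ∀ u, mertensRemainder u * Real.exp (-δ * u) = mertensSum u * Real.exp (-δ * u)
      - (u * Real.log u * Real.exp (-δ * u) + Real.eulerMascheroniConstant *
        (u * Real.exp (-δ * u)) - Real.exp (-δ * u)) := by
    intro u
    rw [mertensRemainder]
    ring
  have i5 := (i2.add (i3.const_mul Real.eulerMascheroniConstant))
  simp only [key]
  refine ⟨i1.sub (i5.sub i4), ?_⟩
  have e : ∫ u in Ioi 0, (mertensSum u * Real.exp (-δ * u)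
      - (u * Real.log u * Real.exp (-δ * u) + Real.eulerMascheroniConstant *
        (u * Real.exp (-δ * u)) - Real.exp (-δ * u)))
      = (∫ u in Ioi 0, mertensSum u * Real.exp (-δ * u))
        - ((1 - Real.eulerMascheroniConstant - Real.log δ) / δ ^ 2
          + Real.eulerMascheroniConstant * (1 / δ ^ 2) - 1 / δ) := by
    refine (integral_sub i1 (i5.sub i4)).trans ?_
    have : ∫ u in Ioi 0, (u * Real.log u * Real.exp (-δ * u) + Real.eulerMascheroniConstant *
        (u * Real.exp (-δ * u)) - Real.exp (-δ * u)) = _ := integral_sub i5 i4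
    refine congrArg₂ _ rfl ?_
    have h2 := integral_add i2 (i3.const_mul Real.eulerMascheroniConstant)
    rw [integral_const_mul] at h2
    refine Eq.trans this ?_
    rw [h2, e2, e3, e4]
  rw [e, Complex.ofReal_sub, e1]
  have h0 : (δ : ℂ) ≠ 0 := by exact_mod_cast hδ.ne'
  have h1 : (1 + δ : ℂ) ≠ 0 := by
    have : (1 + δ : ℝ) ≠ 0 := by positivity
    exact_mod_cast this
  push_cast
  field_simp
  ring

end

end

/-! ### Harmonic numbers and Euler's constant -/

section

open Filter Topology

lemma two_mul_le_log_div {x : ℝ} (hx : 0 ≤ x) (hx1 : x < 1) :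
    2 * x ≤ Real.log ((1 + x) / (1 - x)) := by
  rw [Real.log_div (by linarith) (by linarith)]
  have h := Real.hasSum_log_sub_log_of_abs_lt_one (x := x) (by rwa [abs_of_nonneg hx])
  have := h.summable.sum_le_tsum (Finset.range 1) fun i _ ↦ by positivity
  rw [h.tsum_eq] at this
  simpa using this

lemma log_one_add_le_half {x : ℝ} (hx : 0 ≤ x) : Real.log (1 + x) ≤ (x + x / (1 + x)) / 2 := by
  set f : ℝ → ℝ := fun y ↦ (y + y / (1 + y)) / 2 - Real.log (1 + y) with hf
  have hd : ∀ y, 0 ≤ y → HasDerivAt f (y ^ 2 / (2 * (1 + y) ^ 2)) y := by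
    intro y hy
    have h0 : 1 + y ≠ 0 := by positivity
    have h1 := (hasDerivAt_id' y).const_add 1
    refine ((((hasDerivAt_id' y).add ((hasDerivAt_id' y).div h1 h0)).div_const 2).sub
      (h1.log h0)).congr_deriv ?_
    field_simp
    ring
  have hm : MonotoneOn f (Set.Ici 0) := by
    refine monotoneOn_of_deriv_nonneg (convex_Ici 0)
      (fun y hy ↦ (hd y hy).continuousAt.continuousWithinAt) (fun y hy ↦ ?_) fun y hy ↦ ?_
    · rw [interior_Ici] at hy
      exact (hd y hy.le).differentiableAt.differentiableWithinAt
    · rw [interior_Ici] at hy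
      rw [(hd y hy.le).deriv]
      positivity
  have := hm Set.self_mem_Ici hx hx
  simp only [hf] at this
  norm_num at this
  linarith

lemma harmonic_succ_real (n : ℕ) : (harmonic (n + 1) : ℝ) = harmonic n + 1 / (n + 1) := by
  rw [harmonic_succ]
  push_cast
  ring

lemma eulerMascheroniConstant_le_harmonic_sub (n : ℕ) :
    Real.eulerMascheroniConstant ≤ harmonic n - Real.log (n + 1 / 2) := by
  have ha : Antitone fun n : ℕ ↦ (harmonic n : ℝ) - Real.log (n + 1 / 2) := by
    refine antitone_nat_of_succ_le fun n ↦ ?_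
    have h := two_mul_le_log_div (x := 1 / (2 * (n + 1))) (by positivity)
      (by rw [div_lt_one (by positivity)]; linarith [(n.cast_nonneg : (0 : ℝ) ≤ n)])
    have e : (1 + 1 / (2 * (n + 1)) : ℝ) / (1 - 1 / (2 * (n + 1))) =
        ((n + 1 : ℕ) + 1 / 2) / (n + 1 / 2) := by
      have : (2 * ((n : ℝ) + 1) - 1) ≠ 0 := by
        have : (0 : ℝ) ≤ n := n.cast_nonneg
        linarith
      push_cast
      field_simp
      ring
    rw [e, Real.log_div (by positivity) (by positivity)] at h
    have e2 : 2 * (1 / (2 * ((n : ℝ) + 1))) = 1 / (n + 1) := by field_simp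
    simp only [harmonic_succ_real]
    linarith
  have hc : Tendsto (fun n : ℕ ↦ Real.log ((n : ℝ) + 1 / 2) - Real.log n) atTop (𝓝 0) :=
    (Real.tendsto_log_comp_add_sub_log (1 / 2)).comp tendsto_natCast_atTop_atTop
  have hl : Tendsto (fun n : ℕ ↦ (harmonic n : ℝ) - Real.log (n + 1 / 2)) atTop
      (𝓝 Real.eulerMascheroniConstant) := by
    have := Real.tendsto_harmonic_sub_log.sub hc
    rw [sub_zero] at this
    exact this.congr fun n ↦ by ring
  exact ha.le_of_tendsto hl n

lemma harmonic_sub_le_eulerMascheroniConstant {n : ℕ} (hn : 0 < n) :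
    (harmonic n : ℝ) - Real.log n - 1 / (2 * n) ≤ Real.eulerMascheroniConstant := by
  have hm : Monotone fun n : ℕ ↦ (harmonic (n + 1) : ℝ) - Real.log (n + 1 : ℕ) -
      1 / (2 * (n + 1 : ℕ)) := by
    refine monotone_nat_of_le_succ fun n ↦ ?_
    have h := log_one_add_le_half (x := 1 / (n + 1)) (by positivity)
    have e : (1 + 1 / (n + 1) : ℝ) = (n + 1 + 1 : ℕ) / (n + 1 : ℕ) := by
      push_cast
      field_simp
    rw [e, Real.log_div (by positivity) (by positivity)] at h
    have e2 : (1 / ((n : ℝ) + 1) + 1 / (n + 1) / ((n + 1 + 1 : ℕ) / (n + 1 : ℕ))) / 2 =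
        1 / (2 * (n + 1)) + 1 / (2 * (n + 1 + 1)) := by
      push_cast
      field_simp
    rw [e2] at h
    have e3 : 1 / ((n : ℝ) + 1 + 1) = 1 / (2 * (n + 1 + 1)) + 1 / (2 * (n + 1 + 1)) := by
      field_simp
      ring
    simp only [harmonic_succ_real (n + 1)]
    push_cast at h ⊢
    linarith
  have hl : Tendsto (fun n : ℕ ↦ (harmonic (n + 1) : ℝ) - Real.log (n + 1 : ℕ) -
      1 / (2 * (n + 1 : ℕ))) atTop (𝓝 Real.eulerMascheroniConstant) := by
    have h1 := Real.tendsto_harmonic_sub_log.comp (tendsto_add_atTop_nat 1)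
    have h2 := ((tendsto_one_div_add_atTop_nhds_zero_nat (𝕜 := ℝ)).div_const 2)
    have := h1.sub h2
    rw [zero_div, sub_zero] at this
    refine this.congr fun n ↦ ?_
    simp only [Function.comp_apply]
    push_cast
    field_simp
  obtain ⟨m, rfl⟩ := Nat.exists_eq_add_of_lt hn
  simpa using hm.ge_of_tendsto hl m

lemma eulerMascheroniConstant_lt : Real.eulerMascheroniConstant < 0.578 := by
  have h := eulerMascheroniConstant_le_harmonic_sub 16
  have e : Real.log ((16 : ℕ) + 1 / 2) = 4 * Real.log 2 + Real.log (33 / 32) := by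
    rw [show (((16 : ℕ) : ℝ) + 1 / 2) = 2 ^ 4 * (33 / 32) by norm_num,
      Real.log_mul (by norm_num) (by norm_num), Real.log_pow]
    norm_num
  have h1 := Real.one_sub_inv_le_log_of_pos (x := 33 / 32) (by norm_num)
  have h2 := Real.log_two_gt_d9
  rw [e] at h
  norm_num [harmonic, Finset.sum_range_succ] at h h1
  linarith

lemma eulerMascheroniConstant_gt_d4 : 0.5772 < Real.eulerMascheroniConstant := by
  have h := harmonic_sub_le_eulerMascheroniConstant (n := 128) (by norm_num)
  have e : Real.log (128 : ℕ) = 7 * Real.log 2 := by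
    rw [show ((128 : ℕ) : ℝ) = 2 ^ 7 by norm_num, Real.log_pow]
    norm_num
  have h2 := Real.log_two_lt_d9
  have h3 : (543314 / 100000 : ℚ) ≤ harmonic 128 := by decide +kernel
  have h4 : ((543314 / 100000 : ℚ) : ℝ) ≤ (harmonic 128 : ℝ) := by exact_mod_cast h3
  rw [e] at h
  push_cast at h h4
  norm_num only at h h4
  linarith

end

/-! ### The entire xi function -/

section

open MeasureTheory Set Filter Topology

/-- The kernel whose Mellin transform is twice the entire completed zeta function. -/
noncomputable def thetaModif (x : ℝ) : ℝ :=
  (Ioi 1).indicator (fun x ↦ HurwitzZeta.evenKernel 0 x - 1) x +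
  (Ioo 0 1).indicator (fun x ↦ HurwitzZeta.evenKernel 0 x - x ^ (-(1 / 2) : ℝ)) x

lemma f_modif_eq_thetaModif (x : ℝ) :
    (HurwitzZeta.hurwitzEvenFEPair 0).f_modif x = (thetaModif x : ℂ) := by
  have h0 : (HurwitzZeta.hurwitzEvenFEPair 0).f₀ = 1 := if_pos rfl
  simp only [WeakFEPair.f_modif, thetaModif, Pi.add_apply, h0, indicator_apply]
  split_ifs <;> simp [HurwitzZeta.hurwitzEvenFEPair]

lemma thetaModif_nonneg {x : ℝ} (hx : 0 < x) : 0 ≤ thetaModif x := by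
  have h1 : ∀ y : ℝ, 0 < y → 1 ≤ HurwitzZeta.evenKernel 0 y := by
    intro y hy
    have h := HurwitzZeta.hasSum_int_evenKernel₀ 0 hy
    have h2 := h.nonneg (fun n ↦ by split_ifs <;> positivity)
    simpa using h2
  rw [thetaModif]
  refine add_nonneg (indicator_apply_nonneg fun _ ↦ sub_nonneg.2 (h1 x hx))
    (indicator_apply_nonneg fun _ ↦ sub_nonneg.2 ?_)
  rw [HurwitzZeta.evenKernel_functional_equation, ← HurwitzZeta.evenKernel_eq_cosKernel_of_zero,
    Real.rpow_neg hx.le, ← one_div]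
  exact le_mul_of_one_le_right (by positivity) (h1 _ (by positivity))

lemma integrableOn_thetaModif (σ : ℝ) :
    IntegrableOn (fun x ↦ x ^ (σ / 2 - 1) * thetaModif x) (Ioi 0) := by
  have h := (HurwitzZeta.hurwitzEvenFEPair 0).isStrongFEPair_toStrongFEPair.hasMellin
    ((σ / 2 : ℝ) : ℂ) |>.1
  refine IntegrableOn.congr_fun (Integrable.norm h) (fun x hx ↦ ?_) measurableSet_Ioi
  have hx : 0 < x := hx
  have e : (HurwitzZeta.hurwitzEvenFEPair 0).toStrongFEPair.f x = (thetaModif x : ℂ) :=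
    f_modif_eq_thetaModif x
  rw [norm_smul, e, Complex.norm_cpow_eq_rpow_re_of_pos hx, Complex.norm_real,
    Real.norm_of_nonneg (thetaModif_nonneg hx)]
  simp

/-- The values of the entire completed zeta function on the real axis. -/
noncomputable def realLambda (σ : ℝ) : ℝ := (∫ x in Ioi (0 : ℝ), x ^ (σ / 2 - 1) * thetaModif x) / 2

lemma completedRiemannZeta₀_eq_mellin (s : ℂ) :
    completedRiemannZeta₀ s =
      (∫ x in Ioi (0 : ℝ), (x : ℂ) ^ (s / 2 - 1) * (thetaModif x : ℂ)) / 2 := by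
  have : completedRiemannZeta₀ s = (mellin (HurwitzZeta.hurwitzEvenFEPair 0).f_modif (s / 2)) / 2 :=
    rfl
  rw [this, mellin]
  simp_rw [f_modif_eq_thetaModif, smul_eq_mul]

lemma completedRiemannZeta₀_ofReal (σ : ℝ) : completedRiemannZeta₀ σ = realLambda σ := by
  rw [completedRiemannZeta₀_eq_mellin, realLambda, Complex.ofReal_div, ← integral_complex_ofReal]
  congr 1
  refine setIntegral_congr_fun measurableSet_Ioi fun x hx ↦ ?_
  have hx : 0 < x := hx
  rw [Complex.ofReal_mul, Complex.ofReal_cpow hx.le]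
  push_cast
  rfl

lemma norm_completedRiemannZeta₀_le (s : ℂ) : ‖completedRiemannZeta₀ s‖ ≤ realLambda s.re := by
  rw [completedRiemannZeta₀_eq_mellin, realLambda, norm_div]
  simp only [Complex.norm_ofNat]
  gcongr
  refine (norm_integral_le_integral_norm _).trans (le_of_eq ?_)
  refine setIntegral_congr_fun measurableSet_Ioi fun x hx ↦ ?_
  have hx : 0 < x := hx
  rw [norm_mul, Complex.norm_cpow_eq_rpow_re_of_pos hx, Complex.norm_real,
    Real.norm_of_nonneg (thetaModif_nonneg hx)]
  simp

lemma realLambda_le_add {a b σ : ℝ} (ha : a ≤ σ) (hb : σ ≤ b) :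
    realLambda σ ≤ realLambda a + realLambda b := by
  rw [realLambda, realLambda, realLambda, ← add_div,
    ← integral_add (integrableOn_thetaModif a) (integrableOn_thetaModif b)]
  refine div_le_div_of_nonneg_right ?_ zero_le_two
  refine setIntegral_mono_on (integrableOn_thetaModif σ)
    ((integrableOn_thetaModif a).add (integrableOn_thetaModif b)) measurableSet_Ioi fun x hx ↦ ?_
  have hx : 0 < x := hx
  have h0 := thetaModif_nonneg hx
  rw [← add_mul]
  refine mul_le_mul_of_nonneg_right ?_ h0
  rcases le_total x 1 with h | h
  · have := Real.rpow_le_rpow_of_exponent_ge hx h (show a / 2 - 1 ≤ σ / 2 - 1 by linarith)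
    have : 0 ≤ x ^ (b / 2 - 1) := by positivity
    linarith
  · have := Real.rpow_le_rpow_of_exponent_le h (show σ / 2 - 1 ≤ b / 2 - 1 by linarith)
    have : 0 ≤ x ^ (a / 2 - 1) := by positivity
    linarith

lemma realLambda_one :
    realLambda 1 = (Real.eulerMascheroniConstant - Real.log (4 * Real.pi)) / 2 + 1 := by
  have h := completedRiemannZeta₀_ofReal 1
  rw [Complex.ofReal_one, completedRiemannZeta₀_one, ← Complex.ofReal_ofNat 4,
    ← Complex.ofReal_mul, ← Complex.ofReal_log (by positivity)] at h
  exact_mod_cast h.symm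

lemma realLambda_zero : realLambda 0 = realLambda 1 := by
  have h := completedRiemannZeta₀_one_sub 1
  rw [sub_self] at h
  have h0 := completedRiemannZeta₀_ofReal 0
  have h1 := completedRiemannZeta₀_ofReal 1
  push_cast at h0 h1
  rw [h0, h1] at h
  exact_mod_cast h

lemma log_four_pi_gt : (2.5308 : ℝ) < Real.log (4 * Real.pi) := by
  have h2 := Real.log_two_gt_d9
  have h1 : Real.log (4 * Real.pi) = 3 * Real.log 2 + Real.log (Real.pi / 2) := by
    rw [show 4 * Real.pi = 2 ^ 3 * (Real.pi / 2) by ring,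
      Real.log_mul (by positivity) (by positivity),
      Real.log_pow]
    push_cast; rfl
  have h3 := Real.pi_gt_d4
  have h4 : Real.log (1.5707 : ℝ) ≤ Real.log (Real.pi / 2) :=
    Real.log_le_log (by norm_num) (by linarith)
  have h5 : (0.4514 : ℝ) ≤ Real.log 1.5707 := by
    rw [Real.le_log_iff_exp_le (by norm_num)]
    have := Real.exp_bound' (x := 0.4514) (by norm_num) (by norm_num) (n := 7) (by norm_num)
    norm_num [Finset.sum_range_succ, Nat.factorial] at this ⊢
    linarith
  rw [h1]
  linarith

lemma realLambda_one_lt : realLambda 1 < 0.024 := by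
  have := eulerMascheroniConstant_lt
  have := log_four_pi_gt
  rw [realLambda_one]
  linarith

/-- The entire function `s (s - 1) Λ(s)`. -/
noncomputable def riemannXi (s : ℂ) : ℂ := 1 + s * (s - 1) * completedRiemannZeta₀ s

lemma differentiable_riemannXi : Differentiable ℂ riemannXi := by
  have := differentiable_completedZeta₀
  unfold riemannXi
  fun_prop

lemma riemannXi_one_sub (s : ℂ) : riemannXi (1 - s) = riemannXi s := by
  rw [riemannXi, riemannXi, completedRiemannZeta₀_one_sub]
  ring

lemma riemannXi_zero : riemannXi 0 = 1 := by simp [riemannXi]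

lemma riemannXi_one : riemannXi 1 = 1 := by simp [riemannXi]

lemma riemannXi_eq_mul_completedRiemannZeta {s : ℂ} (h0 : s ≠ 0) (h1 : s ≠ 1) :
    riemannXi s = s * (s - 1) * completedRiemannZeta s := by
  have h2 : 1 - s ≠ 0 := sub_ne_zero.2 h1.symm
  rw [riemannXi, completedRiemannZeta_eq]
  field_simp
  ring

lemma riemannXi_eq_mul_riemannZeta {s : ℂ} (h0 : s ≠ 0) (h1 : s ≠ 1) (hG : s.Gammaℝ ≠ 0) :
    riemannXi s = s * (s - 1) * (s.Gammaℝ * riemannZeta s) := by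
  rw [riemannXi_eq_mul_completedRiemannZeta h0 h1, riemannZeta_def_of_ne_zero h0,
    mul_div_cancel₀ _ hG]

lemma riemannXi_ne_zero_of_mem_Icc {σ : ℝ} (h : σ ∈ Icc (0 : ℝ) 1) : riemannXi σ ≠ 0 := by
  rw [riemannXi, completedRiemannZeta₀_ofReal]
  have h1 := realLambda_le_add h.1 h.2
  rw [realLambda_zero] at h1
  have h2 := realLambda_one_lt
  have h3 : 0 < 1 + σ * (σ - 1) * realLambda σ := by
    have h4 : 0 ≤ σ * (1 - σ) := mul_nonneg h.1 (by linarith [h.2])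
    nlinarith [sq_nonneg (σ - 1 / 2)]
  exact_mod_cast h3.ne'

end

/-! ### Prime power sums -/

section

open Finset
open scoped ArithmeticFunction.vonMangoldt ArithmeticFunction.sigma

lemma sum_vonMangoldt_mul (f : ℕ → ℝ) (N : ℕ) :
    ∑ n ∈ Icc 0 N, Λ n * f n
      = ∑ p ∈ Nat.primesLE N, ∑ k ∈ Icc 1 (Nat.log p N), Real.log p * f (p ^ k) := by
  rw [sum_sigma']
  symm
  refine sum_of_injOn (fun q ↦ q.1 ^ q.2) ?_ ?_ ?_ ?_
  · rintro ⟨p, k⟩ h ⟨q, l⟩ h' e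
    simp only [coe_sigma, Set.mem_sigma_iff, mem_coe, Nat.mem_primesLE, mem_Icc] at h h' e
    obtain ⟨hp, hk⟩ := h.1.2.pow_inj' h'.1.2 (by lia) (by lia) e
    subst hp hk
    rfl
  · rintro ⟨p, k⟩ h
    simp only [coe_sigma, Set.mem_sigma_iff, mem_coe, Nat.mem_primesLE, mem_Icc] at h ⊢
    refine ⟨Nat.zero_le _, ?_⟩
    have hN : N ≠ 0 := by have := h.1.2.pos; lia
    exact Nat.pow_le_of_le_log hN h.2.2
  · intro n hn hn'
    simp only [mem_Icc, Set.mem_image, not_exists] at hn hn'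
    by_contra h0
    have hΛ : Λ n ≠ 0 := left_ne_zero_of_mul h0
    rw [ArithmeticFunction.vonMangoldt_ne_zero_iff] at hΛ
    obtain ⟨p, k, hp, hk, rfl⟩ := hΛ
    have hp := hp.nat_prime
    refine hn' ⟨p, k⟩ ⟨?_, rfl⟩
    simp only [coe_sigma, Set.mem_sigma_iff, mem_coe, Nat.mem_primesLE, mem_Icc]
    have hN : N ≠ 0 := by have := pow_pos hp.pos k; lia
    exact ⟨⟨(Nat.le_self_pow hk.ne' p).trans hn.2, hp⟩, hk, Nat.le_log_of_pow_le hp.one_lt hn.2⟩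
  · rintro ⟨p, k⟩ h
    simp only [mem_sigma, Nat.mem_primesLE, mem_Icc] at h
    simp only
    rw [ArithmeticFunction.vonMangoldt_apply_pow (by lia),
      ArithmeticFunction.vonMangoldt_apply_prime h.1.2]

lemma Nat.Prime.inv_mem {p : ℕ} (hp : p.Prime) : 0 < (p : ℝ)⁻¹ ∧ (p : ℝ)⁻¹ ≤ 1 / 2 := by
  have : (2 : ℝ) ≤ p := by exact_mod_cast hp.two_le
  refine ⟨by positivity, ?_⟩
  rw [one_div]
  gcongr

lemma Nat.Prime.inv_pow_mem {p : ℕ} (hp : p.Prime) (a : ℕ) :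
    0 < (p : ℝ)⁻¹ ^ (a + 1) ∧ (p : ℝ)⁻¹ ^ (a + 1) ≤ 1 / 2 := by
  obtain ⟨h1, h2⟩ := hp.inv_mem
  refine ⟨by positivity, ?_⟩
  exact (pow_le_of_le_one h1.le (by linarith) (by lia)).trans h2

lemma log_sigma_div {n : ℕ} (hn : n ≠ 0) :
    Real.log (ArithmeticFunction.sigma 1 n / n) = ∑ p ∈ n.primeFactors,
      (Real.log (1 - (p : ℝ)⁻¹ ^ (n.factorization p + 1)) - Real.log (1 - (p : ℝ)⁻¹)) := by
  have h1 : (n : ℝ) = ∏ p ∈ n.primeFactors, (p : ℝ) ^ n.factorization p := by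
    have := Nat.prod_factorization_pow_eq_self hn
    rw [Finsupp.prod, Nat.support_factorization] at this
    conv_lhs => rw [← this]
    push_cast
    rfl
  have h2 : (ArithmeticFunction.sigma 1 n : ℝ) = ∏ p ∈ n.primeFactors,
      ∑ k ∈ range (n.factorization p + 1), (p : ℝ) ^ k := by
    rw [ArithmeticFunction.sigma_one_apply, Nat.sum_divisors hn]
    push_cast
    rfl
  rw [h2]
  conv_lhs => rw [h1]
  rw [← prod_div_distrib, Real.log_prod]
  · refine sum_congr rfl fun p hp ↦ ?_
    have hp := Nat.prime_of_mem_primeFactors hp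
    obtain ⟨h3, h4⟩ := hp.inv_mem
    obtain ⟨h5, h6⟩ := hp.inv_pow_mem (n.factorization p)
    have hp1 : (1 : ℝ) < p := by exact_mod_cast hp.one_lt
    have hp0 : (0 : ℝ) < p := by positivity
    rw [← Real.log_div (by linarith) (by linarith), geom_sum_eq hp1.ne']
    congr 1
    have h7 : (p : ℝ) - 1 ≠ 0 := by linarith
    rw [div_div, inv_pow]
    field_simp
    ring
  · intro p hp
    have hp := Nat.prime_of_mem_primeFactors hp
    have hp0 : (0 : ℝ) < p := by exact_mod_cast hp.pos
    have : 0 < ∑ k ∈ range (n.factorization p + 1), (p : ℝ) ^ k :=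
      sum_pos (fun _ _ ↦ by positivity) (by simp)
    positivity

lemma sum_inv_pow_div_le_neg_log {p : ℕ} (hp : p.Prime) (a : ℕ) :
    ∑ k ∈ Icc 1 a, (p : ℝ)⁻¹ ^ k / k ≤ -Real.log (1 - (p : ℝ)⁻¹) := by
  obtain ⟨h1, h2⟩ := hp.inv_mem
  have h := Real.hasSum_pow_div_log_of_abs_lt_one (x := (p : ℝ)⁻¹)
    (by rw [abs_of_pos h1]; linarith)
  have h3 := sum_le_hasSum (range a) (fun i _ ↦ by positivity) h
  refine le_trans (le_of_eq ?_) h3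
  have h4 := sum_Ico_add' (fun k : ℕ ↦ (p : ℝ)⁻¹ ^ k / (k : ℝ)) 0 a 1
  push_cast at h4
  rw [range_eq_Ico, h4]
  rfl

/-- The sum `Σ_{n ≤ N} Λ(n) / (n log n)`. -/
noncomputable def logZetaSum (N : ℕ) : ℝ := ∑ n ∈ Icc 0 N, Λ n * (1 / (n * Real.log n))

lemma logZetaSum_eq (N : ℕ) :
    logZetaSum N = ∑ p ∈ Nat.primesLE N, ∑ k ∈ Icc 1 (Nat.log p N), (p : ℝ)⁻¹ ^ k / k := by
  rw [logZetaSum, sum_vonMangoldt_mul]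
  refine sum_congr rfl fun p hp ↦ sum_congr rfl fun k hk ↦ ?_
  have hp := (Nat.mem_primesLE.1 hp).2
  have hl : 0 < Real.log p := Real.log_pos (by exact_mod_cast hp.one_lt)
  have hk : (0 : ℝ) < k := by
    have := (mem_Icc.1 hk).1
    positivity
  have : (0 : ℝ) < p := by exact_mod_cast hp.pos
  push_cast
  rw [Real.log_pow, inv_pow]
  field_simp

lemma mertensRemainder_eq (u : ℝ) : mertensRemainder u
    = u * (logZetaSum ⌊Real.exp u⌋₊ - Real.log u - Real.eulerMascheroniConstant)
      - (Chebyshev.psi (Real.exp u) / Real.exp u - 1) := by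
  rw [mertensRemainder, mertensSum, logZetaSum, Chebyshev.psi_eq_sum_Icc, Real.exp_neg]
  simp_rw [mul_sub, sum_sub_distrib, ← mul_assoc, ← sum_mul]
  ring

end

/-! ### Least common multiples -/

section

open Finset
open scoped ArithmeticFunction.vonMangoldt ArithmeticFunction.sigma

lemma neg_two_mul_le_log_one_sub {y : ℝ} (h0 : 0 ≤ y) (h1 : y ≤ 1 / 2) :
    -(2 * y) ≤ Real.log (1 - y) := by
  have h := Real.one_sub_inv_le_log_of_pos (x := 1 - y) (by linarith)
  refine le_trans ?_ h
  have h2 : (1 - y)⁻¹ ≤ 1 + 2 * y := by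
    rw [inv_le_iff_one_le_mul₀ (by linarith)]
    nlinarith
  linarith

lemma log_add_le {a b : ℝ} (ha : 0 < a) (hb : 0 < a + b) :
    Real.log (a + b) ≤ Real.log a + b / a := by
  have h := Real.log_le_sub_one_of_pos (x := (a + b) / a) (by positivity)
  rw [Real.log_div hb.ne' ha.ne', add_div, div_self ha.ne'] at h
  linarith

lemma sum_inv_pow_log_le {N : ℕ} (hN : 0 < N) :
    ∑ p ∈ Nat.primesLE N, (p : ℝ)⁻¹ ^ (Nat.log p N + 1) ≤ 3 / √N := by
  set M := Nat.sqrt N with hM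
  have hM0 : 0 < M := Nat.sqrt_pos.2 hN
  have hMN : M ≤ N := Nat.sqrt_le_self N
  have hN' : (0 : ℝ) < N := by exact_mod_cast hN
  have hM' : (0 : ℝ) < M := by exact_mod_cast hM0
  have hs1 : (M : ℝ) ≤ √N := Real.nat_sqrt_le_real_sqrt
  have hs2 : √N ≤ 2 * M := by
    have h1 := Real.real_sqrt_le_nat_sqrt_succ (a := N)
    have h2 : (1 : ℝ) ≤ M := by exact_mod_cast hM0
    linarith
  have hs0 : 0 < √(N : ℝ) := by positivity
  have hss : √(N : ℝ) * √N = N := Real.mul_self_sqrt hN'.le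
  calc ∑ p ∈ Nat.primesLE N, (p : ℝ)⁻¹ ^ (Nat.log p N + 1)
      ≤ ∑ p ∈ Nat.primesLE N, if p ≤ M then (N : ℝ)⁻¹ else ((p : ℝ) ^ 2)⁻¹ := by
        refine sum_le_sum fun p hp ↦ ?_
        obtain ⟨hpN, hp⟩ := Nat.mem_primesLE.1 hp
        have hp0 : (0 : ℝ) < p := by exact_mod_cast hp.pos
        split_ifs with h
        · rw [inv_pow]
          gcongr
          exact_mod_cast (Nat.lt_pow_succ_log_self hp.one_lt N).le
        · rw [inv_pow]
          gcongr
          · exact_mod_cast hp.one_lt.le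
          · have := Nat.log_pos hp.one_lt hpN
            lia
    _ ≤ ∑ m ∈ Ioc 0 N, if m ≤ M then (N : ℝ)⁻¹ else ((m : ℝ) ^ 2)⁻¹ := by
        refine sum_le_sum_of_subset_of_nonneg ?_ fun _ _ _ ↦ by split_ifs <;> positivity
        intro p hp
        obtain ⟨hpN, hp⟩ := Nat.mem_primesLE.1 hp
        exact mem_Ioc.2 ⟨hp.pos, hpN⟩
    _ = ∑ m ∈ Ioc 0 M, (N : ℝ)⁻¹ + ∑ m ∈ Ioc M N, ((m : ℝ) ^ 2)⁻¹ := by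
        rw [← sum_Ioc_consecutive _ (Nat.zero_le M) hMN]
        congr 1
        · exact sum_congr rfl fun m hm ↦ if_pos (mem_Ioc.1 hm).2
        · exact sum_congr rfl fun m hm ↦ if_neg (by have := (mem_Ioc.1 hm).1; lia)
    _ ≤ M * (N : ℝ)⁻¹ + (M : ℝ)⁻¹ := by
        refine add_le_add (by simp) ?_
        refine (sum_Ioc_inv_sq_le_sub hM0.ne' hMN).trans ?_
        have : 0 ≤ (N : ℝ)⁻¹ := by positivity
        linarith
    _ ≤ 3 / √N := by
        have h1 : M * (N : ℝ)⁻¹ ≤ 1 / √N := by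
          rw [← div_eq_mul_inv, div_le_div_iff₀ hN' hs0]
          nlinarith
        have h2 : (M : ℝ)⁻¹ ≤ 2 / √N := by
          rw [inv_eq_one_div, div_le_div_iff₀ hM' hs0]
          linarith
        have : 3 / √(N : ℝ) = 1 / √N + 2 / √N := by ring
        linarith

lemma logZetaSum_sub_le_log_sigma_lcmUpto {N : ℕ} (hN : 0 < N) :
    logZetaSum N - 6 / √N
      ≤ Real.log (ArithmeticFunction.sigma 1 (Nat.lcmUpto N) / Nat.lcmUpto N) := by
  rw [log_sigma_div (Nat.lcmUpto_ne_zero N), Nat.primeFactors_lcmUpto, logZetaSum_eq]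
  have h := sum_inv_pow_log_le hN
  have h2 : ∑ p ∈ Nat.primesLE N, (∑ k ∈ Icc 1 (Nat.log p N), (p : ℝ)⁻¹ ^ k / k
      - 2 * (p : ℝ)⁻¹ ^ (Nat.log p N + 1)) ≤ ∑ p ∈ Nat.primesLE N,
      (Real.log (1 - (p : ℝ)⁻¹ ^ ((Nat.lcmUpto N).factorization p + 1)) -
        Real.log (1 - (p : ℝ)⁻¹)) := by
    refine sum_le_sum fun p hp ↦ ?_
    have hp := (Nat.mem_primesLE.1 hp).2
    rw [Nat.factorization_lcmUpto N hp]
    have h3 := sum_inv_pow_div_le_neg_log hp (Nat.log p N)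
    obtain ⟨h4, h5⟩ := hp.inv_pow_mem (Nat.log p N)
    have h6 := neg_two_mul_le_log_one_sub h4.le h5
    linarith
  rw [sum_sub_distrib, ← mul_sum] at h2
  have : 6 / √(N : ℝ) = 2 * (3 / √N) := by ring
  linarith

lemma harmonic_le_log_add {n : ℕ} (hn : 0 < n) :
    (harmonic n : ℝ) ≤ Real.log n + Real.eulerMascheroniConstant + 1 / n := by
  have h := Real.eulerMascheroniSeq_lt_eulerMascheroniConstant n
  rw [Real.eulerMascheroniSeq] at h
  have hn' : (0 : ℝ) < n := by exact_mod_cast hn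
  have h2 := log_add_le hn' (b := 1) (by linarith)
  linarith

lemma log_lagarias_bound_le {n : ℕ} (hn : 0 < n) (hψ : 3 ≤ Real.log n) :
    Real.log (((harmonic n : ℝ) + Real.exp (harmonic n : ℝ) * Real.log (harmonic n : ℝ)) / n)
      ≤ Real.eulerMascheroniConstant + Real.log (Real.log (Real.log n)) + 5 / Real.log n := by
  have hn' : (0 : ℝ) < n := by exact_mod_cast hn
  set y := Real.log n with hy
  set h := (harmonic n : ℝ) with hh
  have hγ := Real.eulerMascheroniConstant_lt_two_thirds
  have hny : 1 / (n : ℝ) ≤ 1 / y := by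
    gcongr
    have := Real.log_le_sub_one_of_pos hn'
    linarith
  have hy1 : 1 / y ≤ 1 / 3 := by gcongr
  have hle : h ≤ y + Real.eulerMascheroniConstant + 1 / n := harmonic_le_log_add hn
  have hge : y ≤ h := by
    have h1 := log_add_one_le_harmonic n
    refine le_trans ?_ h1
    rw [hy]
    gcongr
    linarith
  have hh0 : 0 < h := by linarith
  have hly : 1 ≤ Real.log y := by
    rw [Real.le_log_iff_exp_le (by linarith)]
    have := Real.exp_one_lt_d9
    linarith
  have hexp : h ≤ Real.exp h * (2 / y) := by
    have h1 := Real.quadratic_le_exp_of_nonneg hh0.le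
    have h2 : h ≤ h ^ 2 / 2 * (2 / y) := by
      rw [show h ^ 2 / 2 * (2 / y) = h * (h / y) by ring]
      exact le_mul_of_one_le_right hh0.le ((one_le_div (by linarith)).2 hge)
    refine h2.trans ?_
    gcongr
    nlinarith
  have hlog : Real.log h ≤ Real.log y + 2 / y := by
    have h1 : Real.log h ≤ Real.log (y + 2) := Real.log_le_log hh0 (by linarith)
    exact h1.trans (log_add_le (by linarith) (by linarith))
  have hup : h + Real.exp h * Real.log h ≤ Real.exp h * (Real.log y + 4 / y) := by
    have : Real.exp h * (Real.log y + 4 / y)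
      = Real.exp h * (2 / y) + Real.exp h * (Real.log y + 2 / y) := by ring
    rw [this]
    gcongr
  have hpos : 0 < h + Real.exp h * Real.log h := by
    have : 0 < Real.log h := Real.log_pos (by linarith)
    positivity
  have h4 : 0 < Real.log y + 4 / y := by positivity
  calc Real.log ((h + Real.exp h * Real.log h) / n)
      ≤ Real.log (Real.exp h * (Real.log y + 4 / y) / n) := by
        gcongr
    _ = h + Real.log (Real.log y + 4 / y) - y := by
        rw [Real.log_div (by positivity) hn'.ne', Real.log_mul (Real.exp_pos _).ne' h4.ne',
          Real.log_exp]
    _ ≤ h + (Real.log (Real.log y) + (4 / y) / Real.log y) - y := by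
        have := log_add_le (b := 4 / y) (by linarith : 0 < Real.log y) h4
        linarith
    _ ≤ Real.eulerMascheroniConstant + Real.log (Real.log y) + 5 / y := by
        have h5 : (4 / y) / Real.log y ≤ 4 / y := div_le_self (by positivity) hly
        have h6 : 5 / y = 4 / y + 1 / y := by ring
        linarith

theorem mertensRemainder_le_of_lagarias
    (H : ∀ n : ℕ, 0 < n → (ArithmeticFunction.sigma 1 n : ℝ) ≤
      (harmonic n : ℝ) + Real.exp (harmonic n : ℝ) * Real.log (harmonic n : ℝ))
    {u : ℝ} (hu : 8 ≤ u) : mertensRemainder u ≤ 17 * u * Real.exp (-(u / 2)) := by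
  set x := Real.exp u with hx
  set y := Real.exp (u / 2) with hy
  have hxy : x = y ^ 2 := by rw [hx, hy, ← Real.exp_nat_mul]; congr 1; push_cast; ring
  have hy8 : 8 ≤ y := by
    have h1 := Real.quadratic_le_exp_of_nonneg (x := u / 2) (by linarith)
    nlinarith
  have hx1 : 64 ≤ x := by rw [hxy]; nlinarith
  have hsx : √x = y := by rw [hxy, Real.sqrt_sq (by linarith)]
  set N := ⌊x⌋₊ with hN
  have hN1 : x - 1 ≤ N := by have := Nat.lt_floor_add_one x; linarith
  have hN0 : 0 < N := Nat.floor_pos.2 (by linarith)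
  have hψ : y ≤ Chebyshev.psi x := by
    have h1 := Chebyshev.psi_ge' (x := x) (by linarith)
    have h2 : Real.log (x + 2) ≤ 2 * (y + 1) := by
      have h3 : Real.log (x + 2) ≤ Real.log ((y + 1) ^ 2) :=
        Real.log_le_log (by linarith) (by rw [hxy]; nlinarith)
      rw [Real.log_pow] at h3
      have h4 := Real.log_le_sub_one_of_pos (x := y + 1) (by linarith)
      push_cast at h3
      linarith
    have h3 := Real.log_two_gt_d9
    have h4 : (x - 1) * 0.69 ≤ (x - 1) * Real.log 2 := by gcongr; linarith; linarith
    rw [hxy] at h4 h1 h2 ⊢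
    nlinarith
  set n := Nat.lcmUpto N with hn
  have hn0 : 0 < n := Nat.lcmUpto_pos N
  have hnψ : Real.log n = Chebyshev.psi x := by
    rw [hn, ← Chebyshev.psi_eq_log_lcmUpto, ← Chebyshev.psi_eq_psi_coe_floor]
  have hψ0 : 3 ≤ Chebyshev.psi x := by linarith
  have h1 := logZetaSum_sub_le_log_sigma_lcmUpto hN0
  have h2 := log_lagarias_bound_le hn0 (hnψ ▸ hψ0)
  have hn' : (0 : ℝ) < n := by exact_mod_cast hn0
  have h3 : Real.log (ArithmeticFunction.sigma 1 n / n) ≤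
      Real.log
        (((harmonic n : ℝ) + Real.exp (harmonic n : ℝ) * Real.log (harmonic n : ℝ)) / n) := by
    have : 0 < (ArithmeticFunction.sigma 1 n : ℝ) := by
      exact_mod_cast ArithmeticFunction.sigma_pos 1 n hn0.ne'
    have := H n hn0
    gcongr
  rw [hnψ] at h2
  have h4 : Real.log (Real.log (Chebyshev.psi x)) ≤ Real.log u + (Chebyshev.psi x / x - 1) / u := by
    have h5 := log_add_le (a := x) (b := Chebyshev.psi x - x) (by linarith) (by linarith)
    rw [add_sub_cancel, hx, Real.log_exp, ← hx, sub_div, div_self (by linarith)] at h5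
    have h6 : 0 < Real.log (Chebyshev.psi x) := Real.log_pos (by linarith)
    have h7 : Real.log (Real.log (Chebyshev.psi x)) ≤ Real.log (u + (Chebyshev.psi x / x - 1)) :=
      Real.log_le_log h6 h5
    exact h7.trans (log_add_le (by linarith) (by linarith))
  have h5 : 5 / Chebyshev.psi x ≤ 5 / y := by gcongr
  have h6 : 6 / √(N : ℝ) ≤ 12 / y := by
    have : y / 2 ≤ √(N : ℝ) := by
      apply Real.le_sqrt_of_sq_le
      nlinarith
    rw [div_le_div_iff₀ (by positivity) (by positivity)]
    linarith
  have h7 : logZetaSum N - Real.log u - Real.eulerMascheroniConstant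
      ≤ 17 / y + (Chebyshev.psi x / x - 1) / u := by
    have : 17 / y = 5 / y + 12 / y := by ring
    linarith
  rw [mertensRemainder_eq, ← hx, ← hN]
  have h8 : u * (logZetaSum N - Real.log u - Real.eulerMascheroniConstant)
      ≤ u * (17 / y + (Chebyshev.psi x / x - 1) / u) := by gcongr
  have h9 : u * (17 / y + (Chebyshev.psi x / x - 1) / u)
      = 17 * u * Real.exp (-(u / 2)) + (Chebyshev.psi x / x - 1) := by
    rw [Real.exp_neg, ← hy]
    field_simp
  linarith

lemma mertensRemainder_le (u₀ : ℝ) :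
    ∃ C, 0 ≤ C ∧ ∀ u, 0 < u → u ≤ u₀ → mertensRemainder u ≤ C := by
  refine ⟨logZetaSum ⌊Real.exp u₀⌋₊ * |u₀| + 2, ?_, fun u h0 h1 ↦ ?_⟩
  · have : 0 ≤ logZetaSum ⌊Real.exp u₀⌋₊ := sum_nonneg fun n _ ↦ by
      have := Real.log_natCast_nonneg n
      have := ArithmeticFunction.vonMangoldt_nonneg (n := n)
      positivity
    positivity
  have hnn : ∀ n : ℕ, 0 ≤ Λ n * (1 / (n * Real.log n)) := fun n ↦ by
    have := Real.log_natCast_nonneg n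
    have := ArithmeticFunction.vonMangoldt_nonneg (n := n)
    positivity
  have h2 : mertensSum u ≤ logZetaSum ⌊Real.exp u₀⌋₊ * |u₀| := by
    rw [mertensSum, logZetaSum, sum_mul]
    calc _ ≤ ∑ n ∈ Icc 0 ⌊Real.exp u⌋₊, Λ n * (1 / (n * Real.log n)) * |u₀| := by
          refine sum_le_sum fun n _ ↦ ?_
          have h3 : Λ n * (1 / (n * Real.log n)) * u ≤ Λ n * (1 / (n * Real.log n)) * |u₀| :=
            mul_le_mul_of_nonneg_left (h1.trans (le_abs_self _)) (hnn n)
          have h4 : 0 ≤ Λ n * Real.exp (-u) :=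
            mul_nonneg ArithmeticFunction.vonMangoldt_nonneg (Real.exp_pos _).le
          linarith
      _ ≤ _ := by
          refine sum_le_sum_of_subset_of_nonneg (Icc_subset_Icc_right ?_) fun n _ _ ↦
            mul_nonneg (hnn n) (abs_nonneg _)
          gcongr
  have h3 : -1 ≤ u * Real.log u := by
    have := Real.one_sub_inv_le_log_of_pos h0
    have h4 : u * (1 - u⁻¹) ≤ u * Real.log u := by gcongr
    rw [mul_sub, mul_inv_cancel₀ h0.ne'] at h4
    linarith
  have h4 : 0 ≤ Real.eulerMascheroniConstant * u :=
    mul_nonneg (by have := Real.one_half_lt_eulerMascheroniConstant; linarith) h0.le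
  rw [mertensRemainder]
  linarith

theorem exists_mertensRemainder_le_of_lagarias
    (H : ∀ n : ℕ, 0 < n → (ArithmeticFunction.sigma 1 n : ℝ) ≤
      (harmonic n : ℝ) + Real.exp (harmonic n : ℝ) * Real.log (harmonic n : ℝ)) :
    ∃ K, 0 ≤ K ∧ ∀ u, 0 < u → mertensRemainder u ≤ K * (1 + u) * Real.exp (-(u / 2)) := by
  obtain ⟨C, hC, h⟩ := mertensRemainder_le 8
  refine ⟨17 + C * Real.exp 4, by positivity, fun u hu ↦ ?_⟩
  rcases le_total 8 u with h8 | h8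
  · refine (mertensRemainder_le_of_lagarias H h8).trans ?_
    gcongr
    · have : 0 ≤ C * Real.exp 4 := by positivity
      linarith
    · linarith
  · refine (h u hu h8).trans ?_
    have h1 : 1 ≤ Real.exp 4 * Real.exp (-(u / 2)) := by
      rw [← Real.exp_add]
      exact Real.one_le_exp (by linarith)
    have h2 : C ≤ C * (Real.exp 4 * Real.exp (-(u / 2))) := le_mul_of_one_le_right hC h1
    have h3 : 0 ≤ Real.exp (-(u / 2)) := by positivity
    have h4 : 0 ≤ C * (Real.exp 4 * Real.exp (-(u / 2))) := by positivity
    nlinarith [mul_nonneg h4 hu.le, mul_nonneg h3 hu.le]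

end

/-! ### Lagarias's inequality implies the Riemann hypothesis -/

section

open MeasureTheory Set Filter Topology ProbabilityTheory

lemma mulZeta_mem_slitPlane {δ : ℝ} (h : -1 < δ) : mulZeta δ ∈ Complex.slitPlane := by
  rcases lt_trichotomy δ 0 with h0 | rfl | h0
  · have hσ0 : (0 : ℝ) < 1 + δ := by linarith
    have hs0 : ((1 + δ : ℝ) : ℂ) ≠ 0 := by exact_mod_cast hσ0.ne'
    have hs1 : ((1 + δ : ℝ) : ℂ) ≠ 1 := by
      rw [← Complex.ofReal_one]
      exact_mod_cast (by linarith : 1 + δ < 1).ne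
    have hΓ : ((1 + δ : ℝ) : ℂ).Gammaℝ
        = ((Real.pi ^ (-(1 + δ) / 2) * Real.Gamma ((1 + δ) / 2) : ℝ) : ℂ) := by
      rw [Complex.Gammaℝ_def, Complex.ofReal_mul, Complex.ofReal_cpow Real.pi_pos.le,
        ← Complex.Gamma_ofReal]
      push_cast
      rfl
    set g : ℝ := Real.pi ^ (-(1 + δ) / 2) * Real.Gamma ((1 + δ) / 2) with hg
    have hgpos : 0 < g := mul_pos (by positivity) (Real.Gamma_pos_of_pos (by linarith))
    have hgC : (g : ℂ) ≠ 0 := by exact_mod_cast hgpos.ne'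
    have hx := riemannXi_eq_mul_riemannZeta hs0 hs1 (by rw [hΓ]; exact hgC)
    have hδ0 : (δ : ℂ) ≠ 0 := by exact_mod_cast h0.ne
    rw [riemannXi, completedRiemannZeta₀_ofReal, hΓ] at hx
    have hm : mulZeta δ = ((1 + (1 + δ) * δ * realLambda (1 + δ)) / ((1 + δ) * g) : ℝ) := by
      rw [mulZeta_of_ne_zero hδ0]
      push_cast at hx ⊢
      rw [eq_div_iff (mul_ne_zero (by simpa using hs0) hgC)]
      linear_combination -hx
    have h1 := realLambda_le_add hσ0.le (by linarith : 1 + δ ≤ 1)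
    rw [realLambda_zero] at h1
    have h2 := realLambda_one_lt
    rw [hm, Complex.ofReal_mem_slitPlane]
    have h4 : 0 ≤ (1 + δ) * (-δ) := by nlinarith
    have : 0 < 1 + (1 + δ) * δ * realLambda (1 + δ) := by nlinarith [sq_nonneg (δ + 1 / 2)]
    positivity
  · simp [mulZeta_zero]
  · exact mulZeta_mem_slitPlane_of_pos h0

/-- The function `e^{-δ} log(δ ζ(1 + δ)) / δ`. -/
noncomputable def expLogZeta : ℂ → ℂ :=
  dslope (fun δ ↦ Complex.exp (-δ) * Complex.log (mulZeta δ)) 0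

lemma analyticAt_expLogZeta {δ : ℝ} (h : -1 < δ) : AnalyticAt ℂ expLogZeta δ := by
  have hf : ∀ t : ℝ, -1 < t →
      AnalyticAt ℂ (fun δ ↦ Complex.exp (-δ) * Complex.log (mulZeta δ)) t := by
    intro t ht
    have := differentiable_mulZeta.analyticAt t
    have := this.clog (mulZeta_mem_slitPlane ht)
    fun_prop
  rcases eq_or_ne δ 0 with rfl | h0
  · obtain ⟨p, hp⟩ := hf 0 h
    rw [Complex.ofReal_zero] at hp ⊢
    exact (hp.has_fpower_series_dslope_fslope).analyticAt
  · have h0' : (δ : ℂ) ≠ 0 := by exact_mod_cast h0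
    have h1 : expLogZeta =ᶠ[𝓝 (δ : ℂ)]
        fun z ↦ (Complex.exp (-z) * Complex.log (mulZeta z)) / z := by
      filter_upwards [isOpen_ne.mem_nhds h0'] with z hz
      rw [expLogZeta, dslope_of_ne _ hz, slope_def_field]
      simp [mulZeta_zero]
    refine AnalyticAt.congr ?_ h1.symm
    exact (hf δ h).div analyticAt_id h0'

lemma mul_expLogZeta (δ : ℂ) :
    δ * expLogZeta δ = Complex.exp (-δ) * Complex.log (mulZeta δ) := by
  have := sub_smul_dslope (fun δ ↦ Complex.exp (-δ) * Complex.log (mulZeta δ)) 0 δ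
  simpa [mulZeta_zero, expLogZeta] using this

lemma mertensRemainder_laplace_eq {δ : ℝ} (hδ : 0 < δ) :
    ((∫ u in Ioi 0, mertensRemainder u * Real.exp (-δ * u) : ℝ) : ℂ)
      = 1 / (1 + δ) - Complex.exp δ * deriv expLogZeta δ / (1 + δ) := by
  rw [(mertensRemainder_laplace hδ).2]
  have h0 : (δ : ℂ) ≠ 0 := by exact_mod_cast hδ.ne'
  have h1 : (1 : ℂ) + δ ≠ 0 := by
    exact_mod_cast (by linarith : 0 < 1 + δ).ne'
  have hs := mulZeta_mem_slitPlane (δ := δ) (by linarith)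
  have hd := (differentiable_mulZeta δ).hasDerivAt.clog hs
  have he : HasDerivAt (fun z : ℂ ↦ Complex.exp (-z)) (-Complex.exp (-δ)) δ := by
    have := (hasDerivAt_neg (δ : ℂ)).cexp
    simpa using this
  have hp := (analyticAt_expLogZeta (δ := δ) (by linarith)).differentiableAt.hasDerivAt
  have e1 := ((hasDerivAt_id (δ : ℂ)).mul hp).unique
    ((he.mul hd).congr_of_eventuallyEq (Eventually.of_forall mul_expLogZeta))
  have e2 := mul_expLogZeta δ
  have e3 : Complex.exp δ * Complex.exp (-δ) = 1 := by
    rw [← Complex.exp_add]; simp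
  simp only [id, one_mul] at e1
  rw [logDeriv_apply]
  set L := Complex.log (mulZeta δ)
  set M := deriv mulZeta δ / mulZeta δ
  set P := expLogZeta δ
  set P' := deriv expLogZeta δ
  set e := Complex.exp (-δ)
  set E := Complex.exp δ
  have e4 : E * P' = (M - L) / δ - L / δ ^ 2 := by
    have hP : P = e * L / δ := by
      rw [eq_div_iff h0]; linear_combination e2
    have hP' : P' = (e * M - e * L - P) / δ := by
      rw [eq_div_iff h0]; linear_combination e1
    rw [hP', hP]
    field_simp
    linear_combination (δ * M - δ * L - L) * e3
  rw [e4]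
  field_simp
  ring

lemma exists_analyticOnNhd_of_mertensRemainder_le {K : ℝ}
    (hK : ∀ u, 0 < u → mertensRemainder u ≤ K * (1 + u) * Real.exp (-(u / 2))) :
    ∃ H : ℂ → ℂ, AnalyticOnNhd ℂ H {δ | -(1 / 2) < δ.re} ∧ ∀ δ : ℝ, 0 < δ →
      H δ = ((∫ u in Ioi 0, mertensRemainder u * Real.exp (-δ * u) : ℝ) : ℂ) := by
  set g : ℝ → ℝ := fun u ↦ K * (1 + u) * Real.exp (-(u / 2)) - mertensRemainder u with hg
  have hg0 : ∀ u ∈ Ioi (0 : ℝ), 0 ≤ g u := fun u hu ↦ sub_nonneg.2 (hK u hu)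
  set B : ℂ → ℂ := fun z ↦ K * (1 / (z + 1 / 2) + 1 / (z + 1 / 2) ^ 2) with hB
  have hBan : ∀ z : ℂ, -(1 / 2) < z.re → AnalyticAt ℂ B z := by
    intro z hz
    have : z + 1 / 2 ≠ 0 := by
      intro h
      have := congrArg Complex.re h
      simp at this
      linarith
    have : (z + 1 / 2) ^ 2 ≠ 0 := pow_ne_zero _ this
    fun_prop (disch := assumption)
  have hgint : ∀ δ > 0, IntegrableOn (fun u ↦ g u * Real.exp (-δ * u)) (Ioi 0) ∧
      ((∫ u in Ioi (0 : ℝ), g u * Real.exp (-δ * u) : ℝ) : ℂ)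
        = B δ - ((∫ u in Ioi 0, mertensRemainder u * Real.exp (-δ * u) : ℝ) : ℂ) := by
    intro δ hδ
    obtain ⟨i1, e1⟩ := hasIntegral_exp (δ := δ + 1 / 2) (by linarith)
    obtain ⟨i2, e2⟩ := hasIntegral_mul (δ := δ + 1 / 2) (by linarith)
    obtain ⟨i3, -⟩ := mertensRemainder_laplace hδ
    have e : (fun u ↦ g u * Real.exp (-δ * u)) = fun u ↦ K * (Real.exp (-(δ + 1 / 2) * u)
        + u * Real.exp (-(δ + 1 / 2) * u)) - mertensRemainder u * Real.exp (-δ * u) := by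
      ext u
      have : Real.exp (-(δ + 1 / 2) * u) = Real.exp (-(u / 2)) * Real.exp (-δ * u) := by
        rw [← Real.exp_add]; ring_nf
      rw [this, hg]
      ring
    rw [e]
    have i4 := (i1.add i2).const_mul K
    refine ⟨i4.sub i3, ?_⟩
    have e5 := (integral_sub i4 i3).trans (congrArg (· - _)
      ((integral_const_mul K _).trans (congrArg (K * ·) (integral_add i1 i2))))
    rw [e1, e2] at e5
    refine (congrArg Complex.ofReal e5).trans ?_
    rw [hB]
    push_cast
    ring
  set μ : Measure ℝ := (volume.restrict (Ioi 0)).withDensity fun u ↦ ENNReal.ofReal (g u) with hμ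
  have hmeas : AEMeasurable (fun u ↦ ENNReal.ofReal (g u)) (volume.restrict (Ioi 0)) := by
    refine AEMeasurable.ennreal_ofReal ?_
    have h1 := (hgint 1 one_pos).1.aestronglyMeasurable.aemeasurable
    have h2 : AEMeasurable (fun u : ℝ ↦ Real.exp u) (volume.restrict (Ioi 0)) := by fun_prop
    refine (h1.mul h2).congr (Eventually.of_forall fun u ↦ ?_)
    simp only [Pi.mul_apply, mul_assoc, ← Real.exp_add]
    simp
  have hInt : ∀ t < 0, Integrable (fun u ↦ Real.exp (t * u)) μ := by
    intro t ht
    rw [hμ, integrable_withDensity_iff_integrable_smul₀' hmeas (by simp)]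
    refine ((hgint (-t) (by linarith)).1).congr ?_
    filter_upwards [ae_restrict_mem measurableSet_Ioi] with u hu
    rw [ENNReal.toReal_ofReal (hg0 u hu), smul_eq_mul, neg_neg]
  have hval : ∀ t : ℝ, t < 0 → complexMGF id μ t
      = B (-t) - ((∫ u in Ioi 0, mertensRemainder u * Real.exp (t * u) : ℝ) : ℂ) := by
    intro t ht
    have := (hgint (-t) (by linarith)).2
    simp only [neg_neg, Complex.ofReal_neg] at this
    rw [← this, complexMGF_ofReal, mgf, hμ,
      integral_withDensity_eq_integral_toReal_smul₀ hmeas (by simp)]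
    congr 1
    refine integral_congr_ae ?_
    filter_upwards [ae_restrict_mem measurableSet_Ioi] with u hu
    rw [ENNReal.toReal_ofReal (hg0 u hu), smul_eq_mul, id]
  have hsupp : ∀ᵐ u ∂μ, 0 ≤ u := by
    refine (withDensity_absolutelyContinuous _ _).ae_le ?_
    filter_upwards [ae_restrict_mem measurableSet_Ioi] with u hu using le_of_lt hu
  have key := integrable_exp_of_analyticAt hsupp (a := 1 / 2) hInt
    (G := fun z ↦ B (-z)
      - (1 / (1 + -z) - Complex.exp (-z) * deriv expLogZeta (-z) / (1 + -z)))
    (by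
      intro t ht
      have h1 : AnalyticAt ℂ B (-(t : ℂ)) := hBan _ (by simp; linarith)
      have h2 : AnalyticAt ℂ (deriv expLogZeta) (-(t : ℂ)) := by
        have := (analyticAt_expLogZeta (δ := -t) (by linarith)).deriv
        simpa using this
      have h1' : AnalyticAt ℂ (fun z ↦ B (-z)) (t : ℂ) :=
        AnalyticAt.fun_comp (f := fun z : ℂ ↦ -z) h1 (by fun_prop)
      have h2' : AnalyticAt ℂ (fun z ↦ deriv expLogZeta (-z)) (t : ℂ) :=
        AnalyticAt.fun_comp (f := fun z : ℂ ↦ -z) h2 (by fun_prop)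
      have h3 : (1 : ℂ) + -t ≠ 0 := by
        exact_mod_cast (by linarith : 0 < 1 + -t).ne'
      fun_prop (disch := assumption))
    (by
      intro t ht
      have := mertensRemainder_laplace_eq (δ := -t) (by linarith)
      simp only [neg_neg, Complex.ofReal_neg] at this
      rw [hval t ht, this])
  refine ⟨fun z ↦ B z - complexMGF id μ (-z), ?_, ?_⟩
  · intro z hz
    have h1 : AnalyticAt ℂ (complexMGF id μ) (-z) := by
      refine analyticAt_complexMGF (interior_mono (s := Iio (1 / 2)) (fun t ht ↦ key t ht) ?_)
      rw [interior_Iio, mem_Iio, Complex.neg_re]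
      have : -(1 / 2) < z.re := hz
      linarith
    have h2 := hBan z hz
    have h1' : AnalyticAt ℂ (fun z ↦ complexMGF id μ (-z)) z :=
      AnalyticAt.fun_comp (f := fun z : ℂ ↦ -z) h1 (by fun_prop)
    fun_prop
  · intro δ hδ
    have := hval (-δ) (by linarith)
    simp only [neg_neg, Complex.ofReal_neg] at this
    simp only [this]
    ring

theorem mulZeta_ne_zero_of_mertensRemainder_le {K : ℝ}
    (hK : ∀ u, 0 < u → mertensRemainder u ≤ K * (1 + u) * Real.exp (-(u / 2)))
    {s : ℂ} (hs : -(1 / 2) < s.re) : mulZeta s ≠ 0 := by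
  obtain ⟨H, hH, hHe⟩ := exists_analyticOnNhd_of_mertensRemainder_le hK
  set Q : ℂ → ℂ := fun z ↦ (1 + z) * Complex.exp (-z) * (1 / (1 + z) - H z) with hQ
  obtain ⟨c, hc1, hcs⟩ : ∃ c : ℝ, 1 ≤ c ∧ dist s c < c + 1 / 2 := by
    obtain ⟨c, hc⟩ := exists_nat_gt (max 1 (‖s‖ ^ 2 / (2 * (s.re + 1 / 2))))
    have h1 : (1 : ℝ) < c := (le_max_left _ _).trans_lt hc
    refine ⟨c, h1.le, ?_⟩
    have h2 : ‖s‖ ^ 2 / (2 * (s.re + 1 / 2)) < c := (le_max_right _ _).trans_lt hc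
    rw [div_lt_iff₀ (by linarith)] at h2
    rw [dist_eq_norm]
    refine lt_of_pow_lt_pow_left₀ 2 (by linarith) ?_
    rw [← Complex.normSq_eq_norm_sq, Complex.normSq_apply] at h2 ⊢
    simp
    nlinarith
  set U := Metric.ball (c : ℂ) (c + 1 / 2) with hU
  have hre : ∀ z ∈ U, -(1 / 2) < z.re := by
    intro z hz
    have h1 := (Complex.abs_re_le_norm (z - c)).trans_lt (mem_ball_iff_norm.1 hz)
    rw [Complex.sub_re, Complex.ofReal_re, abs_lt] at h1
    norm_num at h1
    linarith
  have h1U : ((1 : ℝ) : ℂ) ∈ U := by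
    rw [hU, Metric.mem_ball, Complex.dist_eq, ← Complex.ofReal_sub, Complex.norm_real,
      Real.norm_eq_abs, abs_lt]
    constructor <;> linarith
  have hQan : DifferentiableOn ℂ Q U := by
    intro z hz
    have h1 := (hH z (hre z hz)).differentiableAt
    have h2 : 1 + z ≠ 0 := by
      intro h
      have := congrArg Complex.re h
      simp at this
      linarith [hre z hz]
    refine DifferentiableAt.differentiableWithinAt ?_
    fun_prop (disch := assumption)
  obtain ⟨Φ, hΦ⟩ := hQan.isExactOn_ball
  have hΦan : AnalyticOnNhd ℂ Φ U := by
    refine DifferentiableOn.analyticOnNhd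
      (fun z hz ↦ (hΦ z hz).differentiableAt.differentiableWithinAt) Metric.isOpen_ball
  have hP1 : AnalyticAt ℂ expLogZeta ((1 : ℝ) : ℂ) := analyticAt_expLogZeta (by norm_num)
  have hder : ∀ᶠ t : ℝ in 𝓝 1, deriv expLogZeta t = Q t := by
    filter_upwards [Ioi_mem_nhds one_pos] with t ht
    rw [hQ]
    simp only
    rw [hHe t ht, mertensRemainder_laplace_eq ht]
    have h1 : (1 : ℂ) + t ≠ 0 := by
      exact_mod_cast (by linarith [mem_Ioi.1 ht] : 0 < 1 + t).ne'
    have e3 : Complex.exp t * Complex.exp (-t) = 1 := by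
      rw [← Complex.exp_add]; simp
    field_simp
    linear_combination -(deriv expLogZeta t) * e3
  have hQ1 : AnalyticAt ℂ Q ((1 : ℝ) : ℂ) :=
    hQan.analyticAt (Metric.isOpen_ball.mem_nhds h1U)
  have hder' := eventuallyEq_of_real_eventuallyEq hP1.deriv hQ1 hder
  obtain ⟨k, hk⟩ : ∃ k : ℂ, expLogZeta =ᶠ[𝓝 ((1 : ℝ) : ℂ)] fun z ↦ Φ z + k := by
    have h1 : ∀ᶠ z in 𝓝 ((1 : ℝ) : ℂ), HasDerivAt (fun z ↦ expLogZeta z - Φ z) 0 z := by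
      filter_upwards [hder', hP1.eventually_analyticAt, Metric.isOpen_ball.mem_nhds h1U]
        with z h2 h3 h4
      have := h3.differentiableAt.hasDerivAt.sub (hΦ z h4)
      rwa [h2, sub_self] at this
    obtain ⟨r, hr, hball⟩ := Metric.eventually_nhds_iff_ball.1 h1
    refine ⟨expLogZeta ((1 : ℝ) : ℂ) - Φ ((1 : ℝ) : ℂ), ?_⟩
    filter_upwards [Metric.ball_mem_nhds _ hr] with z hz
    have := (convex_ball ((1 : ℝ) : ℂ) r).is_const_of_fderivWithin_eq_zero (𝕜 := ℂ)
      (f := fun z ↦ expLogZeta z - Φ z)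
      (fun w hw ↦ (hball w hw).differentiableAt.differentiableWithinAt)
      (fun w hw ↦ by
        rw [fderivWithin_of_isOpen Metric.isOpen_ball hw]
        have := (hball w hw).hasFDerivAt.fderiv
        simpa using this)
      hz (Metric.mem_ball_self hr)
    linear_combination (this : expLogZeta z - Φ z = _)
  have hmain : EqOn mulZeta (fun z ↦ Complex.exp (z * Complex.exp z * (Φ z + k))) U := by
    refine AnalyticOnNhd.eqOn_of_preconnected_of_eventuallyEq
      (fun z _ ↦ differentiable_mulZeta.analyticAt z) ?_
      (convex_ball _ _).isPreconnected h1U ?_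
    · intro z hz
      have := hΦan z hz
      fun_prop
    · have hev : ∀ᶠ z in 𝓝 ((1 : ℝ) : ℂ), mulZeta z ∈ Complex.slitPlane :=
        (differentiable_mulZeta.continuous.continuousAt).eventually_mem
          (Complex.isOpen_slitPlane.mem_nhds (mulZeta_mem_slitPlane (by norm_num)))
      filter_upwards [hk, hev] with z hz h2
      have e3 : Complex.exp z * Complex.exp (-z) = 1 := by
        rw [← Complex.exp_add]; simp
      have e4 := mul_expLogZeta z
      have : z * Complex.exp z * (Φ z + k) = Complex.log (mulZeta z) := by
        rw [← hz]
        linear_combination Complex.exp z * e4 + Complex.log (mulZeta z) * e3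
      rw [this, Complex.exp_log (Complex.slitPlane_ne_zero h2)]
  rw [hmain (show s ∈ U from hcs)]
  exact Complex.exp_ne_zero _

/-- If `ζ` has no zero with real part larger than `1 / 2`, the Riemann hypothesis holds. -/
lemma riemannHypothesis_of_forall_ne_zero
    (h : ∀ s : ℂ, 1 / 2 < s.re → s ≠ 1 → riemannZeta s ≠ 0) : RiemannHypothesis := by
  intro s hs htriv hs1
  rcases lt_trichotomy s.re (1 / 2) with hlt | heq | hgt
  · exfalso
    have hs0 : s ≠ 0 := by
      rintro rfl
      rw [riemannZeta_zero] at hs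
      norm_num at hs
    have hG : s.Gammaℝ ≠ 0 := by
      rw [Ne, Complex.Gammaℝ_eq_zero_iff]
      rintro ⟨n, hn⟩
      rcases n with - | n
      · exact hs0 (by simpa using hn)
      · exact htriv ⟨n, by rw [hn]; push_cast; ring⟩
    have h1 : riemannXi s = 0 := by
      rw [riemannXi_eq_mul_riemannZeta hs0 hs1 hG, hs]
      simp
    have hre : 1 / 2 < (1 - s).re := by
      rw [Complex.sub_re, Complex.one_re]; linarith
    have h2 : (1 - s).Gammaℝ ≠ 0 := Complex.Gammaℝ_ne_zero_of_re_pos (by linarith)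
    have h3 : 1 - s ≠ 1 := by simpa using hs0
    have h4 : 1 - s ≠ 0 := sub_ne_zero.2 (Ne.symm hs1)
    rw [← riemannXi_one_sub, riemannXi_eq_mul_riemannZeta h4 h3 h2] at h1
    refine mul_ne_zero (mul_ne_zero h4 (sub_ne_zero.2 h3)) (mul_ne_zero h2 (h _ hre h3)) h1
  · exact heq
  · exact absurd hs (h s hgt hs1)

theorem riemannHypothesis_of_lagarias
    (H : ∀ n : ℕ, 0 < n → (ArithmeticFunction.sigma 1 n : ℝ) ≤
      (harmonic n : ℝ) + Real.exp (harmonic n : ℝ) * Real.log (harmonic n : ℝ)) :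
    RiemannHypothesis := by
  obtain ⟨K, -, hK⟩ := exists_mertensRemainder_le_of_lagarias H
  refine riemannHypothesis_of_forall_ne_zero fun s hs hs1 h0 ↦ ?_
  refine mulZeta_ne_zero_of_mertensRemainder_le hK (s := s - 1)
    (by rw [Complex.sub_re, Complex.one_re]; linarith) ?_
  rw [mulZeta_of_ne_zero (sub_ne_zero.2 hs1), add_sub_cancel, h0, mul_zero]

end

/-! ### Sums over zeros -/

section

open Filter Topology Metric Set Finset

lemma exists_differentiable_eq_pow_mul {f : ℂ → ℂ} (hf : Differentiable ℂ f) (a : ℂ)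
    (h : ¬ ∀ᶠ z in 𝓝 a, f z = 0) :
    ∃ (m : ℕ) (q : ℂ → ℂ), Differentiable ℂ q ∧ q a ≠ 0 ∧ ∀ z, f z = (z - a) ^ m * q z := by
  obtain ⟨p, hp⟩ := hf.analyticAt a
  have hp0 : p ≠ 0 := fun h0 ↦ h (hp.locally_zero_iff.2 h0)
  have hd : ∀ k : ℕ, Differentiable ℂ ((Function.swap dslope a)^[k] f) := by
    intro k
    induction k with
    | zero => exact hf
    | succ k ih =>
      rw [Function.iterate_succ_apply', Function.swap, ← differentiableOn_univ,
        Complex.differentiableOn_dslope univ_mem]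
      exact ih.differentiableOn
  exact ⟨p.order, _, hd _, hp.iterate_dslope_fslope_ne_zero hp0,
    fun z ↦ by rw [hp.eq_pow_order_mul_iterate_dslope z, smul_eq_mul]⟩

lemma not_eventually_eq_zero {f : ℂ → ℂ} (hf : Differentiable ℂ f) (h0 : f 0 ≠ 0) (a : ℂ) :
    ¬ ∃ᶠ z in 𝓝[≠] a, f z = 0 := by
  intro h
  have := AnalyticOnNhd.eqOn_zero_of_preconnected_of_frequently_eq_zero
    (fun z _ ↦ hf.analyticAt z) isPreconnected_univ (mem_univ a) h
  exact h0 (this (mem_univ 0))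

/-- Zeros in a finite set can be divided out of an entire function. -/
lemma exists_differentiable_eq_prod_mul {f : ℂ → ℂ} (hf : Differentiable ℂ f) (h0 : f 0 ≠ 0)
    (S : Finset ℂ) :
    ∃ q : ℂ → ℂ, Differentiable ℂ q ∧ (∀ a ∈ S, q a ≠ 0) ∧
      ∀ z, f z = (∏ a ∈ S, (z - a) ^ analyticOrderNatAt f a) * q z := by
  classical
  induction S using Finset.induction_on with
  | empty => exact ⟨f, hf, by simp, by simp⟩
  | insert b S hb ih =>
    obtain ⟨q, hq, hqS, hqf⟩ := ih
    have hbz : ¬ ∀ᶠ z in 𝓝 b, q z = 0 := by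
      intro h
      refine not_eventually_eq_zero hf h0 b (Eventually.frequently ?_)
      filter_upwards [nhdsWithin_le_nhds h] with z hz
      rw [hqf, hz, mul_zero]
    obtain ⟨m, q', hq', hqb, hqq⟩ := exists_differentiable_eq_pow_mul hq b hbz
    have hP : ∏ a ∈ S, (b - a) ^ analyticOrderNatAt f a ≠ 0 :=
      Finset.prod_ne_zero_iff.2 fun a ha ↦ pow_ne_zero _
        (sub_ne_zero.2 (by rintro rfl; exact hb ha))
    have hord : analyticOrderNatAt f b = m := by
      have : analyticOrderAt f b = m := by
        rw [(hf.analyticAt b).analyticOrderAt_eq_natCast]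
        refine ⟨fun z ↦ (∏ a ∈ S, (z - a) ^ analyticOrderNatAt f a) * q' z, ?_,
          mul_ne_zero hP hqb, Eventually.of_forall fun z ↦ ?_⟩
        · exact Differentiable.analyticAt (by fun_prop) b
        · rw [hqf, hqq, smul_eq_mul]; ring
      simp [analyticOrderNatAt, this]
    refine ⟨q', hq', fun a ha ↦ ?_, fun z ↦ ?_⟩
    · rcases Finset.mem_insert.1 ha with rfl | ha
      · exact hqb
      · intro h
        exact hqS a ha (by rw [hqq, h, mul_zero])
    · rw [Finset.prod_insert hb, hqf, hqq, hord]
      ring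

lemma finite_zeros_closedBall {f : ℂ → ℂ} (hf : Differentiable ℂ f) (h0 : f 0 ≠ 0) (R : ℝ) :
    {a : ℂ | f a = 0 ∧ ‖a‖ ≤ R}.Finite := by
  by_contra h
  obtain ⟨a, -, ha⟩ := Set.Infinite.exists_accPt_of_subset_isCompact h
    (isCompact_closedBall (0 : ℂ) R) (fun z hz ↦ by simpa using hz.2)
  rw [accPt_iff_frequently_nhdsNE] at ha
  exact not_eventually_eq_zero hf h0 a (ha.mono fun z hz ↦ hz.1)

/-- The zeros of an entire function in the closed disc of radius `R`. -/
noncomputable def zerosClosedBall {f : ℂ → ℂ} (hf : Differentiable ℂ f) (h0 : f 0 ≠ 0) (R : ℝ) :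
    Finset ℂ := (finite_zeros_closedBall hf h0 R).toFinset

/-- The logarithmic derivative of a zero-free function on a disc of radius `R` is controlled by its
growth. -/
lemma norm_logDeriv_le_of_norm_le {q : ℂ → ℂ} (hq : Differentiable ℂ q) {R M : ℝ} (hR : 0 < R)
    (hM : 0 < M) (hne : ∀ z ∈ ball (0 : ℂ) R, q z ≠ 0)
    (hle : ∀ z ∈ ball (0 : ℂ) R, ‖q z‖ ≤ ‖q 0‖ * Real.exp M) {w : ℂ} (hw : ‖w‖ ≤ R / 4) :
    ‖logDeriv q w‖ ≤ 8 * M / R := by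
  have hd : DifferentiableOn ℂ (logDeriv q) (ball 0 R) := by
    intro z hz
    have h1 := hne z hz
    have h2 : DifferentiableAt ℂ (deriv q) z := (hq.analyticAt z).deriv.differentiableAt
    exact (h2.div (hq z) h1).differentiableWithinAt
  obtain ⟨h, hh0, hh⟩ := (hd.isExactOn_ball).with_val_at 0 0
  have h00 : (0 : ℂ) ∈ ball (0 : ℂ) R := mem_ball_self hR
  have hexp : ∀ z ∈ ball (0 : ℂ) R, q z = q 0 * Complex.exp (h z) := by
    intro z hz
    have hc := (convex_ball (0 : ℂ) R).is_const_of_fderivWithin_eq_zero (𝕜 := ℂ)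
      (f := fun z ↦ q z * Complex.exp (-h z))
      (fun w hw ↦ ((hq w).mul (hh w hw).differentiableAt.neg.cexp).differentiableWithinAt)
      (fun w hw ↦ by
        rw [fderivWithin_of_isOpen isOpen_ball hw]
        have := ((hq w).hasDerivAt.mul (hh w hw).neg.cexp).hasFDerivAt.fderiv
        refine this.trans ?_
        have h1 := hne w hw
        have e :
            deriv q w * Complex.exp (-h w) + q w * (Complex.exp (-h w) * -logDeriv q w) = 0 := by
          rw [logDeriv_apply]
          field_simp
          ring
        ext
        simpa using e) hz h00
    simp only [hh0, neg_zero, Complex.exp_zero, mul_one] at hc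
    rw [← hc, mul_assoc, ← Complex.exp_add]
    simp
  have hre : MapsTo h (ball 0 R) {z | z.re ≤ M} := by
    intro z hz
    have h1 := hle z hz
    rw [hexp z hz, norm_mul, Complex.norm_exp] at h1
    exact Real.exp_le_exp.1 (le_of_mul_le_mul_left h1 (norm_pos_iff.2 (hne 0 h00)))
  have hhd : DifferentiableOn ℂ h (ball 0 R) :=
    fun z hz ↦ (hh z hz).differentiableAt.differentiableWithinAt
  have hsub : ∀ z ∈ closedBall w (R / 4), ‖z‖ ≤ R / 2 := by
    intro z hz
    have h1 : ‖z - w‖ ≤ R / 4 := by simpa [dist_eq_norm] using hz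
    have h2 := norm_le_norm_add_norm_sub' z w
    linarith
  have hb : ∀ z ∈ sphere w (R / 4), ‖h z‖ ≤ 2 * M := by
    intro z hz
    have h1 := hsub z (sphere_subset_closedBall hz)
    have h2 := Complex.borelCaratheodory_zero hM hhd hre hR (z := z)
      (by rw [mem_ball_zero_iff]; linarith) hh0
    refine h2.trans ?_
    rw [div_le_iff₀ (by linarith)]
    have := norm_nonneg z
    nlinarith
  have hw' : w ∈ ball (0 : ℂ) R := by rw [mem_ball_zero_iff]; linarith
  have := Complex.norm_deriv_le_of_forall_mem_sphere_norm_le (f := h) (c := w) (R := R / 4)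
    (C := 2 * M) (by linarith)
    (DifferentiableOn.diffContOnCl (by
      rw [closure_ball _ (by linarith)]
      exact hhd.mono fun z hz ↦ by
        rw [mem_ball_zero_iff]
        linarith [hsub z hz])) hb
  rw [(hh w hw').deriv] at this
  refine this.trans (le_of_eq ?_)
  field_simp
  ring

theorem tendsto_sum_zeros {f : ℂ → ℂ} (hf : Differentiable ℂ f) (h0 : f 0 ≠ 0)
    (hgrowth : ∀ ε > 0, ∀ᶠ R in atTop, ∀ z : ℂ, ‖z‖ ≤ R → ‖f z‖ ≤ Real.exp (ε * R))
    {w : ℂ} (hw : f w ≠ 0) :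
    Tendsto (fun R ↦ ∑ a ∈ zerosClosedBall hf h0 R, analyticOrderNatAt f a / (w - a)) atTop
      (𝓝 (logDeriv f w)) := by
  rw [Metric.tendsto_nhds]
  intro ε hε
  have h4 : Tendsto (fun R : ℝ ↦ 4 * R) atTop atTop := tendsto_id.const_mul_atTop (by norm_num)
  filter_upwards [eventually_gt_atTop 0, eventually_ge_atTop (4 * ‖w‖),
    eventually_ge_atTop (-Real.log ‖f 0‖ * (1 / (ε / 100))),
    h4.eventually (hgrowth (ε / 100) (by positivity))] with R hR hRw hRf hg
  set S := zerosClosedBall hf h0 R with hS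
  have memS : ∀ a, a ∈ S ↔ f a = 0 ∧ ‖a‖ ≤ R := fun a ↦ by simp [hS, zerosClosedBall]
  obtain ⟨q, hq, hqS, hqf⟩ := exists_differentiable_eq_prod_mul hf h0 S
  set p : ℂ → ℂ := fun z ↦ ∏ a ∈ S, (z - a) ^ analyticOrderNatAt f a with hp
  have hpd : Differentiable ℂ p := by
    rw [hp]
    fun_prop
  have hqne : ∀ z, ‖z‖ ≤ R → q z ≠ 0 := by
    intro z hz h
    have : f z = 0 := by rw [hqf, h, mul_zero]
    exact hqS z ((memS z).2 ⟨this, hz⟩) h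
  have hp0 : p 0 ≠ 0 := by
    intro h
    exact h0 (by rw [hqf]; simp only [hp] at h; rw [h, zero_mul])
  have hpw : p w ≠ 0 := by
    intro h
    exact hw (by rw [hqf]; simp only [hp] at h; rw [h, zero_mul])
  have hq0 : q 0 ≠ 0 := hqne 0 (by simpa using hR.le)
  have hle : ∀ z ∈ ball (0 : ℂ) R, ‖q z‖ ≤ ‖q 0‖ * Real.exp (ε / 20 * R) := by
    intro z hz
    refine Complex.norm_le_of_forall_mem_frontier_norm_le (U := ball 0 (4 * R)) isBounded_ball
      hq.diffContOnCl ?_ (subset_closure (ball_subset_ball (by linarith) hz))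
    intro x hx
    rw [frontier_ball _ (by positivity), mem_sphere_zero_iff_norm] at hx
    have h1 := hg x hx.le
    have h2 : ‖p 0‖ ≤ ‖p x‖ := by
      rw [hp]
      simp only [norm_prod, norm_pow]
      refine Finset.prod_le_prod (fun _ _ ↦ by positivity) fun a ha ↦ ?_
      refine pow_le_pow_left₀ (by positivity) ?_ _
      have h3 := ((memS a).1 ha).2
      have h4 := norm_le_norm_add_norm_sub' x a
      rw [zero_sub, norm_neg]
      linarith
    have h5 : ‖f x‖ = ‖p x‖ * ‖q x‖ := by rw [hqf x, norm_mul]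
    have h6 : ‖f 0‖ = ‖p 0‖ * ‖q 0‖ := by rw [hqf 0, norm_mul]
    have h7 : Real.exp (ε / 100 * (4 * R)) ≤ ‖f 0‖ * Real.exp (ε / 20 * R) := by
      nth_rw 1 [← Real.exp_log (norm_pos_iff.2 h0)]
      rw [← Real.exp_add, Real.exp_le_exp]
      rw [mul_one_div, div_le_iff₀ (by positivity)] at hRf
      linarith
    have h8 : ‖p 0‖ * ‖q x‖ ≤ ‖p 0‖ * (‖q 0‖ * Real.exp (ε / 20 * R)) := by
      calc ‖p 0‖ * ‖q x‖ ≤ ‖p x‖ * ‖q x‖ := by gcongr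
        _ ≤ _ := by rw [← h5, ← mul_assoc, ← h6]; exact h1.trans h7
    exact le_of_mul_le_mul_left h8 (norm_pos_iff.2 hp0)
  have hfin := norm_logDeriv_le_of_norm_le hq hR (by positivity : 0 < ε / 20 * R)
    (fun z hz ↦ hqne z (mem_ball_zero_iff.1 hz).le) hle (w := w) (by linarith)
  have hsum : logDeriv f w = ∑ a ∈ S, analyticOrderNatAt f a / (w - a) + logDeriv q w := by
    have e : f = fun z ↦ p z * q z := funext hqf
    rw [show logDeriv f w = logDeriv (fun z ↦ p z * q z) w by rw [← e], logDeriv_mul w hpw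
      (hqne w (by linarith [norm_nonneg w])) (hpd w) (hq w)]
    congr 1
    rw [hp, logDeriv_prod]
    · refine Finset.sum_congr rfl fun a _ ↦ ?_
      rw [logDeriv_fun_pow (by fun_prop), logDeriv_apply]
      simp [div_eq_mul_inv]
    · intro a ha
      exact Finset.prod_ne_zero_iff.1 hpw a ha
    · intro a ha
      fun_prop
  rw [dist_eq_norm, hsum, sub_add_cancel_left, norm_neg]
  refine hfin.trans_lt ?_
  rw [div_lt_iff₀ hR]
  nlinarith

end

/-! ### Growth of the xi function -/

section

open Filter Topology Metric Set

/-- The entire function `G` with `G(z ^ 2) = ξ(1 / 2 + z)`. -/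
noncomputable def xiSqrt (w : ℂ) : ℂ := riemannXi (1 / 2 + w ^ (1 / 2 : ℂ))

lemma xiSqrt_sq (z : ℂ) : xiSqrt (z ^ 2) = riemannXi (1 / 2 + z) := by
  have h : ((z ^ 2) ^ (1 / 2 : ℂ)) ^ 2 = z ^ 2 := by
    rw [← Complex.cpow_nat_mul]
    norm_num
  rw [xiSqrt]
  rcases sq_eq_sq_iff_eq_or_eq_neg.1 h with h | h
  · rw [h]
  · rw [h, ← riemannXi_one_sub]
    congr 1
    ring

lemma differentiable_xiSqrt : Differentiable ℂ xiSqrt := by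
  have hslit : ∀ w ∈ Complex.slitPlane, DifferentiableAt ℂ (fun v : ℂ ↦ v ^ (1 / 2 : ℂ)) w :=
    fun w hw ↦ (differentiableAt_id.cpow_const hw)
  have h : DifferentiableOn ℂ xiSqrt {0}ᶜ := by
    intro w hw
    refine DifferentiableAt.differentiableWithinAt ?_
    by_cases hs : w ∈ Complex.slitPlane
    · exact (differentiable_riemannXi _).comp w ((hslit w hs).const_add _)
    · have hneg : -w ∈ Complex.slitPlane := by
        rw [Complex.mem_slitPlane_iff] at hs ⊢
        push Not at hs
        refine Or.inl (lt_of_le_of_ne (by simpa using hs.1) fun h ↦ hw ?_)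
        exact Complex.ext (by simpa using h) hs.2
      have e : xiSqrt = fun v ↦ riemannXi (1 / 2 + Complex.I * (-v) ^ (1 / 2 : ℂ)) := by
        ext v
        rw [← xiSqrt_sq, mul_pow, Complex.I_sq, ← Complex.cpow_nat_mul]
        norm_num
      rw [e]
      have h1 : DifferentiableAt ℂ (fun v : ℂ ↦ (-v) ^ (1 / 2 : ℂ)) w :=
        DifferentiableAt.comp w (hslit (-w) hneg) (by fun_prop)
      exact (differentiable_riemannXi _).comp w ((h1.const_mul Complex.I).const_add _)
  have h0 : ContinuousAt xiSqrt 0 := by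
    have h1 : ContinuousAt (fun v : ℂ ↦ v ^ (1 / 2 : ℂ)) 0 := by
      have := Complex.continuousAt_cpow_zero_of_re_pos (z := 1 / 2) (by norm_num)
      exact ContinuousAt.comp (f := fun v : ℂ ↦ (v, (1 / 2 : ℂ))) this (by fun_prop)
    exact differentiable_riemannXi.continuous.continuousAt.comp (h1.const_add _)
  rw [← differentiableOn_univ]
  exact (Complex.differentiableOn_compl_singleton_and_continuousAt_iff univ_mem).1
    ⟨by rwa [← compl_eq_univ_sdiff], h0⟩

lemma realLambda_one_sub (σ : ℝ) : realLambda (1 - σ) = realLambda σ := by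
  have := completedRiemannZeta₀_one_sub (σ : ℂ)
  rw [← Complex.ofReal_one, ← Complex.ofReal_sub, completedRiemannZeta₀_ofReal,
    completedRiemannZeta₀_ofReal] at this
  exact_mod_cast this

lemma norm_riemannZeta_le_two {b : ℝ} (hb : 2 ≤ b) : ‖riemannZeta b‖ ≤ 2 := by
  rw [zeta_eq_tsum_one_div_nat_cpow (by simpa using by linarith)]
  have h2 := hasSum_zeta_two
  refine (tsum_of_norm_bounded h2 fun n ↦ ?_).trans ?_
  · rcases Nat.eq_zero_or_pos n with rfl | hn
    · rw [Nat.cast_zero, Complex.zero_cpow (by exact_mod_cast (by linarith : (0 : ℝ) < b).ne')]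
      simp
    · rw [norm_div, norm_one, Complex.norm_natCast_cpow_of_pos hn, Complex.ofReal_re,
        ← Real.rpow_two]
      have : (1 : ℝ) ≤ n := by exact_mod_cast hn
      gcongr
  · have := Real.pi_lt_d2
    have := Real.pi_pos
    nlinarith

lemma realLambda_le {b : ℝ} (hb : 4 ≤ b) : realLambda b ≤ 2 * b ^ b + 1 := by
  have hb0 : (b : ℂ) ≠ 0 := by exact_mod_cast (by linarith : (0 : ℝ) < b).ne'
  have h1 := completedRiemannZeta_eq b
  have h2 := riemannZeta_def_of_ne_zero hb0
  have hG : (b : ℂ).Gammaℝ ≠ 0 := Complex.Gammaℝ_ne_zero_of_re_pos (by simpa using by linarith)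
  rw [eq_div_iff hG, h1, completedRiemannZeta₀_ofReal] at h2
  have h3 : (realLambda b : ℂ) =
      riemannZeta b * (b : ℂ).Gammaℝ + ((1 / b - 1 / (b - 1) : ℝ) : ℂ) := by
    have hb1 : (b : ℂ) - 1 ≠ 0 := by
      rw [← Complex.ofReal_one, ← Complex.ofReal_sub]
      exact_mod_cast (by linarith : (0 : ℝ) < b - 1).ne'
    have hb1' : 1 - (b : ℂ) ≠ 0 := by rw [← neg_sub]; exact neg_ne_zero.2 hb1
    rw [h2]
    push_cast
    field_simp
    ring
  have h4 : ‖(b : ℂ).Gammaℝ‖ ≤ b ^ b := by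
    rw [Complex.Gammaℝ_def, norm_mul, Complex.norm_cpow_eq_rpow_re_of_pos Real.pi_pos,
      show (b : ℂ) / 2 = ((b / 2 : ℝ) : ℂ) by push_cast; rfl, Complex.Gamma_ofReal,
      Complex.norm_real, Real.norm_of_nonneg (Real.Gamma_pos_of_pos (by linarith)).le]
    have h5 : Real.pi ^ (-(b : ℂ) / 2).re ≤ 1 := by
      refine Real.rpow_le_one_of_one_le_of_nonpos (by linarith [Real.pi_gt_three]) ?_
      rw [show (-(b : ℂ) / 2) = ((-b / 2 : ℝ) : ℂ) by push_cast; rfl, Complex.ofReal_re]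
      linarith
    set m := ⌈b / 2⌉₊ with hm
    have hm1 : b / 2 ≤ m := Nat.le_ceil _
    have hm2 : (m : ℝ) < b / 2 + 1 := Nat.ceil_lt_add_one (by linarith)
    have h6 : Real.Gamma (b / 2) ≤ b ^ b := by
      calc Real.Gamma (b / 2) ≤ Real.Gamma (m + 1) :=
            Real.Gamma_strictMonoOn_Ici.monotoneOn (mem_Ici.2 (by linarith))
              (mem_Ici.2 (by linarith)) (by linarith)
        _ = m.factorial := Real.Gamma_nat_eq_factorial m
        _ ≤ (m : ℝ) ^ m := by exact_mod_cast Nat.factorial_le_pow m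
        _ ≤ b ^ m := by gcongr; linarith
        _ = b ^ (m : ℝ) := (Real.rpow_natCast _ _).symm
        _ ≤ b ^ b := Real.rpow_le_rpow_of_exponent_le (by linarith) (by linarith)
    have := Real.Gamma_pos_of_pos (s := b / 2) (by linarith)
    nlinarith
  have h5 : |realLambda b| ≤ 2 * b ^ b + 1 := by
    rw [← Real.norm_eq_abs, ← Complex.norm_real, h3]
    refine (norm_add_le _ _).trans (add_le_add ?_ ?_)
    · rw [norm_mul]
      exact mul_le_mul (norm_riemannZeta_le_two (by linarith)) h4 (norm_nonneg _) (by norm_num)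
    · rw [Complex.norm_real, Real.norm_eq_abs, abs_le]
      have h6 : 1 / b ≤ 1 := by rw [div_le_one (by linarith)]; linarith
      have h7 : 1 / (b - 1) ≤ 1 := by rw [div_le_one (by linarith)]; linarith
      have h8 : 0 ≤ 1 / b := by positivity
      have h9 : 0 ≤ 1 / (b - 1) := div_nonneg zero_le_one (by linarith)
      constructor <;> linarith
  exact (le_abs_self _).trans h5

lemma norm_riemannXi_le {z : ℂ} {r : ℝ} (hr : ‖z‖ ≤ r) (h2 : 2 ≤ r) :
    ‖riemannXi (1 / 2 + z)‖ ≤ (r + 2) ^ (r + 7) := by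
  set b := r + 2 with hb
  have h1 : |(1 / 2 + z).re - 1 / 2| ≤ r := by
    have := (Complex.abs_re_le_norm z).trans hr
    simpa using this
  rw [abs_le] at h1
  have h3 := norm_completedRiemannZeta₀_le (1 / 2 + z)
  have h4 := realLambda_le_add (a := 1 - b) (b := b) (σ := (1 / 2 + z).re) (by linarith)
    (by linarith)
  rw [realLambda_one_sub] at h4
  have h5 := realLambda_le (b := b) (by linarith)
  have h6 : ‖1 / 2 + z‖ ≤ b := by
    refine (norm_add_le _ _).trans ?_
    norm_num; linarith
  have h7 : ‖1 / 2 + z - 1‖ ≤ b := by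
    rw [show 1 / 2 + z - 1 = z - 1 / 2 by ring]
    refine (norm_sub_le _ _).trans ?_
    norm_num; linarith
  have hbb : 1 ≤ b ^ b := Real.one_le_rpow (by linarith) (by linarith)
  calc ‖riemannXi (1 / 2 + z)‖ ≤ 1 + b * b * (2 * (2 * b ^ b + 1)) := by
        rw [riemannXi]
        refine (norm_add_le _ _).trans ?_
        rw [norm_one, norm_mul, norm_mul]
        have : ‖completedRiemannZeta₀ (1 / 2 + z)‖ ≤ 2 * (2 * b ^ b + 1) := by linarith
        gcongr
    _ ≤ b ^ b * b ^ 5 := by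
        have h8 : 4 ≤ b := by linarith
        have h9 : 64 ≤ b ^ 3 := by
          calc (64 : ℝ) = 4 ^ 3 := by norm_num
            _ ≤ b ^ 3 := by gcongr
        have h10 : 16 ≤ b * b := by nlinarith
        have h11 : b ^ b * b ^ 5 = b ^ b * (b * b) * b ^ 3 := by ring
        have h12 : b * b ≤ b ^ b * (b * b) := by nlinarith
        rw [h11]
        nlinarith
    _ = b ^ (r + 7) := by
        rw [← Real.rpow_natCast b 5, ← Real.rpow_add (by linarith)]
        congr 1
        rw [hb]; push_cast; ring

lemma xiSqrt_growth {ε : ℝ} (hε : 0 < ε) :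
    ∀ᶠ R in atTop, ∀ w : ℂ, ‖w‖ ≤ R → ‖xiSqrt w‖ ≤ Real.exp (ε * R) := by
  have hlog : ∀ᶠ b : ℝ in atTop, Real.log b ≤ ε / 4 * b := by
    have := Real.isLittleO_log_id_atTop.def (c := ε / 4) (by positivity)
    filter_upwards [this, eventually_ge_atTop 0] with b hb hb0
    rw [id, Real.norm_of_nonneg hb0] at hb
    exact (le_abs_self _).trans hb
  have ht : Tendsto (fun R : ℝ ↦ √R + 2) atTop atTop :=
    tendsto_atTop_add_const_right _ _ Real.tendsto_sqrt_atTop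
  filter_upwards [ht.eventually hlog, Real.tendsto_sqrt_atTop.eventually_ge_atTop 10,
    eventually_ge_atTop 0] with R h1 h2 hR w hw
  set z := w ^ (1 / 2 : ℂ) with hz
  have hzn : ‖z‖ ≤ √R := by
    refine Real.le_sqrt_of_sq_le ?_
    rw [← norm_pow, hz, ← Complex.cpow_nat_mul]
    norm_num
    exact hw
  rw [xiSqrt]
  refine (norm_riemannXi_le hzn (by linarith)).trans ?_
  rw [Real.rpow_def_of_pos (by linarith), Real.exp_le_exp]
  have h3 : √R * √R = R := Real.mul_self_sqrt hR
  calc Real.log (√R + 2) * (√R + 7) ≤ ε / 4 * (√R + 2) * (√R + 7) := by gcongr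
    _ = ε * ((√R + 2) * (√R + 7) / 4) := by ring
    _ ≤ ε * R := by
      gcongr
      nlinarith

end

/-! ### Zeros of the xi function -/

section

open Filter Topology Metric Set

lemma re_eq_half_of_riemannXi_eq_zero (h : RiemannHypothesis) {s : ℂ} (hs : riemannXi s = 0) :
    s.re = 1 / 2 := by
  have key : ∀ s : ℂ, 1 / 2 ≤ s.re → riemannXi s = 0 → s.re = 1 / 2 := by
    intro s hre hs
    have h0 : s ≠ 0 := by rintro rfl; simp [riemannXi_zero] at hs
    have h1 : s ≠ 1 := by rintro rfl; simp [riemannXi_one] at hs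
    have hG : s.Gammaℝ ≠ 0 := Complex.Gammaℝ_ne_zero_of_re_pos (by linarith)
    rw [riemannXi_eq_mul_riemannZeta h0 h1 hG] at hs
    have hz : riemannZeta s = 0 := by
      simpa [h0, sub_ne_zero.2 h1, hG] using hs
    refine h s hz ?_ h1
    rintro ⟨n, hn⟩
    have := congrArg Complex.re hn
    simp at this
    have hn : (0 : ℝ) ≤ n := n.cast_nonneg
    linarith
  rcases le_total (1 / 2) s.re with hre | hre
  · exact key s hre hs
  · have := key (1 - s) (by simp; linarith) (by rw [riemannXi_one_sub, hs])
    simp at this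
    linarith

lemma xiSqrt_zero_ne_zero : xiSqrt 0 ≠ 0 := by
  have h := riemannXi_ne_zero_of_mem_Icc (σ := 1 / 2) ⟨by norm_num, by norm_num⟩
  have h2 := xiSqrt_sq 0
  simp only [ne_eq, OfNat.ofNat_ne_zero, not_false_eq_true, zero_pow, add_zero] at h2
  rw [h2]
  simpa using h

lemma xiSqrt_zero_eq_neg_sq (h : RiemannHypothesis) {a : ℂ} (ha : xiSqrt a = 0) :
    ∃ γ : ℝ, a = -(γ : ℂ) ^ 2 := by
  have h2 : (a ^ (1 / 2 : ℂ)) ^ 2 = a := by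
    rw [← Complex.cpow_nat_mul]
    norm_num
  rw [← h2, xiSqrt_sq] at ha
  have := re_eq_half_of_riemannXi_eq_zero h ha
  refine ⟨(a ^ (1 / 2 : ℂ)).im, ?_⟩
  have h3 : a ^ (1 / 2 : ℂ) = (a ^ (1 / 2 : ℂ)).im * Complex.I := by
    apply Complex.ext
    · simpa using this
    · simp
  rw [h3, mul_pow, Complex.I_sq, mul_neg_one] at h2
  exact h2.symm

lemma countable_zeros {f : ℂ → ℂ} (hf : Differentiable ℂ f) (h0 : f 0 ≠ 0) :
    {a | f a = 0}.Countable := by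
  refine (countable_iUnion fun n : ℕ ↦ (zerosClosedBall hf h0 n).countable_toSet).mono fun a ha ↦ ?_
  obtain ⟨n, hn⟩ := exists_nat_ge ‖a‖
  exact mem_iUnion.2 ⟨n, by simpa [zerosClosedBall] using ⟨ha, hn⟩⟩

/-- On the Riemann hypothesis, the logarithmic derivative of `ξ` is a sum over zeros with
nonnegative terms. -/
theorem exists_hasSum_logDeriv_riemannXi (h : RiemannHypothesis) :
    ∃ (ι : Type) (_ : Countable ι) (m γ : ι → ℝ), (∀ i, 0 ≤ m i) ∧ ∀ z : ℝ, 0 < z →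
      ∃ L : ℝ, HasSum (fun i ↦ m i * (2 * z / (z ^ 2 + γ i ^ 2))) L ∧
        logDeriv riemannXi (1 / 2 + z) = L := by
  choose γ hγ using fun a : {a // xiSqrt a = 0} ↦ xiSqrt_zero_eq_neg_sq h a.2
  refine ⟨{a // xiSqrt a = 0},
    (countable_zeros differentiable_xiSqrt xiSqrt_zero_ne_zero).to_subtype,
    fun a ↦ analyticOrderNatAt xiSqrt a, γ, fun a ↦ Nat.cast_nonneg _, fun z hz ↦ ?_⟩
  have hw : xiSqrt ((z : ℂ) ^ 2) ≠ 0 := by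
    rw [xiSqrt_sq]
    intro h0
    have := re_eq_half_of_riemannXi_eq_zero h h0
    simp at this
    linarith
  have hlim := tendsto_sum_zeros differentiable_xiSqrt xiSqrt_zero_ne_zero
    (fun ε hε ↦ xiSqrt_growth hε) hw
  set t : {a // xiSqrt a = 0} → ℝ := fun a ↦ analyticOrderNatAt xiSqrt a * (1 / (z ^ 2 + γ a ^ 2))
    with ht
  have ht0 : ∀ a, 0 ≤ t a := fun a ↦ by simp only [ht]; positivity
  set S := fun R ↦ (zerosClosedBall differentiable_xiSqrt xiSqrt_zero_ne_zero R).subtype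
    (fun a ↦ xiSqrt a = 0) with hS
  have hsum : ∀ R, ∑ a ∈ zerosClosedBall differentiable_xiSqrt xiSqrt_zero_ne_zero R,
      (analyticOrderNatAt xiSqrt a / ((z : ℂ) ^ 2 - a) : ℂ) = ((∑ a ∈ S R, t a : ℝ) : ℂ) := by
    intro R
    rw [← Finset.sum_subtype_of_mem (p := fun a ↦ xiSqrt a = 0), Complex.ofReal_sum]
    · refine Finset.sum_congr rfl fun a _ ↦ ?_
      simp only [ht]
      nth_rewrite 2 [hγ a]
      push_cast
      rw [sub_neg_eq_add, mul_one_div]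
    · intro a ha
      simp only [zerosClosedBall, Finite.mem_toFinset, mem_ofPred_eq] at ha
      exact ha.1
  simp_rw [hsum] at hlim
  have hre := (Complex.continuous_re.tendsto _).comp hlim
  have him := (Complex.continuous_im.tendsto _).comp hlim
  simp only [Function.comp_def, Complex.ofReal_re, Complex.ofReal_im] at hre him
  have him0 : (logDeriv xiSqrt ((z : ℂ) ^ 2)).im = 0 := (tendsto_nhds_unique him tendsto_const_nhds)
  set l := (logDeriv xiSqrt ((z : ℂ) ^ 2)).re with hl
  have hls : HasSum t l := by
    refine hasSum_of_isLUB_of_nonneg _ ht0 ⟨?_, fun b hb ↦ ?_⟩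
    · rintro _ ⟨s, rfl⟩
      refine ge_of_tendsto hre ?_
      have : ∀ᶠ R : ℝ in atTop, ∀ a ∈ s, ‖(a : ℂ)‖ ≤ R :=
        (Finset.eventually_all s).2 fun a _ ↦ eventually_ge_atTop _
      filter_upwards [this] with R hR
      refine Finset.sum_le_sum_of_subset_of_nonneg (fun a ha ↦ ?_) fun a _ _ ↦ ht0 a
      simpa [hS, zerosClosedBall] using ⟨a.2, hR a ha⟩
    · exact le_of_tendsto' hre fun R ↦ hb ⟨S R, rfl⟩
  refine ⟨l * (2 * z), ?_, ?_⟩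
  · refine (hls.mul_right (2 * z)).congr_fun fun i ↦ ?_
    simp only [ht]
    ring
  · have h1 : (fun v : ℂ ↦ riemannXi (1 / 2 + v)) = xiSqrt ∘ fun v ↦ v ^ 2 := by
      ext v
      exact (xiSqrt_sq v).symm
    have h2 : logDeriv (fun v : ℂ ↦ riemannXi (1 / 2 + v)) z = logDeriv riemannXi (1 / 2 + z) := by
      rw [logDeriv_apply, logDeriv_apply, deriv_comp_const_add]
    rw [← h2, h1, logDeriv_comp differentiable_xiSqrt.differentiableAt (by fun_prop)]
    have h3 : logDeriv xiSqrt ((z : ℂ) ^ 2) = l := Complex.ext (by simp [hl]) (by simp [him0])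
    rw [h3]
    simp

end

/-! ### Values of the digamma function -/

section

open Filter Topology Set

lemma hasSum_logDeriv_Gamma {x : ℝ} (hx : 1 ≤ x) :
    HasSum (fun n : ℕ ↦ 1 / ((n : ℝ) + 1) - 1 / (n + x))
      (logDeriv Real.Gamma x + Real.eulerMascheroniConstant) := by
  set f := Real.log ∘ Real.Gamma
  have hc : ConvexOn ℝ (Ioi 0) f := Real.convexOn_log_Gamma
  have h_rec (x : ℝ) (hx : 0 < x) : f (x + 1) = f x + Real.log x := by
    simp only [f, Function.comp_apply, Real.Gamma_add_one hx.ne',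
      Real.log_mul hx.ne' (Real.Gamma_pos_of_pos hx).ne', add_comm]
  have hdG {x : ℝ} (hx : 0 < x) : DifferentiableAt ℝ Real.Gamma x :=
    Real.differentiableAt_Gamma fun m ↦ ne_of_gt (by linarith [m.cast_nonneg (α := ℝ)])
  have hder {x : ℝ} (hx : 0 < x) : DifferentiableAt ℝ f x :=
    (hdG hx).log (Real.Gamma_pos_of_pos hx).ne'
  have hder_rec (x : ℝ) (hx : 0 < x) : deriv f (x + 1) = deriv f x + 1 / x := by
    rw [← deriv_comp_add_const, one_div, ← Real.deriv_log,
      ← deriv_add (hder <| by positivity) (Real.differentiableAt_log hx.ne')]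
    apply EventuallyEq.deriv_eq
    filter_upwards [eventually_gt_nhds hx] using h_rec
  have lb (x : ℝ) (hx : 0 < x) : Real.log x ≤ deriv f (x + 1) := by
    refine (le_of_eq ?_).trans <| hc.slope_le_deriv (mem_Ioi.mpr hx)
      (by positivity : 0 < x + 1) (by linarith) (hder <| by positivity)
    rw [slope_def_field, add_sub_cancel_left, div_one, h_rec x hx, add_sub_cancel_left]
  have ub (x : ℝ) (hx : 0 < x) : deriv f x ≤ Real.log x := by
    refine (hc.deriv_le_slope hx (by positivity : (0 : ℝ) < x + 1)
        (by linarith) (hder <| by positivity)).trans (le_of_eq ?_)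
    rw [slope_def_field, add_sub_cancel_left, div_one, h_rec x hx, add_sub_cancel_left]
  have hx0 : 0 < x := by linarith
  have hfx : deriv f x = logDeriv Real.Gamma x := by
    rw [logDeriv_apply]
    exact ((hdG hx0).hasDerivAt.log (Real.Gamma_pos_of_pos hx0).ne').deriv
  have hpart (N : ℕ) : ∑ n ∈ Finset.range N, (1 / ((n : ℝ) + 1) - 1 / (n + x)) =
      harmonic N - (deriv f (x + N) - deriv f x) := by
    induction N with
    | zero => simp
    | succ N ih =>
      rw [Finset.sum_range_succ, ih, harmonic_succ,
        show x + ((N + 1 : ℕ) : ℝ) = x + N + 1 by push_cast; ring, hder_rec (x + N) (by positivity)]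
      push_cast
      ring
  rw [← hfx]
  have hlog (c : ℝ) : Tendsto (fun N : ℕ ↦ Real.log (N + c) - Real.log N) atTop (𝓝 0) :=
    (Real.tendsto_log_comp_add_sub_log c).comp tendsto_natCast_atTop_atTop
  have h1 : Tendsto (fun N : ℕ ↦ deriv f (x + N) - Real.log N) atTop (𝓝 0) := by
    refine tendsto_of_tendsto_of_tendsto_of_le_of_le' (hlog (x - 1)) (hlog x) ?_ ?_
    · filter_upwards [eventually_gt_atTop 0] with N hN
      have hN : (0 : ℝ) < N := Nat.cast_pos.2 hN
      have := lb (N + (x - 1)) (by linarith)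
      rw [show (N : ℝ) + (x - 1) + 1 = x + N by ring] at this
      linarith
    · filter_upwards with N
      have := ub (x + N) (by positivity)
      rw [add_comm (N : ℝ)]
      linarith
  rw [hasSum_iff_tendsto_nat_of_nonneg]
  · simp_rw [hpart]
    have := ((Real.tendsto_harmonic_sub_log.sub h1).add_const (deriv f x))
    rw [sub_zero, add_comm] at this
    refine this.congr fun N ↦ ?_
    ring
  · intro n
    rw [sub_nonneg]
    exact one_div_le_one_div_of_le (by positivity) (by linarith)

lemma logDeriv_Gamma_ofReal {x : ℝ} (hx : 0 < x) :
    logDeriv Complex.Gamma x = (logDeriv Real.Gamma x : ℝ) := by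
  have h1 : HasDerivAt Complex.Gamma (deriv Complex.Gamma x) x :=
    (Complex.differentiableAt_Gamma _ fun m h ↦ by
      have := congrArg Complex.re h
      simp at this
      linarith [m.cast_nonneg (α := ℝ)]).hasDerivAt
  have h2 : HasDerivAt Real.Gamma (deriv Real.Gamma x) x :=
    (Real.differentiableAt_Gamma fun m ↦ ne_of_gt (by linarith [m.cast_nonneg (α := ℝ)])).hasDerivAt
  have h3 := h1.comp_ofReal
  simp_rw [Complex.Gamma_ofReal] at h3
  have h4 := h3.unique h2.ofReal_comp
  rw [logDeriv_apply, logDeriv_apply, h4, Complex.Gamma_ofReal]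
  push_cast
  rfl

/-- The von Mangoldt Dirichlet series in terms of `ξ` and `Γ`. -/
lemma tsum_vonMangoldt_eq {δ : ℝ} (hδ : 0 < δ) :
    ((∑' n : ℕ, ArithmeticFunction.vonMangoldt n * (n : ℝ) ^ (-(1 + δ)) : ℝ) : ℂ) =
      1 / δ - logDeriv riemannXi (1 + δ) - Real.log Real.pi / 2 +
        (logDeriv Real.Gamma ((1 + δ) / 2 + 1) : ℝ) / 2 := by
  rw [tsum_vonMangoldt hδ]
  have hδ' : (δ : ℂ) ≠ 0 := by exact_mod_cast hδ.ne'
  have hne : ∀ᶠ z : ℂ in 𝓝 (δ : ℂ), 0 < z.re :=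
    Complex.continuous_re.continuousAt.eventually (lt_mem_nhds (by simpa using hδ))
  have he : (fun z : ℂ ↦ riemannXi (1 + z)) =ᶠ[𝓝 (δ : ℂ)]
      fun z ↦ (2 * (Real.pi : ℂ) ^ (-(1 + z) / 2)) *
        (Complex.Gamma ((1 + z) / 2 + 1) * mulZeta z) := by
    filter_upwards [hne] with z hz
    have hz0 : z ≠ 0 := by rintro rfl; simp at hz
    have hz1 : 1 + z ≠ 0 := by
      intro h
      have := congrArg Complex.re h
      simp at this
      linarith
    rw [riemannXi_eq_mul_riemannZeta hz1 (by simpa using hz0)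
      (Complex.Gammaℝ_ne_zero_of_re_pos (by simp; linarith)), mulZeta_of_ne_zero hz0,
      Complex.Gammaℝ_def, Complex.Gamma_add_one _ (div_ne_zero hz1 two_ne_zero)]
    ring
  have h1 : logDeriv riemannXi (1 + δ) = logDeriv (fun z : ℂ ↦ riemannXi (1 + z)) δ := by
    rw [logDeriv_apply, logDeriv_apply, deriv_comp_const_add]
  have hG : (1 + (δ : ℂ)) / 2 + 1 = (((1 + δ) / 2 + 1 : ℝ) : ℂ) := by push_cast; ring
  have hx : 0 < (1 + δ) / 2 + 1 := by positivity
  have dG : DifferentiableAt ℂ Complex.Gamma ((1 + (δ : ℂ)) / 2 + 1) :=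
    Complex.differentiableAt_Gamma _ fun m h ↦ by
      have := congrArg Complex.re h
      simp at this
      linarith [m.cast_nonneg (α := ℝ)]
  have hpi : (Real.pi : ℂ) ≠ 0 := by exact_mod_cast Real.pi_ne_zero
  have e1 : HasDerivAt (fun z : ℂ ↦ 2 * (Real.pi : ℂ) ^ (-(1 + z) / 2))
      (2 * ((Real.pi : ℂ) ^ (-(1 + (δ : ℂ)) / 2) * Complex.log Real.pi * (-(1 : ℂ) / 2))) δ := by
    have : HasDerivAt (fun z : ℂ ↦ -(1 + z) / 2) (-(1 : ℂ) / 2) δ :=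
      (((hasDerivAt_id (δ : ℂ)).const_add 1).neg).div_const 2
    exact (this.const_cpow (Or.inl hpi)).const_mul 2
  have e2 : DifferentiableAt ℂ (fun z : ℂ ↦ Complex.Gamma ((1 + z) / 2 + 1)) δ :=
    DifferentiableAt.comp (δ : ℂ) dG (by fun_prop)
  have g1 : (2 * (Real.pi : ℂ) ^ (-(1 + (δ : ℂ)) / 2)) ≠ 0 := by
    simp [Complex.cpow_eq_zero_iff, hpi]
  have g2 : Complex.Gamma ((1 + (δ : ℂ)) / 2 + 1) ≠ 0 := by
    rw [hG, Complex.Gamma_ofReal]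
    exact_mod_cast (Real.Gamma_pos_of_pos hx).ne'
  have g3 : mulZeta δ ≠ 0 := Complex.slitPlane_ne_zero (mulZeta_mem_slitPlane_of_pos hδ)
  have h2 : logDeriv (fun z : ℂ ↦ Complex.Gamma ((1 + z) / 2 + 1)) δ =
      (logDeriv Real.Gamma ((1 + δ) / 2 + 1) : ℝ) / 2 := by
    rw [← logDeriv_Gamma_ofReal hx, ← hG]
    have := logDeriv_comp (f := Complex.Gamma) (g := fun z : ℂ ↦ (1 + z) / 2 + 1) (x := (δ : ℂ)) dG
      (by fun_prop)
    rw [Function.comp_def] at this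
    rw [this]
    have hd : HasDerivAt (fun z : ℂ ↦ (1 + z) / 2 + 1) (1 / 2 : ℂ) δ :=
      (((hasDerivAt_id (δ : ℂ)).const_add 1).div_const 2).add_const 1
    rw [hd.deriv]
    ring
  have hm2 := logDeriv_mul (f := fun z : ℂ ↦ Complex.Gamma ((1 + z) / 2 + 1)) (g := mulZeta) (δ : ℂ)
    g2 g3 e2 differentiable_mulZeta.differentiableAt
  have hm1 := logDeriv_mul (f := fun z : ℂ ↦ 2 * (Real.pi : ℂ) ^ (-(1 + z) / 2))
    (g := fun z ↦ Complex.Gamma ((1 + z) / 2 + 1) * mulZeta z) (δ : ℂ) g1 (mul_ne_zero g2 g3)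
    e1.differentiableAt (e2.mul differentiable_mulZeta.differentiableAt)
  rw [h1, (logDeriv_congr_nhds he).eq_of_nhds, hm1, hm2, h2,
    logDeriv_apply (fun z : ℂ ↦ 2 * (Real.pi : ℂ) ^ (-(1 + z) / 2)), e1.deriv,
    ← Complex.ofReal_log Real.pi_pos.le]
  have : (2 * ((Real.pi : ℂ) ^ (-(1 + (δ : ℂ)) / 2) * Real.log Real.pi * (-(1 : ℂ) / 2))) /
      (2 * (Real.pi : ℂ) ^ (-(1 + (δ : ℂ)) / 2)) = -(Real.log Real.pi / 2 : ℂ) := by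
    rw [div_eq_iff g1]
    ring
  rw [this]
  ring

end

/-! ### The remainder in the prime number theorem -/

section

open MeasureTheory Set Filter Topology
open scoped ArithmeticFunction.vonMangoldt

/-- The weighted sum `Σ_n Λ(n) (1 / n - e^{-u})⁺`. -/
noncomputable def psiSum (u : ℝ) : ℝ :=
  ∑ n ∈ Finset.Icc 0 ⌊Real.exp u⌋₊, Λ n * (1 / n - Real.exp (-u))

lemma exp_neg_le_of_mem_Icc {u : ℝ} {n : ℕ} (hn : n ∈ Finset.Icc 0 ⌊Real.exp u⌋₊) (h0 : n ≠ 0) :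
    Real.exp (-u) ≤ 1 / n := by
  rw [Real.exp_neg, one_div]
  have h : (n : ℝ) ≤ Real.exp u :=
    (Nat.le_floor_iff (Real.exp_pos u).le).1 (Finset.mem_Icc.1 hn).2
  gcongr

lemma psiSum_nonneg (u : ℝ) : 0 ≤ psiSum u := by
  refine Finset.sum_nonneg fun n hn ↦ ?_
  rcases eq_or_ne n 0 with rfl | h0
  · simp
  · exact mul_nonneg ArithmeticFunction.vonMangoldt_nonneg
      (sub_nonneg.2 (exp_neg_le_of_mem_Icc hn h0))

lemma psiSum_eq_sum_max {u : ℝ} {N : ℕ} (hN : ⌊Real.exp u⌋₊ ≤ N) :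
    psiSum u = ∑ n ∈ Finset.Icc 0 N, Λ n * max (1 / n - Real.exp (-u)) 0 := by
  have h1 : psiSum u = ∑ n ∈ Finset.Icc 0 ⌊Real.exp u⌋₊, Λ n * max (1 / n - Real.exp (-u)) 0 := by
    refine Finset.sum_congr rfl fun n hn ↦ ?_
    rcases eq_or_ne n 0 with rfl | h0
    · simp
    · rw [max_eq_left (sub_nonneg.2 (exp_neg_le_of_mem_Icc hn h0))]
  rw [h1]
  refine Finset.sum_subset (Finset.Icc_subset_Icc_right hN) fun n hn hn' ↦ ?_
  have : Real.exp u < n := by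
    rw [← Nat.floor_lt (Real.exp_pos u).le]
    by_contra! h
    exact hn' (Finset.mem_Icc.2 ⟨Nat.zero_le _, h⟩)
  have h2 : (1 : ℝ) / n ≤ Real.exp (-u) := by
    rw [Real.exp_neg, one_div]
    exact inv_anti₀ (Real.exp_pos u) this.le
  rw [max_eq_right (by linarith), mul_zero]

lemma continuous_psiSum : Continuous psiSum := by
  rw [continuous_iff_continuousAt]
  intro u₀
  have : psiSum =ᶠ[𝓝 u₀] fun u ↦ ∑ n ∈ Finset.Icc 0 ⌊Real.exp (u₀ + 1)⌋₊,
      Λ n * max (1 / (n : ℝ) - Real.exp (-u)) 0 := by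
    filter_upwards [gt_mem_nhds (lt_add_one u₀)] with u hu
    exact psiSum_eq_sum_max (Nat.floor_mono (Real.exp_le_exp.2 hu.le))
  refine ContinuousAt.congr ?_ this.symm
  fun_prop

section

variable {δ : ℝ} (hδ : 0 < δ)
include hδ

lemma psiSum_laplace :
    IntegrableOn (fun u ↦ psiSum u * Real.exp (-δ * u)) (Ioi 0) ∧
    ∫ u in Ioi 0, psiSum u * Real.exp (-δ * u)
      = (∑' n : ℕ, Λ n * (n : ℝ) ^ (-(1 + δ))) * (1 / (δ * (1 + δ))) := by
  have hterm : ∀ n : ℕ, Λ n * (n : ℝ) ^ (-δ) *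
      (0 * (Real.log n / δ + 1 / δ ^ 2) + 1 / n / δ - 1 / n / (1 + δ)) =
      Λ n * (n : ℝ) ^ (-(1 + δ)) * (1 / (δ * (1 + δ))) := by
    intro n
    rcases Nat.eq_zero_or_pos n with rfl | hn
    · simp
    have hn0 : (0 : ℝ) < n := by positivity
    have : (n : ℝ) ^ (-(1 + δ)) = (n : ℝ) ^ (-δ) / n := by
      rw [neg_add, add_comm, Real.rpow_add hn0, Real.rpow_neg_one, div_eq_mul_inv]
    rw [this]
    have : (1 + δ) ≠ 0 := by positivity
    field_simp
    ring
  have h := laplace_sum_floor_exp (c := fun n ↦ Λ n) (a := fun n ↦ 0)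
    (b := fun n ↦ 1 / n) (fun n ↦ ArithmeticFunction.vonMangoldt_nonneg)
    (fun n ↦ le_rfl) (fun n hn ↦ by simp) (by simp) hδ (by
      refine ((summable_vonMangoldt hδ).mul_right (1 / (δ * (1 + δ)))).congr fun n ↦ ?_
      exact (hterm n).symm)
  rw [tsum_congr hterm, tsum_mul_right] at h
  simp only [zero_mul, zero_add] at h
  exact h

lemma hasIntegral_exp_mul {c : ℝ} (hc : 0 ≤ c) :
    IntegrableOn (fun u ↦ Real.exp (-c * u) * Real.exp (-δ * u)) (Ioi 0) ∧
    ∫ u in Ioi (0 : ℝ), Real.exp (-c * u) * Real.exp (-δ * u) = 1 / (δ + c) := by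
  have h := hasIntegral_exp (δ := δ + c) (by positivity)
  have e : ∀ u : ℝ, Real.exp (-c * u) * Real.exp (-δ * u) = Real.exp (-(δ + c) * u) := fun u ↦ by
    rw [← Real.exp_add]
    ring_nf
  simpa only [e] using h

lemma hasIntegral_one_sub_exp {c : ℝ} (hc : 0 ≤ c) :
    IntegrableOn (fun u ↦ (1 - Real.exp (-c * u)) * Real.exp (-δ * u)) (Ioi 0) ∧
    ∫ u in Ioi (0 : ℝ), (1 - Real.exp (-c * u)) * Real.exp (-δ * u) = 1 / δ - 1 / (δ + c) := by
  have h1 := hasIntegral_exp hδ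
  have h2 := hasIntegral_exp_mul hδ hc
  simp_rw [sub_mul, one_mul]
  exact ⟨h1.1.sub h2.1, by rw [integral_sub h1.1 h2.1, h1.2, h2.2]⟩

lemma hasIntegral_exp_mul_cos (γ : ℝ) :
    IntegrableOn (fun u ↦ Real.exp (-u / 2) * Real.cos (γ * u) * Real.exp (-δ * u)) (Ioi 0) ∧
    ∫ u in Ioi (0 : ℝ), Real.exp (-u / 2) * Real.cos (γ * u) * Real.exp (-δ * u)
      = (δ + 1 / 2) / ((δ + 1 / 2) ^ 2 + γ ^ 2) := by
  set a : ℂ := -(δ + 1 / 2 : ℝ) + γ * Complex.I with ha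
  have hre : a.re < 0 := by simp [ha]; linarith
  have hi := integrableOn_exp_mul_complex_Ioi hre 0
  have hv := integral_exp_mul_complex_Ioi hre 0
  have e : ∀ u : ℝ, Real.exp (-u / 2) * Real.cos (γ * u) * Real.exp (-δ * u) =
      (Complex.exp (a * u)).re := fun u ↦ by
    rw [Complex.exp_re]
    have h1 : (a * u).re = -u / 2 + -δ * u := by simp [ha]; ring
    have h2 : (a * u).im = γ * u := by simp [ha]
    rw [h1, h2, Real.exp_add]
    ring
  simp_rw [e]
  refine ⟨hi.re, ?_⟩
  have h3 := integral_re hi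
  simp only [RCLike.re_to_complex] at h3
  rw [h3, hv]
  simp only [Complex.ofReal_zero, mul_zero, Complex.exp_zero]
  have h1 : a.re = -(δ + 1 / 2) := by simp [ha]
  have h2 : a.im = γ := by simp [ha]
  rw [Complex.div_re, Complex.normSq_apply, h1, h2]
  simp only [Complex.neg_re, Complex.one_re, Complex.neg_im, Complex.one_im]
  ring

end

end

/-! ### Expansion over the zeros -/

section

open MeasureTheory Set Filter Topology
open scoped ArithmeticFunction.vonMangoldt

lemma logDeriv_riemannXi_one : logDeriv riemannXi 1 = realLambda 1 := by
  have h1 : HasDerivAt (fun s : ℂ ↦ s * (s - 1)) ((1 * (1 - 1) + 1 * 1)) 1 :=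
    (hasDerivAt_id (1 : ℂ)).mul ((hasDerivAt_id (1 : ℂ)).sub_const 1)
  have h2 := (h1.mul (differentiable_completedZeta₀ 1).hasDerivAt).const_add 1
  have h3 : deriv riemannXi 1 = _ := h2.deriv
  have h4 := completedRiemannZeta₀_ofReal 1
  rw [Complex.ofReal_one] at h4
  rw [logDeriv_apply, h3, riemannXi_one, h4]
  simp

lemma log_two_pi_lt : Real.log 2 + Real.log Real.pi < 1.84 := by
  rw [← Real.log_mul (by norm_num) Real.pi_ne_zero, Real.log_lt_iff_lt_exp (by positivity)]
  have h1 := Real.pi_lt_d4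
  have h2 := Real.sum_le_exp_of_nonneg (x := 1.84) (by norm_num) 10
  simp only [Finset.sum_range_succ, Finset.sum_range_zero, Nat.factorial] at h2
  norm_num at h2 ⊢
  linarith

lemma trivial_zero_weights :
    Summable (fun k : ℕ ↦ 1 / (2 * ((k : ℝ) + 1) * (2 * (k + 1) + 1))) ∧
    ∑' k : ℕ, 1 / (2 * ((k : ℝ) + 1) * (2 * (k + 1) + 1)) ≤ 1 := by
  have h : ∀ N : ℕ, ∑ k ∈ Finset.range N, 1 / (2 * ((k : ℝ) + 1) * (2 * (k + 1) + 1)) ≤ 1 := by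
    intro N
    have : ∑ k ∈ Finset.range N, 1 / (2 * ((k : ℝ) + 1) * (2 * (k + 1) + 1)) ≤
        1 - 1 / (N + 1) := by
      induction N with
      | zero => simp
      | succ N ih =>
        rw [Finset.sum_range_succ]
        have h2 : 1 / (2 * ((N : ℝ) + 1) * (2 * (N + 1) + 1)) ≤ 1 / (((N : ℝ) + 1) * (N + 2)) := by
          refine one_div_le_one_div_of_le (by positivity) ?_
          nlinarith [N.cast_nonneg (α := ℝ)]
        have h3 : 1 / (((N : ℝ) + 1) * (N + 2)) = 1 / (N + 1) - 1 / (N + 1 + 1) := by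
          field_simp
          ring
        push_cast
        linarith
    have h2 : (0 : ℝ) ≤ 1 / (N + 1) := by positivity
    linarith
  exact ⟨summable_of_sum_range_le (fun k ↦ by positivity) h,
    Real.tsum_le_of_sum_range_le (fun k ↦ by positivity) h⟩

section

variable {ι : Type} {m γ : ι → ℝ} {δ : ℝ}

/-- The contribution of a zero `1 / 2 + iγ` to the explicit formula. -/
noncomputable def zeroTerm (m γ : ℝ) (u : ℝ) : ℝ :=
  2 * m / (1 / 4 + γ ^ 2) * (1 / 2 * (1 + Real.exp (-1 * u)) - Real.exp (-u / 2) * Real.cos (γ * u))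

/-- The contribution of the trivial zero `-2(k + 1)` to the explicit formula. -/
noncomputable def trivialZeroTerm (k : ℕ) (u : ℝ) : ℝ :=
  1 / (2 * ((k : ℝ) + 1) * (2 * (k + 1) + 1)) * (1 - Real.exp (-(2 * (k + 1) + 1) * u))

lemma zeroTerm_nonneg {m : ℝ} (hm : 0 ≤ m) (γ u : ℝ) : 0 ≤ zeroTerm m γ u := by
  refine mul_nonneg (by positivity) ?_
  have h1 : Real.exp (-1 * u) = Real.exp (-u / 2) ^ 2 := by
    rw [← Real.exp_nat_mul]
    ring_nf
  have h2 := mul_le_of_le_one_right (Real.exp_pos (-u / 2)).le (Real.cos_le_one (γ * u))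
  rw [h1]
  nlinarith [sq_nonneg (Real.exp (-u / 2) - 1)]

lemma zeroTerm_laplace (m γ : ℝ) (hδ : 0 < δ) :
    IntegrableOn (fun u ↦ zeroTerm m γ u * Real.exp (-δ * u)) (Ioi 0) ∧
    ∫ u in Ioi 0, zeroTerm m γ u * Real.exp (-δ * u) =
      m * (2 * (δ + 1 / 2) / ((δ + 1 / 2) ^ 2 + γ ^ 2)) * (1 / (δ * (1 + δ))) := by
  obtain ⟨i1, e1⟩ := hasIntegral_exp hδ
  obtain ⟨i2, e2⟩ := hasIntegral_exp_mul hδ zero_le_one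
  obtain ⟨i3, e3⟩ := hasIntegral_exp_mul_cos hδ γ
  have e : ∀ u, zeroTerm m γ u * Real.exp (-δ * u) = 2 * m / (1 / 4 + γ ^ 2) *
      (1 / 2 * (Real.exp (-δ * u) + Real.exp (-1 * u) * Real.exp (-δ * u)) -
        Real.exp (-u / 2) * Real.cos (γ * u) * Real.exp (-δ * u)) := fun u ↦ by
    rw [zeroTerm]
    ring
  have i4 := (i1.add i2).const_mul (1 / 2)
  simp only [e]
  refine ⟨(i4.sub i3).const_mul _, ?_⟩
  rw [integral_const_mul]
  have h1 := integral_sub i4 i3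
  simp only [Pi.add_apply] at h1
  rw [h1, integral_const_mul, integral_add i1 i2, e1, e2, e3]
  have : (1 : ℝ) / 4 + γ ^ 2 ≠ 0 := by positivity
  have : 1 + δ ≠ 0 := by positivity
  have : (δ + 1 / 2) ^ 2 + γ ^ 2 ≠ 0 := by positivity
  field_simp
  ring

lemma trivialZeroTerm_laplace (k : ℕ) (hδ : 0 < δ) :
    IntegrableOn (fun u ↦ trivialZeroTerm k u * Real.exp (-δ * u)) (Ioi 0) ∧
    ∫ u in Ioi 0, trivialZeroTerm k u * Real.exp (-δ * u) =
      (1 / ((k : ℝ) + 1) - 1 / (k + ((1 + δ) / 2 + 1))) * (1 / (2 * δ * (1 + δ))) := by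
  obtain ⟨i1, e1⟩ := hasIntegral_one_sub_exp hδ (c := 2 * ((k : ℝ) + 1) + 1) (by positivity)
  simp only [trivialZeroTerm, mul_assoc (1 / (2 * ((k : ℝ) + 1) * (2 * (k + 1) + 1)))]
  refine ⟨i1.const_mul _, ?_⟩
  rw [integral_const_mul, e1]
  field_simp
  ring

lemma trivialZeroTerm_nonneg (k : ℕ) {u : ℝ} (hu : 0 ≤ u) : 0 ≤ trivialZeroTerm k u := by
  refine mul_nonneg (by positivity) (sub_nonneg.2 (Real.exp_le_one_iff.2 ?_))
  have : 0 ≤ (2 * ((k : ℝ) + 1) + 1) * u := by positivity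
  linarith

lemma hasSum_trivialZeroTerm {u : ℝ} (hu : 0 ≤ u) : ∃ T, 0 ≤ T ∧ T ≤ Real.exp (-3 * u) ∧
    HasSum (fun k ↦ trivialZeroTerm k u)
      (∑' k : ℕ, 1 / (2 * ((k : ℝ) + 1) * (2 * (k + 1) + 1)) - T) := by
  obtain ⟨hs, h1⟩ := trivial_zero_weights
  set τ : ℕ → ℝ := fun k ↦ 1 / (2 * ((k : ℝ) + 1) * (2 * (k + 1) + 1)) with hτ
  have hτ0 : ∀ k, 0 ≤ τ k := fun k ↦ by positivity
  have hle : ∀ k : ℕ, τ k * Real.exp (-(2 * (k + 1) + 1) * u) ≤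
      τ k * Real.exp (-3 * u) := fun k ↦ by
    refine mul_le_mul_of_nonneg_left (Real.exp_le_exp.2 ?_) (hτ0 k)
    nlinarith [k.cast_nonneg (α := ℝ)]
  have hs2 : Summable fun k : ℕ ↦ τ k * Real.exp (-(2 * (k + 1) + 1) * u) :=
    (hs.mul_right (Real.exp (-3 * u))).of_nonneg_of_le
      (fun k ↦ mul_nonneg (hτ0 k) (Real.exp_pos _).le) hle
  refine ⟨∑' k : ℕ, τ k * Real.exp (-(2 * (k + 1) + 1) * u),
    tsum_nonneg fun k ↦ mul_nonneg (hτ0 k) (Real.exp_pos _).le, ?_, ?_⟩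
  · refine (hs2.tsum_le_tsum hle (hs.mul_right _)).trans ?_
    rw [tsum_mul_right]
    exact mul_le_of_le_one_left (Real.exp_pos _).le h1
  · refine (hs.hasSum.sub hs2.hasSum).congr_fun fun k ↦ ?_
    simp only [trivialZeroTerm, hτ]
    ring

lemma hasSum_zeroTerm {B : ℝ} (hm : ∀ i, 0 ≤ m i)
    (hB : HasSum (fun i ↦ 2 * m i / (1 / 4 + γ i ^ 2)) B) (u : ℝ) : ∃ Q, |Q| ≤ B ∧
    HasSum (fun i ↦ zeroTerm (m i) (γ i) u)
      (B / 2 * (1 + Real.exp (-1 * u)) - Real.exp (-u / 2) * Q) := by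
  have h0 : ∀ i, 0 ≤ 2 * m i / (1 / 4 + γ i ^ 2) := fun i ↦ by have := hm i; positivity
  have hle : ∀ i, ‖2 * m i / (1 / 4 + γ i ^ 2) * Real.cos (γ i * u)‖ ≤
      2 * m i / (1 / 4 + γ i ^ 2) := fun i ↦ by
    rw [norm_mul, Real.norm_of_nonneg (h0 i), Real.norm_eq_abs]
    exact mul_le_of_le_one_right (h0 i) (Real.abs_cos_le_one _)
  have hs := Summable.of_norm_bounded hB.summable hle
  refine ⟨∑' i, 2 * m i / (1 / 4 + γ i ^ 2) * Real.cos (γ i * u),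
    by simpa using tsum_of_norm_bounded hB hle, ?_⟩
  have h1 := (hB.mul_right (1 / 2 * (1 + Real.exp (-1 * u)))).sub
    (hs.hasSum.mul_left (Real.exp (-u / 2)))
  rw [show B * (1 / 2 * (1 + Real.exp (-1 * u))) = B / 2 * (1 + Real.exp (-1 * u)) by ring] at h1
  refine h1.congr_fun fun i ↦ ?_
  simp only [zeroTerm]
  ring

end

end

/-! ### A bound for the remainder under the Riemann hypothesis -/

section

open MeasureTheory Set Filter Topology
open scoped ArithmeticFunction.vonMangoldt

lemma le_of_ae_restrict_Ioi {f g : ℝ → ℝ} (hf : Continuous f) (hg : Continuous g)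
    (h : ∀ᵐ u ∂(volume.restrict (Ioi (0 : ℝ))), f u ≤ g u) {u : ℝ} (hu : 0 < u) : f u ≤ g u := by
  by_contra! hlt
  have hev : ∀ᶠ v in 𝓝 u, g v < f v :=
    hg.continuousAt.eventually_lt hf.continuousAt hlt
  rw [ae_restrict_iff' measurableSet_Ioi] at h
  have hfreq : ∃ᶠ v in 𝓝 u, v ∈ Ioi (0 : ℝ) → f v ≤ g v :=
    mem_closure_iff_frequently.1 (Measure.dense_of_ae h u)
  obtain ⟨v, hv1, hv2, hv3⟩ := (hfreq.and_eventually (hev.and (Ioi_mem_nhds hu))).exists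
  linarith [hv1 hv3]

theorem exists_abs_psiSum_sub_le (h : RiemannHypothesis) : ∃ c c₁ : ℝ, ∀ u, 0 < u →
    |psiSum u - u - c| ≤ 0.048 * Real.exp (-u / 2) + 1.84 * Real.exp (-u) ∧
    |psiSum u - u - c - c₁ * Real.exp (-u)| ≤
      0.048 * Real.exp (-u / 2) + Real.exp (-3 * u) := by
  obtain ⟨ι, _, m, γ, hm, hL⟩ := exists_hasSum_logDeriv_riemannXi h
  set B := 2 * realLambda 1 with hBdef
  have hB : HasSum (fun i ↦ 2 * m i / (1 / 4 + γ i ^ 2)) B := by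
    obtain ⟨L, h1, h2⟩ := hL (1 / 2) (by norm_num)
    have h3 : (1 / 2 + ((1 / 2 : ℝ) : ℂ)) = 1 := by norm_num
    rw [h3, logDeriv_riemannXi_one, Complex.ofReal_inj] at h2
    rw [hBdef, h2]
    refine (h1.mul_left 2).congr_fun fun i ↦ ?_
    norm_num
    ring
  set K := 1 + Real.log Real.pi / 2 + Real.eulerMascheroniConstant / 2 with hK
  have hγ0 := Real.one_half_lt_eulerMascheroniConstant
  have hlogpi : 0 ≤ Real.log Real.pi := Real.log_nonneg (by linarith [Real.pi_gt_three])
  have hK0 : 0 ≤ K := by positivity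
  set A := ∑' k : ℕ, 1 / (2 * ((k : ℝ) + 1) * (2 * (k + 1) + 1)) with hA
  set f : ℝ → ℝ := fun u ↦ psiSum u + ∑' i, zeroTerm (m i) (γ i) u + K * (1 - Real.exp (-1 * u))
    with hf
  set g : ℝ → ℝ := fun u ↦ u + ∑' k, trivialZeroTerm k u with hg
  have hpos : ∀ᵐ u ∂(volume.restrict (Ioi (0 : ℝ))), 0 < u :=
    ae_restrict_mem measurableSet_Ioi
  have key1 : ∀ δ > 0, IntegrableOn (fun u ↦ f u * Real.exp (-δ * u)) (Ioi 0) ∧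
      ∫ u in Ioi 0, f u * Real.exp (-δ * u) = 1 / δ ^ 2 + (logDeriv Real.Gamma ((1 + δ) / 2 + 1) +
        Real.eulerMascheroniConstant) * (1 / (2 * δ * (1 + δ))) := by
    intro δ hδ
    obtain ⟨i1, e1⟩ := psiSum_laplace hδ
    obtain ⟨i2, e2⟩ := hasIntegral_one_sub_exp hδ zero_le_one
    obtain ⟨L, h1, h2⟩ := hL (δ + 1 / 2) (by positivity)
    have hsum : HasSum (fun i ↦ ∫ u in Ioi 0, zeroTerm (m i) (γ i) u * Real.exp (-δ * u))
        (L * (1 / (δ * (1 + δ)))) :=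
      (h1.mul_right _).congr_fun fun i ↦ (zeroTerm_laplace (m i) (γ i) hδ).2
    obtain ⟨i3, e3⟩ := integrable_tsum_of_nonneg (fun i ↦ (zeroTerm_laplace (m i) (γ i) hδ).1)
      (Eventually.of_forall fun u i ↦
        mul_nonneg (zeroTerm_nonneg (hm i) (γ i) u) (Real.exp_pos _).le)
      (Eventually.of_forall fun u ↦ by
        obtain ⟨Q, -, hQ⟩ := hasSum_zeroTerm hm hB u
        exact hQ.summable.mul_right _) hsum.summable
    rw [hsum.tsum_eq] at e3
    simp_rw [tsum_mul_right] at i3 e3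
    have e : ∀ u, f u * Real.exp (-δ * u) = psiSum u * Real.exp (-δ * u) +
        (∑' i, zeroTerm (m i) (γ i) u) * Real.exp (-δ * u) +
        K * ((1 - Real.exp (-1 * u)) * Real.exp (-δ * u)) := fun u ↦ by
      simp only [hf]
      ring
    simp only [e]
    have i4 := i1.add i3
    have i5 := i2.const_mul K
    refine ⟨i4.add i5, ?_⟩
    have e4 := integral_add i4 i5
    simp only [Pi.add_apply] at e4
    rw [e4, integral_add i1 i3, integral_const_mul, e1, e2, e3]
    have hS := tsum_vonMangoldt_eq hδ
    have h3 : (1 / 2 + ((δ + 1 / 2 : ℝ) : ℂ)) = 1 + δ := by push_cast; ring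
    rw [h3] at h2
    rw [h2] at hS
    have hS' : ∑' n : ℕ, Λ n * (n : ℝ) ^ (-(1 + δ)) = 1 / δ - L - Real.log Real.pi / 2 +
        logDeriv Real.Gamma ((1 + δ) / 2 + 1) / 2 := by exact_mod_cast hS
    rw [hS', hK]
    field_simp
    ring
  have key2 : ∀ δ > 0, IntegrableOn (fun u ↦ g u * Real.exp (-δ * u)) (Ioi 0) ∧
      ∫ u in Ioi 0, g u * Real.exp (-δ * u) = 1 / δ ^ 2 + (logDeriv Real.Gamma ((1 + δ) / 2 + 1) +
        Real.eulerMascheroniConstant) * (1 / (2 * δ * (1 + δ))) := by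
    intro δ hδ
    obtain ⟨i1, e1⟩ := hasIntegral_mul hδ
    have hsum : HasSum (fun k ↦ ∫ u in Ioi 0, trivialZeroTerm k u * Real.exp (-δ * u))
        ((logDeriv Real.Gamma ((1 + δ) / 2 + 1) + Real.eulerMascheroniConstant) *
          (1 / (2 * δ * (1 + δ)))) :=
      ((hasSum_logDeriv_Gamma (by linarith)).mul_right _).congr_fun
        fun k ↦ (trivialZeroTerm_laplace k hδ).2
    obtain ⟨i2, e2⟩ := integrable_tsum_of_nonneg (fun k ↦ (trivialZeroTerm_laplace k hδ).1)
      (hpos.mono fun u hu k ↦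
        mul_nonneg (trivialZeroTerm_nonneg k hu.le) (Real.exp_pos _).le)
      (hpos.mono fun u hu ↦ by
        obtain ⟨T, -, -, hT⟩ := hasSum_trivialZeroTerm hu.le
        exact hT.summable.mul_right _) hsum.summable
    rw [hsum.tsum_eq] at e2
    simp_rw [tsum_mul_right] at i2 e2
    simp only [hg, add_mul _ _ (Real.exp _)]
    exact ⟨i1.add i2, by rw [integral_add i1 i2, e1, e2]⟩
  have hae : f =ᵐ[volume.restrict (Ioi 0)] g := by
    refine ae_eq_of_laplace_eq (fun u hu ↦ ?_) (fun u hu ↦ ?_) (fun δ hδ ↦ (key1 δ hδ).1)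
      (fun δ hδ ↦ (key2 δ hδ).1) fun δ hδ ↦ (key1 δ hδ).2.trans (key2 δ hδ).2.symm
    · have h1 := psiSum_nonneg u
      have h2 : 0 ≤ ∑' i, zeroTerm (m i) (γ i) u :=
        tsum_nonneg fun i ↦ zeroTerm_nonneg (hm i) (γ i) u
      have h3 : Real.exp (-1 * u) ≤ 1 := Real.exp_le_one_iff.2 (by linarith [mem_Ioi.1 hu])
      have h4 := mul_nonneg hK0 (sub_nonneg.2 h3)
      simp only [hf]
      positivity
    · have h2 : 0 ≤ ∑' k, trivialZeroTerm k u :=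
        tsum_nonneg fun k ↦ trivialZeroTerm_nonneg k (mem_Ioi.1 hu).le
      exact add_nonneg (mem_Ioi.1 hu).le h2
  have hKB : K - B / 2 = Real.log 2 + Real.log Real.pi := by
    have h4 : Real.log (4 * Real.pi) = 2 * Real.log 2 + Real.log Real.pi := by
      rw [Real.log_mul (by norm_num) Real.pi_ne_zero, show (4 : ℝ) = 2 ^ 2 by norm_num,
        Real.log_pow]
      norm_num
    rw [hK, hBdef, realLambda_one, h4]
    ring
  have hl2 := Real.log_pos one_lt_two
  have hB1 : B < 0.048 := by
    have := realLambda_one_lt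
    rw [hBdef]
    linarith
  have hlp := log_two_pi_lt
  have hbound : ∀ᵐ u ∂(volume.restrict (Ioi (0 : ℝ))), |psiSum u - u - (A - B / 2 - K)| ≤
      0.048 * Real.exp (-u / 2) + 1.84 * Real.exp (-u) ∧
      |psiSum u - u - (A - B / 2 - K) - (K - B / 2) * Real.exp (-u)| ≤
      0.048 * Real.exp (-u / 2) + Real.exp (-3 * u) := by
    filter_upwards [hae, hpos] with u hu hu0
    obtain ⟨Q, hQ, hQs⟩ := hasSum_zeroTerm hm hB u
    obtain ⟨T, hT0, hT1, hTs⟩ := hasSum_trivialZeroTerm hu0.le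
    simp only [hf, hg, hQs.tsum_eq, hTs.tsum_eq, neg_mul, one_mul, ← hA] at hu
    have e : psiSum u - u - (A - B / 2 - K) =
        -T + (K - B / 2) * Real.exp (-u) + Real.exp (-u / 2) * Q := by linear_combination hu
    have hE := Real.exp_pos (-u)
    have hE2 := Real.exp_pos (-u / 2)
    have hT2 : T ≤ Real.exp (-u) := hT1.trans (Real.exp_le_exp.2 (by linarith))
    have hQE : |Real.exp (-u / 2) * Q| ≤ 0.048 * Real.exp (-u / 2) := by
      rw [abs_mul, abs_of_pos hE2, mul_comm]
      exact mul_le_mul_of_nonneg_right (hQ.trans hB1.le) hE2.le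
    have hmain : |-T + (K - B / 2) * Real.exp (-u)| ≤ 1.84 * Real.exp (-u) := by
      rw [hKB, abs_le]
      constructor <;> nlinarith
    rw [e]
    refine ⟨(abs_add_le _ _).trans (by linarith), ?_⟩
    rw [add_right_comm, add_sub_cancel_right]
    refine (abs_add_le _ _).trans ?_
    rw [abs_neg, abs_of_nonneg hT0]
    linarith
  have hc := continuous_psiSum
  exact ⟨A - B / 2 - K, K - B / 2, fun u hu ↦
    ⟨le_of_ae_restrict_Ioi (by fun_prop) (by fun_prop) (hbound.mono fun _ h ↦ h.1) hu,
      le_of_ae_restrict_Ioi (by fun_prop) (by fun_prop) (hbound.mono fun _ h ↦ h.2) hu⟩⟩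

end

/-! ### A bound for the Mertens remainder under the Riemann hypothesis -/

section

open MeasureTheory Set Filter Topology
open scoped ArithmeticFunction.vonMangoldt

lemma continuousAt_mertensSum {u₀ : ℝ} : ContinuousAt mertensSum u₀ := by
  have h1 : ∀ u : ℝ, ∀ N, ⌊Real.exp u⌋₊ ≤ N → mertensSum u =
      ∑ n ∈ Finset.Icc 0 N, Λ n * max (1 / (n * Real.log n) * u - Real.exp (-u)) 0 := by
    intro u N hN
    have hsub := Finset.Icc_subset_Icc_right hN (a := 0)
    rw [mertensSum, ← Finset.sum_subset_zero_on_sdiff hsub (f := fun n ↦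
      Λ n * max (1 / (n * Real.log n) * u - Real.exp (-u)) 0) ?_ fun _ _ ↦ rfl]
    · refine Finset.sum_congr rfl fun n hn ↦ ?_
      rcases le_or_gt n 1 with h1 | h1
      · interval_cases n <;> simp
      have hlog : 0 < Real.log n := Real.log_pos (by exact_mod_cast h1)
      have hn0 : (0 : ℝ) < n := by positivity
      have h2 : (n : ℝ) ≤ Real.exp u :=
        (Nat.le_floor_iff (Real.exp_pos u).le).1 (Finset.mem_Icc.1 hn).2
      have h3 : Real.log n ≤ u := (Real.log_le_iff_le_exp hn0).2 h2
      have h4 := exp_neg_le_of_mem_Icc hn (by lia)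
      have h5 : 1 / (n : ℝ) ≤ 1 / (n * Real.log n) * u := by
        rw [div_mul_eq_mul_div, one_mul, div_le_div_iff₀ hn0 (by positivity)]
        nlinarith
      rw [max_eq_left (by linarith)]
    · intro n hn
      rw [Finset.mem_sdiff, Finset.mem_Icc, Finset.mem_Icc] at hn
      have hn2 : Real.exp u < n := by
        rw [← Nat.floor_lt (Real.exp_pos u).le]
        lia
      rcases le_or_gt n 1 with h1 | h1
      · interval_cases n <;> simp
      have hlog : 0 < Real.log n := Real.log_pos (by exact_mod_cast h1)
      have hn0 : (0 : ℝ) < n := by positivity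
      have h3 : u < Real.log n := (Real.lt_log_iff_exp_lt hn0).2 hn2
      have h4 : (1 : ℝ) / n ≤ Real.exp (-u) := by
        rw [Real.exp_neg, one_div]
        exact inv_anti₀ (Real.exp_pos u) hn2.le
      have h5 : 1 / (n * Real.log n) * u ≤ 1 / (n : ℝ) := by
        rw [div_mul_eq_mul_div, one_mul, div_le_div_iff₀ (by positivity) hn0]
        nlinarith
      rw [max_eq_right (by linarith), mul_zero]
  have : mertensSum =ᶠ[𝓝 u₀] fun u ↦ ∑ n ∈ Finset.Icc 0 ⌊Real.exp (u₀ + 1)⌋₊,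
      Λ n * max (1 / (n * Real.log n) * u - Real.exp (-u)) 0 := by
    filter_upwards [gt_mem_nhds (lt_add_one u₀)] with u hu
    exact h1 u _ (Nat.floor_mono (Real.exp_le_exp.2 hu.le))
  refine ContinuousAt.congr ?_ this.symm
  fun_prop

lemma continuous_mertensRemainder : Continuous mertensRemainder := by
  have h1 : Continuous mertensSum := continuous_iff_continuousAt.2 fun _ ↦ continuousAt_mertensSum
  have h2 := Real.continuous_mul_log
  unfold mertensRemainder
  fun_prop

lemma eventually_floor_exp_eq (u : ℝ) : ∀ᶠ v in 𝓝[≥] u, ⌊Real.exp v⌋₊ = ⌊Real.exp u⌋₊ := by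
  have h : ∀ᶠ v in 𝓝 u, Real.exp v < ⌊Real.exp u⌋₊ + 1 :=
    Real.continuous_exp.continuousAt.eventually (gt_mem_nhds (Nat.lt_floor_add_one _))
  filter_upwards [h.filter_mono nhdsWithin_le_nhds, self_mem_nhdsWithin] with v hv huv
  refine le_antisymm ?_ (Nat.floor_mono (Real.exp_le_exp.2 huv))
  rw [← Nat.lt_add_one_iff, Nat.floor_lt (Real.exp_pos v).le]
  exact_mod_cast hv

/-- The right derivative of `D(u) / u - (u⁻¹ + u⁻²) r(u)`, with `D` the Mertens remainder and
`r(u) = psiSum u - u - c`, is `(u⁻² + 2 u⁻³) r(u)`. -/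
lemma hasDerivWithinAt_mertensRemainder {u : ℝ} (hu : 0 < u) (c : ℝ) :
    HasDerivWithinAt (fun v ↦ mertensRemainder v / v - (1 / v + 1 / v ^ 2) * (psiSum v - v - c))
      ((1 / u ^ 2 + 2 / u ^ 3) * (psiSum u - u - c)) (Ici u) u := by
  set N := ⌊Real.exp u⌋₊ with hN
  set A := ∑ n ∈ Finset.Icc 0 N, Λ n * (1 / (n * Real.log n)) with hA
  set C := ∑ n ∈ Finset.Icc 0 N, Λ n * (1 / (n : ℝ)) with hC
  set S := ∑ n ∈ Finset.Icc 0 N, Λ n with hS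
  have h1 : ∀ v, ⌊Real.exp v⌋₊ = N → mertensSum v = A * v - S * Real.exp (-v) := by
    intro v hv
    rw [mertensSum, hv, hA, hS, Finset.sum_mul, Finset.sum_mul, ← Finset.sum_sub_distrib]
    exact Finset.sum_congr rfl fun n _ ↦ by ring
  have h2 : ∀ v, ⌊Real.exp v⌋₊ = N → psiSum v = C - S * Real.exp (-v) := by
    intro v hv
    rw [psiSum, hv, hC, hS, Finset.sum_mul, ← Finset.sum_sub_distrib]
    exact Finset.sum_congr rfl fun n _ ↦ by ring
  have hd : HasDerivAt (fun v ↦ (A * v - S * Real.exp (-v) -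
      (v * Real.log v + Real.eulerMascheroniConstant * v - 1)) / v -
      (1 / v + 1 / v ^ 2) * (C - S * Real.exp (-v) - v - c))
      ((1 / u ^ 2 + 2 / u ^ 3) * (C - S * Real.exp (-u) - u - c)) u := by
    have e1 : HasDerivAt (fun v ↦ Real.exp (-v)) (-Real.exp (-u)) u := by
      simpa using (hasDerivAt_neg u).exp
    have e2 := Real.hasDerivAt_mul_log hu.ne'
    have e3 := hasDerivAt_id' u
    have e4 := (((e3.const_mul A).sub (e1.const_mul S)).sub
      ((e2.add (e3.const_mul Real.eulerMascheroniConstant)).sub_const 1)).div e3 hu.ne'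
    have e5 := (e3.inv hu.ne').add ((e3.inv hu.ne').pow 2)
    have e6 := (((e1.const_mul S).const_sub C).sub e3).sub_const c
    have e7 := e4.sub (e5.mul e6)
    refine (e7.congr_deriv ?_).congr_of_eventuallyEq (Eventually.of_forall fun v ↦ ?_)
    · simp only [Pi.add_apply, Pi.sub_apply, Pi.pow_apply, Pi.inv_apply,
        show 2 - 1 = 1 from rfl, pow_one]
      field_simp
      ring
    · simp
  rw [h2 u rfl]
  refine hd.hasDerivWithinAt.congr_of_eventuallyEq_of_mem ?_ self_mem_Ici
  filter_upwards [eventually_floor_exp_eq u] with v hv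
  rw [mertensRemainder, h1 v hv, h2 v hv]

lemma abs_mertensRemainder_div_sub_le {c : ℝ} (hc : ∀ u, 0 < u →
    |psiSum u - u - c| ≤ 0.048 * Real.exp (-u / 2) + 1.84 * Real.exp (-u)) {u v : ℝ} (hu : 0 < u)
    (huv : u ≤ v) : |mertensRemainder v / v - mertensRemainder u / u| ≤
      2 * ((1 / u + 1 / u ^ 2) * (0.048 * Real.exp (-u / 2) + 1.84 * Real.exp (-u))) := by
  set b : ℝ → ℝ := fun v ↦ 0.048 * Real.exp (-v / 2) + 1.84 * Real.exp (-v) with hb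
  set b' : ℝ → ℝ := fun v ↦ 0.024 * Real.exp (-v / 2) + 1.84 * Real.exp (-v) with hb'
  set W : ℝ → ℝ := fun v ↦ 1 / v + 1 / v ^ 2 with hW
  set G : ℝ → ℝ := fun v ↦ mertensRemainder v / v - W v * (psiSum v - v - c) with hG
  have hb1 : ∀ x, HasDerivAt b (-b' x) x := by
    intro x
    have e1 : HasDerivAt (fun v ↦ Real.exp (-v)) (-Real.exp (-x)) x := by
      simpa using (hasDerivAt_neg x).exp
    have e2 : HasDerivAt (fun v ↦ Real.exp (-v / 2)) (Real.exp (-x / 2) * (-1 / 2)) x :=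
      ((hasDerivAt_neg x).div_const 2).exp
    exact ((e2.const_mul 0.048).add (e1.const_mul 1.84)).congr_deriv (by simp only [hb']; ring)
  have hW1 : ∀ x, 0 < x → HasDerivAt W (-(1 / x ^ 2 + 2 / x ^ 3)) x := by
    intro x hx
    have e3 := hasDerivAt_id' x
    have e5 := (e3.inv hx.ne').add ((e3.inv hx.ne').pow 2)
    refine (e5.congr_deriv ?_).congr_of_eventuallyEq (Eventually.of_forall fun v ↦ ?_)
    · simp only [Pi.inv_apply, show 2 - 1 = 1 from rfl, pow_one]
      field_simp
      ring
    · simp [hW]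
  have hpos : ∀ x ∈ Icc u v, 0 < x := fun x hx ↦ hu.trans_le hx.1
  have hkey := image_norm_le_of_norm_deriv_right_le_deriv_boundary' (a := u) (b := v)
    (f := fun x ↦ G x - G u) (f' := fun x ↦ (1 / x ^ 2 + 2 / x ^ 3) * (psiSum x - x - c))
    (B := fun x ↦ W u * b u - W x * b x)
    (B' := fun x ↦ (1 / x ^ 2 + 2 / x ^ 3) * b x + W x * b' x) ?_ ?_ (by simp) ?_ ?_ ?_
    (right_mem_Icc.2 huv)
  · have hWu : 0 < W u := by simp only [hW]; positivity
    have hWv : 0 < W v := by have := hpos v (right_mem_Icc.2 huv); simp only [hW]; positivity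
    have h1 : |W u * (psiSum u - u - c)| ≤ W u * b u := by
      rw [abs_mul, abs_of_pos hWu]
      exact mul_le_mul_of_nonneg_left (hc u hu) hWu.le
    have h2 : |W v * (psiSum v - v - c)| ≤ W v * b v := by
      rw [abs_mul, abs_of_pos hWv]
      exact mul_le_mul_of_nonneg_left (hc v (hu.trans_le huv)) hWv.le
    rw [Real.norm_eq_abs] at hkey
    simp only [hG] at hkey
    rw [abs_le] at h1 h2 hkey ⊢
    change _ ≤ _ ∧ _ ≤ 2 * (W u * b u)
    constructor <;> [change -(2 * (W u * b u)) ≤ _; skip] <;> linarith [hkey.1, hkey.2]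
  · have h1 := continuous_mertensRemainder
    have h2 := continuous_psiSum
    have hWc : ContinuousOn W (Icc u v) := fun x hx ↦
      (hW1 x (hpos x hx)).continuousAt.continuousWithinAt
    refine ContinuousOn.sub (ContinuousOn.sub ?_ (hWc.mul (by fun_prop))) continuousOn_const
    exact h1.continuousOn.div continuousOn_id fun x hx ↦ (hpos x hx).ne'
  · intro x hx
    exact (hasDerivWithinAt_mertensRemainder (hpos x (Ico_subset_Icc_self hx)) c).sub_const _
  · exact fun x hx ↦ (continuousAt_const.sub ((hW1 x (hpos x hx)).continuousAt.mul
      (hb1 x).continuousAt)).continuousWithinAt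
  · intro x hx
    refine HasDerivAt.hasDerivWithinAt ?_
    exact (((hW1 x (hpos x (Ico_subset_Icc_self hx))).mul (hb1 x)).const_sub _).congr_deriv
      (by ring)
  · intro x hx
    have hx0 := hpos x (Ico_subset_Icc_self hx)
    rw [norm_mul, Real.norm_of_nonneg (by positivity), Real.norm_eq_abs]
    have h1 := mul_le_mul_of_nonneg_left (hc x hx0) (by positivity : 0 ≤ 1 / x ^ 2 + 2 / x ^ 3)
    change _ ≤ _ * b x at h1
    have h2 : 0 ≤ W x * b' x := by simp only [hW, hb']; positivity
    linarith

/-- A bound for `psiSum u - u` up to a constant implies a bound for the Mertens remainder. -/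
theorem mertensRemainder_div_le {c : ℝ} (hc : ∀ u, 0 < u →
    |psiSum u - u - c| ≤ 0.048 * Real.exp (-u / 2) + 1.84 * Real.exp (-u)) {u : ℝ} (hu : 0 < u) :
    mertensRemainder u / u ≤
      2 * ((1 / u + 1 / u ^ 2) * (0.048 * Real.exp (-u / 2) + 1.84 * Real.exp (-u))) := by
  by_contra! hcon
  obtain ⟨η, hη, hlow⟩ : ∃ η > 0, ∀ v, u ≤ v → η * v ≤ mertensRemainder v := by
    refine ⟨_, sub_pos.2 hcon, fun v huv ↦ ?_⟩
    rw [← le_div_iff₀ (hu.trans_le huv)]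
    have := (abs_le.1 (abs_mertensRemainder_div_sub_le hc hu huv)).1
    linarith
  obtain ⟨K, hK⟩ : ∃ K, ∀ v, 0 ≤ v → η * v - K ≤ mertensRemainder v := by
    obtain ⟨K, hK⟩ := (isCompact_Icc (a := 0) (b := u)).exists_bound_of_continuousOn
      continuous_mertensRemainder.continuousOn
    refine ⟨max 0 (η * u + K), fun v hv ↦ ?_⟩
    rcases le_total u v with h | h
    · linarith [hlow v h, le_max_left 0 (η * u + K)]
    · have := neg_le_of_abs_le (hK v ⟨hv, h⟩)
      have := mul_le_mul_of_nonneg_left h hη.le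
      linarith [le_max_right 0 (η * u + K)]
  have hlap : ∀ δ : ℝ, 0 < δ → η - K * δ ≤ (δ ^ 2 * (1 / (1 + δ) : ℂ) + Complex.log (mulZeta δ) -
      δ * logDeriv mulZeta δ / (1 + δ)).re := by
    intro δ hδ
    obtain ⟨i1, e1⟩ := mertensRemainder_laplace hδ
    obtain ⟨i2, e2⟩ := hasIntegral_mul hδ
    obtain ⟨i3, e3⟩ := hasIntegral_exp hδ
    have hle : η * (1 / δ ^ 2) - K * (1 / δ) ≤
        ∫ u in Ioi 0, mertensRemainder u * Real.exp (-δ * u) := by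
      rw [← e2, ← e3, ← integral_const_mul, ← integral_const_mul,
        ← integral_sub (i2.const_mul η) (i3.const_mul K)]
      refine setIntegral_mono_on ((i2.const_mul η).sub (i3.const_mul K)) i1 measurableSet_Ioi
        fun v hv ↦ ?_
      have := mul_le_mul_of_nonneg_right (hK v (mem_Ioi.1 hv).le) (Real.exp_pos (-δ * v)).le
      linarith
    have e4 : (δ ^ 2 * (1 / (1 + δ) : ℂ) + Complex.log (mulZeta δ) -
        δ * logDeriv mulZeta δ / (1 + δ)) =
        ((δ ^ 2 * ∫ u in Ioi 0, mertensRemainder u * Real.exp (-δ * u) : ℝ) : ℂ) := by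
      have h0 : (δ : ℂ) ≠ 0 := by exact_mod_cast hδ.ne'
      have h1 : (1 + δ : ℂ) ≠ 0 := by
        have : (1 + δ : ℝ) ≠ 0 := by positivity
        exact_mod_cast this
      rw [Complex.ofReal_mul, e1]
      push_cast
      field_simp
    rw [e4, Complex.ofReal_re]
    calc η - K * δ = δ ^ 2 * (η * (1 / δ ^ 2) - K * (1 / δ)) := by field_simp
      _ ≤ _ := by gcongr
  have hcont : ContinuousAt (fun δ : ℝ ↦ (δ ^ 2 * (1 / (1 + δ) : ℂ) + Complex.log (mulZeta δ) -
      δ * logDeriv mulZeta δ / (1 + δ)).re) 0 := by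
    have hm : ContinuousAt (fun δ : ℝ ↦ mulZeta δ) 0 :=
      (differentiable_mulZeta.continuous.comp Complex.continuous_ofReal).continuousAt
    have hd : ContinuousAt (fun δ : ℝ ↦ deriv mulZeta δ) 0 :=
      ((differentiable_mulZeta.contDiff (n := 1)).continuous_deriv_one.comp
        Complex.continuous_ofReal).continuousAt
    have hl : ContinuousAt (fun δ : ℝ ↦ Complex.log (mulZeta δ)) 0 := by
      refine hm.clog ?_
      simp [mulZeta_zero]
    have h1 : ContinuousAt (fun δ : ℝ ↦ (δ : ℂ)) 0 := Complex.continuous_ofReal.continuousAt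
    have h10 : (1 : ℂ) + (0 : ℝ) ≠ 0 := by simp
    refine Complex.continuous_re.continuousAt.comp ?_
    refine ContinuousAt.sub (ContinuousAt.add ((h1.pow 2).mul
      (continuousAt_const.div (continuousAt_const.add h1) h10)) hl) ?_
    refine (h1.mul ?_).div (continuousAt_const.add h1) h10
    simp only [logDeriv]
    exact hd.div hm (by simp [mulZeta_zero])
  have hlim : Tendsto (fun δ : ℝ ↦ η - K * δ) (𝓝[>] 0) (𝓝 (η - K * 0)) :=
    (Continuous.tendsto (by fun_prop) 0).mono_left nhdsWithin_le_nhds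
  have := le_of_tendsto_of_tendsto hlim (hcont.tendsto.mono_left nhdsWithin_le_nhds)
    (by filter_upwards [self_mem_nhdsWithin] with δ hδ using hlap δ hδ)
  simp [mulZeta_zero] at this
  linarith

end

/-! ### The contributions of prime powers -/

section

open Finset
open scoped ArithmeticFunction.vonMangoldt ArithmeticFunction.sigma

/-- The contribution `log (σ(p ^ a) / p ^ a)` of a prime power to `log (σ(n) / n)`. -/
noncomputable def logSigmaPow (p a : ℕ) : ℝ :=
  Real.log (1 - (p : ℝ)⁻¹ ^ (a + 1)) - Real.log (1 - (p : ℝ)⁻¹)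

lemma log_sigma_div_eq_sum {n N : ℕ} (hn : n ≠ 0) (hN : n ≤ N) :
    Real.log (ArithmeticFunction.sigma 1 n / n)
      = ∑ p ∈ Nat.primesLE N, logSigmaPow p (n.factorization p) := by
  rw [log_sigma_div hn]
  refine sum_subset (fun p hp ↦ ?_) fun p _ hp' ↦ ?_
  · rw [Nat.mem_primesLE]
    exact ⟨(Nat.le_of_mem_primeFactors hp).trans hN, Nat.prime_of_mem_primeFactors hp⟩
  · rw [← Nat.support_factorization, Finsupp.notMem_support_iff] at hp'
    simp [hp']

lemma log_eq_sum_factorization {n N : ℕ} (hn : n ≠ 0) (hN : n ≤ N) :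
    Real.log n = ∑ p ∈ Nat.primesLE N, n.factorization p * Real.log p := by
  have h1 : (n : ℝ) = ∏ p ∈ n.primeFactors, (p : ℝ) ^ n.factorization p := by
    have := Nat.prod_factorization_pow_eq_self hn
    rw [Finsupp.prod, Nat.support_factorization] at this
    conv_lhs => rw [← this]
    push_cast
    rfl
  conv_lhs => rw [h1]
  rw [Real.log_prod fun p hp ↦ by
    have := (Nat.prime_of_mem_primeFactors hp).pos
    positivity]
  simp_rw [Real.log_pow]
  refine sum_subset (fun p hp ↦ ?_) fun p _ hp' ↦ ?_
  · rw [Nat.mem_primesLE]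
    exact ⟨(Nat.le_of_mem_primeFactors hp).trans hN, Nat.prime_of_mem_primeFactors hp⟩
  · rw [← Nat.support_factorization, Finsupp.notMem_support_iff] at hp'
    simp [hp']

lemma neg_log_one_sub_le {p : ℕ} (hp : p.Prime) (b : ℕ) :
    -Real.log (1 - (p : ℝ)⁻¹) ≤ ∑ k ∈ Icc 1 b, (p : ℝ)⁻¹ ^ k / k
      + (p : ℝ)⁻¹ ^ (b + 1) / ((b + 1) * (1 - (p : ℝ)⁻¹)) := by
  obtain ⟨h1, h2⟩ := hp.inv_mem
  set v := (p : ℝ)⁻¹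
  have h := Real.hasSum_pow_div_log_of_abs_lt_one (x := v) (by rw [abs_of_pos h1]; linarith)
  have h3 := (hasSum_nat_add_iff' b).2 h
  have h4 : HasSum (fun i : ℕ ↦ v ^ (b + 1) / (b + 1) * v ^ i)
      (v ^ (b + 1) / (b + 1) * (1 - v)⁻¹) :=
    (hasSum_geometric_of_lt_one h1.le (by linarith)).mul_left _
  have h5 := hasSum_le (fun i ↦ ?_) h3 h4
  · have h6 : ∑ k ∈ Icc 1 b, v ^ k / (k : ℝ) = ∑ i ∈ range b, v ^ (i + 1) / ((i : ℝ) + 1) := by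
      have h4 := sum_Ico_add' (fun k : ℕ ↦ v ^ k / (k : ℝ)) 0 b 1
      push_cast at h4
      rw [range_eq_Ico, h4]
      rfl
    have h7 : v ^ (b + 1) / (b + 1) * (1 - v)⁻¹ = v ^ (b + 1) / ((b + 1) * (1 - v)) := by
      rw [div_mul_eq_div_div, div_eq_mul_inv _ (1 - v)]
    rw [h6]
    linarith
  · rw [div_mul_eq_mul_div, ← pow_add]
    push_cast
    rw [show i + b + 1 = b + 1 + i by ring]
    gcongr
    linarith [(Nat.cast_nonneg i : (0 : ℝ) ≤ i)]

lemma logSigmaPow_le_neg_log {p : ℕ} (hp : p.Prime) (a : ℕ) :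
    logSigmaPow p a ≤ -Real.log (1 - (p : ℝ)⁻¹) := by
  obtain ⟨h1, h2⟩ := hp.inv_pow_mem a
  have := Real.log_nonpos (x := 1 - (p : ℝ)⁻¹ ^ (a + 1)) (by linarith) (by linarith)
  rw [logSigmaPow]
  linarith

lemma logSigmaPow_zero (p : ℕ) : logSigmaPow p 0 = 0 := by simp [logSigmaPow]

lemma logSigmaPow_le_sum {p : ℕ} (hp : p.Prime) (a : ℕ) :
    logSigmaPow p a ≤ ∑ k ∈ Icc 1 a, (p : ℝ)⁻¹ ^ k / k := by
  rcases Nat.eq_zero_or_pos a with rfl | ha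
  · simp [logSigmaPow_zero]
  have h := neg_log_one_sub_le hp a
  obtain ⟨h1, h2⟩ := hp.inv_pow_mem a
  obtain ⟨h3, h4⟩ := hp.inv_mem
  have h5 := Real.log_le_sub_one_of_pos (x := 1 - (p : ℝ)⁻¹ ^ (a + 1)) (by linarith)
  have h6 : (p : ℝ)⁻¹ ^ (a + 1) / ((a + 1) * (1 - (p : ℝ)⁻¹)) ≤ (p : ℝ)⁻¹ ^ (a + 1) := by
    refine div_le_self h1.le ?_
    have : (1 : ℝ) ≤ a := by exact_mod_cast ha
    nlinarith
  rw [logSigmaPow]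
  linarith

lemma logSigmaPow_one {p : ℕ} (hp : p.Prime) : logSigmaPow p 1 = Real.log (1 + (p : ℝ)⁻¹) := by
  obtain ⟨h1, h2⟩ := hp.inv_mem
  obtain ⟨h3, h4⟩ := hp.inv_pow_mem 1
  rw [logSigmaPow, ← Real.log_div (by linarith) (by linarith)]
  congr 1
  rw [div_eq_iff (by linarith)]
  ring

/-- The excess of `log (σ(p ^ a) / p ^ a)` over the corresponding part of
`Σ_{n ≤ exp u} Λ(n) / (n log n)`, corrected by a multiple of `log p`. -/
noncomputable def robinExcess (u : ℝ) (p a : ℕ) : ℝ :=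
  logSigmaPow p a - ∑ k ∈ Icc 1 (Nat.log p ⌊Real.exp u⌋₊), (p : ℝ)⁻¹ ^ k / k
    + (Real.exp u * u)⁻¹ * ((Nat.log p ⌊Real.exp u⌋₊ : ℝ) - a) * Real.log p

section

variable {u : ℝ} {p a : ℕ}

lemma inv_mul_log_le_inv_pow_div (hp : p.Prime) {k : ℕ} (hk : k ≠ 0)
    (hkb : k ≤ Nat.log p ⌊Real.exp u⌋₊) :
    (Real.exp u * u)⁻¹ * Real.log p ≤ (p : ℝ)⁻¹ ^ k / k := by
  have hx := Real.exp_pos u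
  have hfl : ⌊Real.exp u⌋₊ ≠ 0 := by
    rintro h
    simp [h] at hkb
    exact hk hkb
  have h1 : ((p ^ k : ℕ) : ℝ) ≤ Real.exp u :=
    (Nat.le_floor_iff hx.le).1 (Nat.pow_le_of_le_log hfl hkb)
  push_cast at h1
  have hp0 : (0 : ℝ) < p := by exact_mod_cast hp.pos
  have hlp : 0 < Real.log p := Real.log_pos (by exact_mod_cast hp.one_lt)
  have hk0 : (0 : ℝ) < k := by positivity
  have h2 : k * Real.log p ≤ u := by
    rw [← Real.log_pow]
    exact (Real.log_le_iff_le_exp (by positivity)).2 h1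
  have hu : 0 < u := lt_of_lt_of_le (by positivity) h2
  rw [inv_pow, inv_mul_eq_div, ← one_div, div_div, div_le_div_iff₀ (by positivity) (by positivity)]
  have := mul_le_mul h1 h2 (by positivity) hx.le
  linarith

lemma inv_pow_div_le_inv_mul_log (hu : 0 < u) (hp : p.Prime) {k : ℕ}
    (hkb : Nat.log p ⌊Real.exp u⌋₊ < k) :
    (p : ℝ)⁻¹ ^ k / k ≤ (Real.exp u * u)⁻¹ * Real.log p := by
  have hx := Real.exp_pos u
  have h1 : Real.exp u < ((p ^ k : ℕ) : ℝ) :=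
    (Nat.floor_lt hx.le).1 (Nat.lt_pow_of_log_lt hp.one_lt hkb)
  push_cast at h1
  have hp0 : (0 : ℝ) < p := by exact_mod_cast hp.pos
  have hk0 : (0 : ℝ) < k := by exact_mod_cast (Nat.zero_le _).trans_lt hkb
  have h2 : u < k * Real.log p := by
    rw [← Real.log_pow]
    exact (Real.lt_log_iff_exp_lt (by positivity)).2 h1
  rw [inv_pow, inv_mul_eq_div, ← one_div, div_div, div_le_div_iff₀ (by positivity) (by positivity)]
  have := mul_le_mul h1.le h2.le hu.le (by positivity)
  linarith

lemma robinExcess_nonpos_of_le (hp : p.Prime) (ha : a ≤ Nat.log p ⌊Real.exp u⌋₊) :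
    robinExcess u p a ≤ 0 := by
  set b := Nat.log p ⌊Real.exp u⌋₊ with hb
  have h1 := logSigmaPow_le_sum hp a
  have h2 : (b - a) * ((Real.exp u * u)⁻¹ * Real.log p) ≤
      ∑ k ∈ Ioc a b, (p : ℝ)⁻¹ ^ k / k := by
    have := card_nsmul_le_sum (Ioc a b) (fun k : ℕ ↦ (p : ℝ)⁻¹ ^ k / k) _ fun k hk ↦
      inv_mul_log_le_inv_pow_div (u := u) hp (by have := (mem_Ioc.1 hk).1; lia) (mem_Ioc.1 hk).2
    rwa [Nat.card_Ioc, nsmul_eq_mul, Nat.cast_sub ha] at this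
  have h3 : ∑ k ∈ Icc 1 b, (p : ℝ)⁻¹ ^ k / k
      = ∑ k ∈ Icc 1 a, (p : ℝ)⁻¹ ^ k / k + ∑ k ∈ Ioc a b, (p : ℝ)⁻¹ ^ k / k :=
    (sum_Ioc_consecutive (fun k : ℕ ↦ (p : ℝ)⁻¹ ^ k / k) (Nat.zero_le a) ha).symm
  rw [robinExcess, ← hb, h3]
  linarith

lemma robinExcess_le_of_lt (hu : 0 < u) (hp : p.Prime) (ha : Nat.log p ⌊Real.exp u⌋₊ < a) :
    robinExcess u p a ≤ (Real.exp u * u)⁻¹ * (Real.log p / (p - 1)) := by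
  set b := Nat.log p ⌊Real.exp u⌋₊ with hb
  have h1 := logSigmaPow_le_neg_log hp a
  have h2 := neg_log_one_sub_le hp b
  have h3 := inv_pow_div_le_inv_mul_log hu hp (hb ▸ b.lt_succ_self)
  push_cast at h3
  obtain ⟨h4, h5⟩ := hp.inv_mem
  have hp1 : (1 : ℝ) < p := by exact_mod_cast hp.one_lt
  have hlp : 0 < Real.log p := Real.log_pos hp1
  have hε : 0 < (Real.exp u * u)⁻¹ := by positivity
  have h6 : (p : ℝ)⁻¹ ^ (b + 1) / ((b + 1) * (1 - (p : ℝ)⁻¹))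
      ≤ (Real.exp u * u)⁻¹ * Real.log p * (p / (p - 1)) := by
    rw [← div_div]
    have : (p : ℝ) / (p - 1) = (1 - (p : ℝ)⁻¹)⁻¹ := by
      have : (p : ℝ) - 1 ≠ 0 := by linarith
      field_simp
    rw [this, ← div_eq_mul_inv]
    gcongr
    linarith
  have h7 : ((b : ℝ) - a) * ((Real.exp u * u)⁻¹ * Real.log p) ≤
      -1 * ((Real.exp u * u)⁻¹ * Real.log p) := by
    gcongr
    have : (b : ℝ) + 1 ≤ a := by exact_mod_cast ha
    linarith
  have h8 : (Real.exp u * u)⁻¹ * (Real.log p / (p - 1)) =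
      (Real.exp u * u)⁻¹ * Real.log p * (p / (p - 1)) - (Real.exp u * u)⁻¹ * Real.log p := by
    have : (p : ℝ) - 1 ≠ 0 := by linarith
    field_simp
    ring
  rw [robinExcess, ← hb]
  linarith

lemma log_floor_exp_eq_zero (hpx : Real.exp u < p) : Nat.log p ⌊Real.exp u⌋₊ = 0 :=
  Nat.log_of_lt ((Nat.floor_lt (Real.exp_pos u).le).2 hpx)

lemma robinExcess_nonpos_of_exp_lt (hu : 0 < u) (hp : p.Prime) (hpx : Real.exp u < p) :
    robinExcess u p a ≤ 0 := by
  have hb := log_floor_exp_eq_zero hpx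
  have h1 := inv_pow_div_le_inv_mul_log (k := 1) hu hp (by lia)
  simp only [pow_one, Nat.cast_one, div_one] at h1
  obtain ⟨h4, h5⟩ := hp.inv_mem
  have h2 : logSigmaPow p a ≤ a * (p : ℝ)⁻¹ := by
    rcases a with _ | _ | a
    · simp [logSigmaPow_zero]
    · simpa using logSigmaPow_le_sum hp 1
    · have h6 := neg_log_one_sub_le hp 0
      have h7 : (p : ℝ)⁻¹ ^ (0 + 1) / ((((0 : ℕ) : ℝ) + 1) * (1 - (p : ℝ)⁻¹)) ≤ 2 * (p : ℝ)⁻¹ := by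
        rw [div_le_iff₀ (by push_cast; linarith)]
        push_cast
        nlinarith
      have h8 := logSigmaPow_le_neg_log hp (a + 1 + 1)
      simp only [zero_lt_one, Icc_eq_empty_of_lt, sum_empty] at h6
      push_cast
      nlinarith [(Nat.cast_nonneg a : (0 : ℝ) ≤ a)]
  have h3 : (a : ℝ) * (p : ℝ)⁻¹ ≤ a * ((Real.exp u * u)⁻¹ * Real.log p) := by gcongr
  rw [robinExcess, hb]
  simp only [zero_lt_one, Icc_eq_empty_of_lt, sum_empty, Nat.cast_zero]
  linarith

lemma log_floor_exp_eq_one (hpx : (p : ℝ) ≤ Real.exp u)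
    (hpx2 : Real.exp u < (p : ℝ) ^ 2) : Nat.log p ⌊Real.exp u⌋₊ = 1 := by
  rw [Nat.log_eq_iff (Or.inl one_ne_zero), pow_one]
  refine ⟨Nat.le_floor hpx, (Nat.floor_lt (Real.exp_pos u).le).2 ?_⟩
  push_cast
  exact hpx2

variable (hu : 0 < u) (hp : p.Prime) (hp1 : 101 ≤ p) (hpx : (p : ℝ) ≤ Real.exp u)
  (hpx2 : 1.01 * Real.exp u < (p : ℝ) ^ 2)
include hu hp hp1 hpx hpx2

lemma robinExcess_le_of_one_lt (ha : 1 < a) :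
    Real.exp u * robinExcess u p a ≤ -(0.5 - 0.5 * (1.01 * Real.exp u / p ^ 2)) := by
  have hx := Real.exp_pos u
  have hb := log_floor_exp_eq_one hpx (by linarith)
  have h1 := logSigmaPow_le_neg_log hp a
  have h2 := neg_log_one_sub_le hp 1
  have hp0 : (0 : ℝ) < p := by exact_mod_cast hp.pos
  have hp101 : (101 : ℝ) ≤ p := by exact_mod_cast hp1
  have hlp : 0 < Real.log p := Real.log_pos (by linarith)
  have h3 : u ≤ 2 * Real.log p := by
    have h := (Real.lt_log_iff_exp_lt (y := (p : ℝ) ^ 2) (x := u) (by positivity)).2 (by linarith)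
    rw [Real.log_pow] at h
    exact_mod_cast h.le
  have h4 : 0.5 ≤ Real.exp u * ((Real.exp u * u)⁻¹ * Real.log p) := by
    rw [show Real.exp u * ((Real.exp u * u)⁻¹ * Real.log p) = Real.log p / u by field_simp,
      le_div_iff₀ hu]
    linarith
  have h5 : ((1 : ℝ) - a) * (Real.exp u * ((Real.exp u * u)⁻¹ * Real.log p)) ≤
      -1 * (Real.exp u * ((Real.exp u * u)⁻¹ * Real.log p)) := by
    refine mul_le_mul_of_nonneg_right ?_ (by linarith)
    have : (1 : ℝ) + 1 ≤ a := by exact_mod_cast ha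
    linarith
  have h6 : (p : ℝ)⁻¹ ^ (1 + 1) / ((((1 : ℕ) : ℝ) + 1) * (1 - (p : ℝ)⁻¹)) ≤
      0.5 * (1.01 / p ^ 2) := by
    have : (p : ℝ)⁻¹ ≤ 1 / 101 := by
      rw [one_div]
      gcongr
    rw [inv_pow, ← one_div, div_div, mul_div_assoc', div_le_div_iff₀
      (mul_pos (by positivity) (mul_pos (by push_cast; norm_num) (by linarith))) (by positivity)]
    push_cast
    have : 0 < (p : ℝ) ^ 2 := by positivity
    nlinarith
  have h7 := mul_le_mul_of_nonneg_left h6 hx.le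
  rw [robinExcess, hb]
  have h8 : Real.exp u * (0.5 * (1.01 / p ^ 2)) = 0.5 * (1.01 * Real.exp u / p ^ 2) := by ring
  rw [h8] at h7
  push_cast
  have h9 := mul_le_mul_of_nonneg_left (h1.trans h2) hx.le
  linarith

lemma robinExcess_le_of_le_one (hpx' : 2 * (p : ℝ) ≤ Real.exp u) (ha : a ≤ 1) :
    Real.exp u * robinExcess u p a ≤ -(0.49 * (1.01 * Real.exp u / p ^ 2)) := by
  have hx := Real.exp_pos u
  have hb := log_floor_exp_eq_one hpx (by linarith)
  have hp0 : (0 : ℝ) < p := by exact_mod_cast hp.pos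
  have hp101 : (101 : ℝ) ≤ p := by exact_mod_cast hp1
  rw [robinExcess, hb]
  simp only [Icc_self, sum_singleton, pow_one, Nat.cast_one, div_one]
  interval_cases a
  · have h1 : Real.exp u * ((Real.exp u * u)⁻¹ * Real.log p) ≤ 1 / 2 * Real.exp u * (p : ℝ)⁻¹ := by
      rw [show Real.exp u * ((Real.exp u * u)⁻¹ * Real.log p) = Real.log p / u by field_simp,
        div_le_iff₀ hu]
      have h3 : Real.log p ≤ u := (Real.log_le_iff_le_exp hp0).2 hpx
      have h4 : 1 ≤ 1 / 2 * Real.exp u * (p : ℝ)⁻¹ := by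
        rw [← div_eq_mul_inv, le_div_iff₀ hp0]
        linarith
      nlinarith
    have h2 : 0.49 * (1.01 * Real.exp u / p ^ 2) ≤ 1 / 2 * Real.exp u * (p : ℝ)⁻¹ := by
      rw [← div_eq_mul_inv, mul_div_assoc', div_le_div_iff₀ (by positivity) hp0]
      have : 0 < Real.exp u * p := by positivity
      nlinarith
    rw [logSigmaPow_zero]
    push_cast
    linarith
  · rw [logSigmaPow_one hp]
    have h1 := log_one_add_le_half (x := (p : ℝ)⁻¹) (by positivity)
    have h2 : ((p : ℝ)⁻¹ + (p : ℝ)⁻¹ / (1 + (p : ℝ)⁻¹)) / 2 - (p : ℝ)⁻¹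
        ≤ -(0.49 * (1.01 / p ^ 2)) := by
      have : ((p : ℝ)⁻¹ + (p : ℝ)⁻¹ / (1 + (p : ℝ)⁻¹)) / 2 - (p : ℝ)⁻¹ =
          -(1 / (2 * p * (p + 1))) := by
        field_simp
        ring
      rw [this, neg_le_neg_iff, mul_div_assoc', div_le_div_iff₀ (by positivity) (by positivity)]
      nlinarith
    have h3 := mul_le_mul_of_nonneg_left h2 hx.le
    have h4 := mul_le_mul_of_nonneg_left h1 hx.le
    have h5 : Real.exp u * (0.49 * (1.01 / (p : ℝ) ^ 2)) =
        0.49 * (1.01 * Real.exp u / p ^ 2) := by ring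
    push_cast
    linarith

end

end

/-! ### Estimates for large primes -/

section

open Finset
open scoped ArithmeticFunction.vonMangoldt ArithmeticFunction.sigma

lemma logZetaSum_eq_of_le {M N : ℕ} (hMN : M ≤ N) :
    logZetaSum M = ∑ p ∈ Nat.primesLE N, ∑ k ∈ Icc 1 (Nat.log p M), (p : ℝ)⁻¹ ^ k / k := by
  rw [logZetaSum_eq]
  refine sum_subset (fun p hp ↦ ?_) fun p hp hp' ↦ ?_
  · rw [Nat.mem_primesLE] at hp ⊢
    exact ⟨hp.1.trans hMN, hp.2⟩
  · rw [Nat.mem_primesLE] at hp hp'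
    have : Nat.log p M = 0 := Nat.log_of_lt (by by_contra! h; exact hp' ⟨h, hp.2⟩)
    simp [this]

lemma psi_eq_sum_log_mul {x : ℝ} {N : ℕ} (hN : ⌊x⌋₊ ≤ N) :
    Chebyshev.psi x = ∑ p ∈ Nat.primesLE N, Nat.log p ⌊x⌋₊ * Real.log p := by
  have h := sum_vonMangoldt_mul (fun _ ↦ 1) ⌊x⌋₊
  simp only [mul_one, sum_const, Nat.card_Icc, add_tsub_cancel_right, nsmul_eq_mul] at h
  rw [Chebyshev.psi_eq_sum_Icc, h]
  refine sum_subset (fun p hp ↦ ?_) fun p hp hp' ↦ ?_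
  · rw [Nat.mem_primesLE] at hp ⊢
    exact ⟨hp.1.trans hN, hp.2⟩
  · rw [Nat.mem_primesLE] at hp hp'
    have : Nat.log p ⌊x⌋₊ = 0 := Nat.log_of_lt (by by_contra! h; exact hp' ⟨h, hp.2⟩)
    simp [this]

lemma log_sigma_div_eq_add_sum_robinExcess {n N : ℕ} {u : ℝ} (hu : 0 < u)
    (hnu : Real.log n = Real.exp u) (hN : n ≤ N) (hN' : ⌊Real.exp u⌋₊ ≤ N) :
    Real.log (ArithmeticFunction.sigma 1 n / n) = Real.log u + Real.eulerMascheroniConstant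
      + mertensRemainder u / u + ∑ p ∈ Nat.primesLE N, robinExcess u p (n.factorization p) := by
  have hn : n ≠ 0 := by
    rintro rfl
    simp at hnu
    exact (Real.exp_pos u).ne hnu
  have h1 := log_sigma_div_eq_sum hn hN
  have h2 := log_eq_sum_factorization hn hN
  have h3 := logZetaSum_eq_of_le hN'
  have h4 := psi_eq_sum_log_mul hN'
  have hx := (Real.exp_pos u).ne'
  have h5 : mertensRemainder u / u = logZetaSum ⌊Real.exp u⌋₊ - Real.log u
      - Real.eulerMascheroniConstant
      - (Real.exp u * u)⁻¹ * (Chebyshev.psi (Real.exp u) - Real.log n) := by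
    rw [mertensRemainder_eq, hnu]
    field_simp
  rw [h5, h4, h2, h3, h1]
  simp only [robinExcess, sum_add_distrib, sum_sub_distrib, ← mul_sum, mul_assoc, sub_mul]
  ring

/-- A piecewise linear function supported on `[1 / 5, 1]`. -/
noncomputable def tent (w : ℝ) : ℝ :=
  0.39 * max (w - 1 / 5) 0 - 1.248 * max (w - 3 / 4) 0 + 0.858 * max (w - 1) 0

lemma tent_of_one_le {w : ℝ} (hw : 1 ≤ w) : tent w = 0 := by
  rw [tent, max_eq_left (by linarith), max_eq_left (by linarith), max_eq_left (by linarith)]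
  ring

lemma tent_of_le {w : ℝ} (hw : w ≤ 1 / 5) : tent w = 0 := by
  rw [tent, max_eq_right (by linarith), max_eq_right (by linarith), max_eq_right (by linarith)]
  ring

lemma tent_nonneg (w : ℝ) : 0 ≤ tent w := by
  rw [tent]
  rcases max_cases (w - 1 / 5) 0 with h1 | h1 <;> rcases max_cases (w - 3 / 4) 0 with h2 | h2 <;>
    rcases max_cases (w - 1) 0 with h3 | h3 <;> rw [h1.1, h2.1, h3.1] <;> linarith

lemma tent_le (w : ℝ) : tent w ≤ 0.49 * w ^ 2 := by
  rw [tent]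
  rcases max_cases (w - 1 / 5) 0 with h1 | h1 <;> rcases max_cases (w - 3 / 4) 0 with h2 | h2 <;>
    rcases max_cases (w - 1) 0 with h3 | h3 <;> rw [h1.1, h2.1, h3.1] <;>
    nlinarith [sq_nonneg (w - 0.398), sq_nonneg w]

lemma tent_le_of_le_one {w : ℝ} (hw0 : 0 ≤ w) (hw : w ≤ 1) : tent w ≤ 0.5 - 0.5 * w ^ 2 := by
  rw [tent, max_eq_right (a := w - 1) (by linarith)]
  rcases max_cases (w - 1 / 5) 0 with h1 | h1 <;> rcases max_cases (w - 3 / 4) 0 with h2 | h2 <;>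
    rw [h1.1, h2.1] <;> nlinarith

section

variable {u y : ℝ} (hu : 0 < u) (hy : y ^ 2 = 1.01 * Real.exp u) (hy0 : 101 ≤ y)
include hu hy hy0

lemma exp_mul_robinExcess_le {p a : ℕ} (hp : p.Prime) :
    Real.exp u * robinExcess u p a ≤
      (if (p : ℝ) ≤ y then Real.log p / (p - 1) else 0) / u - tent (y / p) := by
  have hx := Real.exp_pos u
  have hp0 : (0 : ℝ) < p := by exact_mod_cast hp.pos
  have hp1 : (1 : ℝ) < p := by exact_mod_cast hp.one_lt
  split_ifs with hpy
  · rw [tent_of_one_le ((one_le_div hp0).2 hpy), sub_zero]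
    have hlp : 0 < Real.log p := Real.log_pos hp1
    have hnn : 0 ≤ Real.log p / (p - 1) := div_nonneg hlp.le (by linarith)
    rcases le_or_gt a (Nat.log p ⌊Real.exp u⌋₊) with h | h
    · have := robinExcess_nonpos_of_le hp h
      have h2 : 0 ≤ Real.log p / (p - 1) / u := by positivity
      nlinarith
    · have := mul_le_mul_of_nonneg_left (robinExcess_le_of_lt hu hp h) hx.le
      refine this.trans_eq ?_
      field_simp
  push Not at hpy
  rw [zero_div, zero_sub]
  have hyx : y ≤ Real.exp u := by nlinarith
  have hp101 : 101 ≤ p := by exact_mod_cast (hy0.trans hpy.le)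
  have hw : (y / p) ^ 2 = 1.01 * Real.exp u / p ^ 2 := by rw [div_pow, hy]
  have hpx2 : 1.01 * Real.exp u < (p : ℝ) ^ 2 := by rw [← hy]; gcongr
  have hw1 : y / p ≤ 1 := (div_le_one hp0).2 hpy.le
  rcases lt_or_ge (Real.exp u) p with hpx | hpx
  · have := robinExcess_nonpos_of_exp_lt (a := a) hu hp hpx
    rw [tent_of_le]
    · nlinarith
    · rw [div_le_iff₀ hp0]
      nlinarith
  rcases lt_or_ge 1 a with ha | ha
  · have h1 := robinExcess_le_of_one_lt hu hp hp101 hpx hpx2 ha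
    have h2 := tent_le_of_le_one (by positivity) hw1
    rw [hw] at h2
    linarith
  rcases le_or_gt (2 * (p : ℝ)) (Real.exp u) with hpx' | hpx'
  · have h1 := robinExcess_le_of_le_one hu hp hp101 hpx hpx2 hpx' ha
    have h2 := tent_le (y / p)
    rw [hw] at h2
    linarith
  · have := robinExcess_nonpos_of_le (u := u) (a := a) hp (by
      rwa [log_floor_exp_eq_one hpx (by linarith)])
    rw [tent_of_le]
    · nlinarith
    · rw [div_le_iff₀ hp0]
      nlinarith

end

lemma sum_log_div_sub_one_le {y : ℝ} (hy : 1 ≤ y) (N : ℕ) :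
    ∑ p ∈ Nat.primesLE N, (if (p : ℝ) ≤ y then Real.log p / (p - 1) else 0) ≤
      Real.log 2 + Real.log y * (1 + Real.log y) / 2 := by
  have hly := Real.log_nonneg hy
  have hnn : ∀ p : ℕ, 0 ≤ Real.log p / ((p : ℝ) - 1) := fun p ↦ by
    rcases Nat.eq_zero_or_pos p with rfl | h
    · simp
    · have : (1 : ℝ) ≤ p := by exact_mod_cast h
      exact div_nonneg (Real.log_nonneg this) (by linarith)
  set m := (⌊y⌋₊ - 1) / 2 with hm
  have h1 : (Nat.primesLE N).filter (fun p : ℕ ↦ (p : ℝ) ≤ y) ⊆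
      insert 2 ((Icc 1 m).image fun j ↦ 2 * j + 1) := by
    intro p hp
    rw [mem_filter, Nat.mem_primesLE] at hp
    obtain ⟨⟨-, hp⟩, hpy⟩ := hp
    have hpy := Nat.le_floor hpy
    rw [mem_insert, mem_image]
    refine hp.eq_two_or_odd'.imp_right fun ⟨j, hj⟩ ↦ ⟨j, ?_, hj.symm⟩
    have := hp.one_lt
    rw [mem_Icc]
    lia
  rw [← sum_filter]
  refine (sum_le_sum_of_subset_of_nonneg h1 fun p _ _ ↦ hnn p).trans ?_
  rw [sum_insert (by simp), sum_image (by simp)]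
  have h2 : ∀ j ∈ Icc 1 m, Real.log (2 * j + 1 : ℕ) / (((2 * j + 1 : ℕ) : ℝ) - 1)
      ≤ Real.log y / 2 * (j : ℝ)⁻¹ := by
    intro j hj
    rw [mem_Icc] at hj
    have hj0 : (0 : ℝ) < j := by exact_mod_cast hj.1
    have h3 : ((2 * j + 1 : ℕ) : ℝ) ≤ y := (Nat.le_floor_iff (by linarith)).1 (by lia)
    have h5 := Real.log_le_log (by positivity) h3
    rw [div_le_iff₀ (by push_cast; linarith)]
    refine h5.trans_eq ?_
    push_cast
    field_simp
    ring
  have h4 : (harmonic m : ℝ) ≤ 1 + Real.log y := by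
    rcases Nat.eq_zero_or_pos m with h0 | h0
    · rw [h0]
      simp
      linarith
    · refine (harmonic_le_one_add_log m).trans ?_
      gcongr
      exact (Nat.le_floor_iff (by linarith)).1 (by lia)
  have h6 := sum_le_sum h2
  rw [← mul_sum] at h6
  rw [harmonic_eq_sum_Icc] at h4
  push_cast at h4 h6 ⊢
  have h7 := mul_le_mul_of_nonneg_left h4 (by linarith : 0 ≤ Real.log y / 2)
  rw [show (2 : ℝ) - 1 = 1 by norm_num, div_one]
  linarith

lemma sum_tent_pow_le {p : ℕ} (hp : p.Prime) {y : ℝ} (hy1 : 1 ≤ y) (K : ℕ) :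
    ∑ k ∈ Icc 2 K, tent (y / (p ^ k : ℕ)) ≤ if (p : ℝ) ≤ √(5 * y) then 0.654 else 0 := by
  have hy : 0 < y := by linarith
  have hp0 : (0 : ℝ) < p := by exact_mod_cast hp.pos
  have hp2 : (2 : ℝ) ≤ p := by exact_mod_cast hp.two_le
  split_ifs with hpy
  · set j := Nat.log p ⌊y⌋₊ + 1 with hj
    have hyj : y < (p : ℝ) ^ j := by
      exact_mod_cast (Nat.floor_lt hy.le).1 (Nat.lt_pow_of_log_lt hp.one_lt (Nat.lt_succ_self _))
    have h1 : ∀ k, tent (y / (p ^ k : ℕ)) ≤ if j ≤ k then 0.49 * (1 / 4) ^ (k - j) else 0 := by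
      intro k
      split_ifs with hk
      · refine (tent_le _).trans ?_
        refine mul_le_mul_of_nonneg_left ?_ (by norm_num)
        obtain ⟨i, rfl⟩ := Nat.exists_eq_add_of_le hk
        rw [add_tsub_cancel_left, show (1 / 4 : ℝ) ^ i = ((1 / 2) ^ i) ^ 2 by
          rw [← pow_mul, mul_comm, pow_mul]; norm_num]
        gcongr
        push_cast
        rw [pow_add, ← div_div, one_div_pow]
        refine div_le_div₀ zero_le_one ((div_le_one (by positivity)).2 hyj.le) (by positivity) ?_
        gcongr
      · rw [tent_of_one_le]
        rw [one_le_div (by exact_mod_cast pow_pos hp.pos k)]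
        have h0 : ⌊y⌋₊ ≠ 0 := (Nat.floor_pos.2 hy1).ne'
        exact (Nat.le_floor_iff hy.le).1 (Nat.pow_le_of_le_log h0 (by lia))
    calc ∑ k ∈ Icc 2 K, tent (y / (p ^ k : ℕ))
        ≤ ∑ k ∈ Icc 2 K, if j ≤ k then 0.49 * (1 / 4 : ℝ) ^ (k - j) else 0 :=
          sum_le_sum fun k _ ↦ h1 k
      _ = ∑ k ∈ Icc 2 K with j ≤ k, 0.49 * (1 / 4 : ℝ) ^ (k - j) := by rw [sum_filter]
      _ ≤ ∑ k ∈ Ico j (j + (K + 1)), 0.49 * (1 / 4 : ℝ) ^ (k - j) :=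
          sum_le_sum_of_subset_of_nonneg (fun k hk ↦ by
            simp only [mem_filter, mem_Icc, mem_Ico] at hk ⊢
            lia) fun _ _ _ ↦ by positivity
      _ = 0.49 * ∑ i ∈ range (K + 1), (1 / 4 : ℝ) ^ i := by
          rw [sum_Ico_eq_sum_range, mul_sum]
          simp
      _ ≤ 0.49 * (4 / 3) := by
          gcongr
          have := (summable_geometric_of_lt_one (r := (1 / 4 : ℝ)) (by norm_num)
            (by norm_num)).sum_le_tsum (range (K + 1)) fun _ _ ↦ by positivity
          rw [tsum_geometric_of_lt_one (by norm_num) (by norm_num)] at this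
          exact this.trans (by norm_num)
      _ ≤ _ := by norm_num
  · push Not at hpy
    refine (sum_eq_zero fun k hk ↦ tent_of_le ?_).le
    have h1 : 5 * y < (p : ℝ) ^ 2 := (Real.sqrt_lt' hp0).1 hpy
    have h2 : (p : ℝ) ^ 2 ≤ p ^ k := pow_le_pow_right₀ (by linarith) (mem_Icc.1 hk).1
    push_cast
    rw [div_le_iff₀ (by positivity)]
    linarith

lemma sum_vonMangoldt_mul_tent {y : ℝ} (hy : 0 < y) {N : ℕ} (hN : ⌊5 * y⌋₊ ≤ N) :
    ∑ n ∈ Icc 0 N, Λ n * tent (y / n) = y * (0.39 * psiSum (Real.log (5 * y))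
      - 1.248 * psiSum (Real.log (4 / 3 * y)) + 0.858 * psiSum (Real.log y)) := by
  have key : ∀ c : ℝ, 0 < c → c ≤ 5 → y * psiSum (Real.log (c * y))
      = ∑ n ∈ Icc 0 N, Λ n * max (y / n - 1 / c) 0 := by
    intro c hc hc5
    have hcy : 0 < c * y := by positivity
    rw [psiSum_eq_sum_max (N := N), mul_sum]
    · refine sum_congr rfl fun n _ ↦ ?_
      rw [mul_left_comm, mul_max_of_nonneg _ _ hy.le, mul_zero, mul_sub, Real.exp_neg,
        Real.exp_log hcy]
      congr 3
      · ring
      · field_simp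
    · rw [Real.exp_log hcy]
      refine le_trans (Nat.floor_mono ?_) hN
      gcongr
  have h1 := key 5 (by norm_num) le_rfl
  have h2 := key (4 / 3) (by norm_num) (by norm_num)
  have h3 := key 1 one_pos (by norm_num)
  rw [one_mul] at h3
  rw [mul_add, mul_sub, mul_left_comm, h1, mul_left_comm y, h2, mul_left_comm y, h3, mul_sum,
    mul_sum, mul_sum, ← sum_sub_distrib, ← sum_add_distrib]
  refine sum_congr rfl fun n _ ↦ ?_
  rw [tent, show 1 / (4 / 3 : ℝ) = 3 / 4 by norm_num, div_one]
  ring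

/-- A lower bound for `Σ_p tent (y / p)`. -/
lemma le_log_mul_sum_tent {y : ℝ} (hy : 1 ≤ y) {N : ℕ} (hN : ⌊5 * y⌋₊ ≤ N) :
    y * (0.39 * psiSum (Real.log (5 * y)) - 1.248 * psiSum (Real.log (4 / 3 * y))
      + 0.858 * psiSum (Real.log y)) - 0.654 * (Real.log 4 * √(5 * y))
      ≤ Real.log (5 * y) * ∑ p ∈ Nat.primesLE N, tent (y / p) := by
  have hy0 : 0 < y := by linarith
  rw [← sum_vonMangoldt_mul_tent hy0 hN, sum_vonMangoldt_mul (fun n ↦ tent (y / n))]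
  have h1 : ∀ p ∈ Nat.primesLE N, ∑ k ∈ Icc 1 (Nat.log p N), Real.log p * tent (y / (p ^ k : ℕ))
      ≤ Real.log (5 * y) * tent (y / p)
        + 0.654 * (if (p : ℝ) ≤ √(5 * y) then Real.log p else 0) := by
    intro p hp
    rw [Nat.mem_primesLE] at hp
    obtain ⟨hpN, hp⟩ := hp
    have hp0 : (0 : ℝ) < p := by exact_mod_cast hp.pos
    have hlp : 0 < Real.log p := Real.log_pos (by exact_mod_cast hp.one_lt)
    have h2 : 1 ≤ Nat.log p N := Nat.le_log_of_pow_le hp.one_lt (by simpa using hpN)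
    have h3 := sum_tent_pow_le hp hy (Nat.log p N)
    rw [← mul_sum, ← add_sum_Ioc_eq_sum_Icc h2, mul_add]
    have h4 : Real.log p * tent (y / (p ^ 1 : ℕ)) ≤ Real.log (5 * y) * tent (y / p) := by
      rw [pow_one]
      rcases le_or_gt (5 * y) p with h | h
      · rw [tent_of_le (by rw [div_le_iff₀ hp0]; linarith)]
        simp
      · exact mul_le_mul_of_nonneg_right (Real.log_le_log hp0 h.le) (tent_nonneg _)
    have h5 := mul_le_mul_of_nonneg_left h3 hlp.le
    have h6 : Real.log p * (if (p : ℝ) ≤ √(5 * y) then 0.654 else 0) =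
        0.654 * (if (p : ℝ) ≤ √(5 * y) then Real.log p else 0) := by
      split_ifs <;> ring
    rw [h6] at h5
    exact add_le_add h4 h5
  have h2 : ∑ p ∈ Nat.primesLE N, (if (p : ℝ) ≤ √(5 * y) then Real.log p else 0)
      ≤ Real.log 4 * √(5 * y) := by
    refine le_trans ?_ (Chebyshev.theta_le_log4_mul_x (Real.sqrt_nonneg _))
    rw [Chebyshev.theta_eq_sum_primesLE, ← sum_filter]
    refine sum_le_sum_of_subset_of_nonneg (fun p hp ↦ ?_) fun p hp _ ↦ ?_
    · rw [mem_filter, Nat.mem_primesLE] at hp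
      rw [Nat.mem_primesLE]
      exact ⟨Nat.le_floor hp.2, hp.1.2⟩
    · exact Real.log_natCast_nonneg p
  have h3 := sum_le_sum h1
  rw [sum_add_distrib, ← mul_sum, ← mul_sum] at h3
  linarith

end

/-! ### Robin's inequality for large numbers -/

section

open Finset
open scoped ArithmeticFunction.vonMangoldt ArithmeticFunction.sigma

lemma log_five_mem : 1.6085 ≤ Real.log 5 ∧ Real.log 5 ≤ 1.6114 := by
  have h1 := two_mul_le_log_div (x := 1 / 9) (by norm_num) (by norm_num)
  have h2 := log_one_add_le_half (x := 1 / 4) (by norm_num)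
  have h3 : Real.log 5 = 2 * Real.log 2 + Real.log (5 / 4) := by
    rw [Real.log_div (by norm_num) (by norm_num), show (4 : ℝ) = 2 ^ 2 by norm_num, Real.log_pow]
    push_cast
    ring
  norm_num at h1 h2
  have := Real.log_two_gt_d9
  have := Real.log_two_lt_d9
  constructor <;> linarith

lemma log_le_mul_sqrt {y : ℝ} (hy : 316.84 ≤ y) : Real.log y ≤ 0.3242 * √y := by
  have h1 : 17.8 ≤ √y := Real.le_sqrt_of_sq_le (by norm_num; linarith)
  have h2 := Real.log_le_sub_one_of_pos (x := √y / 16) (by positivity)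
  rw [Real.log_div (by positivity) (by norm_num), Real.log_sqrt (by linarith),
    show (16 : ℝ) = 2 ^ 4 by norm_num, Real.log_pow] at h2
  have := Real.log_two_lt_d9
  push_cast at h2
  linarith

section

variable {c c₁ y : ℝ} (hc : ∀ u : ℝ, 0 < u →
  |psiSum u - u - c - c₁ * Real.exp (-u)| ≤ 0.048 * Real.exp (-u / 2) + Real.exp (-3 * u))
  (hy : 317 ≤ y)
include hc hy

lemma le_psiSum_combination : 0.256 ≤ 0.39 * psiSum (Real.log (5 * y))
    - 1.248 * psiSum (Real.log (4 / 3 * y)) + 0.858 * psiSum (Real.log y) := by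
  have key : ∀ k : ℝ, 1 ≤ k →
      |psiSum (Real.log (k * y)) - (Real.log k + Real.log y) - c - c₁ / k * y⁻¹| ≤ 0.0028 := by
    intro k hk
    have hky : 317 ≤ k * y := by nlinarith
    have hu : 0 < Real.log (k * y) := Real.log_pos (by linarith)
    have h1 := hc _ hu
    have h2 : Real.exp (-Real.log (k * y) / 2) ≤ 1 / 17.8 := by
      rw [neg_div, Real.exp_neg, ← one_div, ← Real.log_sqrt (by linarith),
        Real.exp_log (Real.sqrt_pos.2 (by linarith))]
      gcongr
      exact Real.le_sqrt_of_sq_le (by norm_num; linarith)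
    have h3 : Real.exp (-3 * Real.log (k * y)) ≤ (1 / 317) ^ 3 := by
      rw [show -3 * Real.log (k * y) = (3 : ℕ) * -Real.log (k * y) by push_cast; ring,
        Real.exp_nat_mul, Real.exp_neg, Real.exp_log (by linarith), ← one_div]
      gcongr
    rw [Real.exp_neg, Real.exp_log (by linarith), Real.log_mul (by linarith) (by linarith)] at h1
    rw [Real.log_mul (by linarith) (by linarith)] at h2 h3 ⊢
    rw [show c₁ / k * y⁻¹ = c₁ * (k * y)⁻¹ by rw [mul_inv]; ring]
    refine h1.trans ?_
    norm_num at h2 h3 ⊢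
    linarith
  have h1 := (abs_le.1 (key 5 (by norm_num))).1
  have h2 := (abs_le.1 (key (4 / 3) (by norm_num))).2
  have h3 := (abs_le.1 (key 1 le_rfl)).1
  rw [one_mul, Real.log_one] at h3
  have h4 := log_one_add_le_half (x := 1 / 3) (by norm_num)
  norm_num at h4
  have h5 := log_five_mem.1
  linarith

lemma le_sum_tent {u : ℝ} (hu : 11.5 ≤ u) (hyu : y ^ 2 = 1.01 * Real.exp u) {N : ℕ}
    (hN : ⌊5 * y⌋₊ ≤ N) : 0.21 * y / u ≤ ∑ p ∈ Nat.primesLE N, tent (y / p) := by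
  have hy0 : 0 < y := by linarith
  have h1 := le_log_mul_sum_tent (y := y) (by linarith) hN
  have h2 := le_psiSum_combination hc hy
  have hr : 17.8 ≤ √y := Real.le_sqrt_of_sq_le (by norm_num; linarith)
  have hr2 := Real.sq_sqrt hy0.le
  have h3 : Real.log 4 * √(5 * y) ≤ 3.1003 * √y := by
    rw [Real.sqrt_mul (by norm_num), show (4 : ℝ) = 2 ^ 2 by norm_num, Real.log_pow, ← mul_assoc]
    gcongr
    have h4 : √5 ≤ 2.2361 := Real.sqrt_le_iff.2 (by norm_num)
    have := Real.log_two_lt_d9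
    have := Real.log_pos one_lt_two
    push_cast
    nlinarith [Real.sqrt_nonneg 5]
  have h4 : 0.654 * (Real.log 4 * √(5 * y)) ≤ 0.114 * y := by nlinarith
  have h5 : Real.log (5 * y) ≤ 0.641 * u := by
    have h6 := congrArg Real.log hyu
    rw [Real.log_pow, Real.log_mul (by norm_num) (Real.exp_pos u).ne', Real.log_exp] at h6
    have h7 := Real.log_le_sub_one_of_pos (x := 1.01) (by norm_num)
    have h8 := log_five_mem.2
    rw [Real.log_mul (by norm_num) hy0.ne']
    push_cast at h6
    linarith
  have h6 : 0 ≤ ∑ p ∈ Nat.primesLE N, tent (y / p) := sum_nonneg fun p _ ↦ tent_nonneg _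
  have h7 := mul_le_mul_of_nonneg_right h5 h6
  have h8 := mul_le_mul_of_nonneg_left h2 hy0.le
  rw [div_le_iff₀ (by linarith)]
  nlinarith

end

/-- Robin's inequality for large `n` under the Riemann hypothesis. -/
theorem log_sigma_div_le_of_large (h : RiemannHypothesis) {n : ℕ} (hn : 10 ^ 5 ≤ Real.log n) :
    Real.log (ArithmeticFunction.sigma 1 n / n)
      ≤ Real.log (Real.log (Real.log n)) + Real.eulerMascheroniConstant := by
  obtain ⟨c, c₁, hc⟩ := exists_abs_psiSum_sub_le h
  set u := Real.log (Real.log n) with hu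
  have hnu : Real.exp u = Real.log n := Real.exp_log (by linarith)
  have hu1 : 11.5 ≤ u := by
    have h1 := Real.log_le_log (by norm_num) hn
    rw [show (10 : ℝ) ^ 5 = (2 * 5) ^ 5 by norm_num, Real.log_pow,
      Real.log_mul (by norm_num) (by norm_num)] at h1
    have := log_five_mem.1
    have := Real.log_two_gt_d9
    push_cast at h1
    linarith
  have hu0 : 0 < u := by linarith
  set x := Real.exp u with hx
  have hx0 : 0 < x := Real.exp_pos u
  set y := √(1.01 * x) with hy
  have hyx : y ^ 2 = 1.01 * x := Real.sq_sqrt (by positivity)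
  have hy317 : 317 ≤ y := Real.le_sqrt_of_sq_le (by norm_num; linarith)
  set N := n + ⌊5 * y⌋₊ + ⌊x⌋₊ with hN
  rw [log_sigma_div_eq_add_sum_robinExcess (N := N) hu0 hnu.symm (by lia) (by lia)]
  set s := Real.exp (u / 2) with hs
  have hsx : s ^ 2 = x := by rw [hs, ← Real.exp_nat_mul]; push_cast; congr 1; ring
  have hs316 : 316 ≤ s := by
    have := Real.exp_pos (u / 2)
    nlinarith
  have hsy : s ≤ y := Real.le_sqrt_of_sq_le (by rw [hsx]; linarith)
  have h1 := mertensRemainder_div_le (fun v hv ↦ (hc v hv).1) hu0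
  have h2 := le_sum_tent (fun v hv ↦ (hc v hv).2) hy317 hu1 hyx (N := N) (by lia)
  have h3 := sum_log_div_sub_one_le (y := y) (by linarith) N
  have h4 : x * ∑ p ∈ Nat.primesLE N, robinExcess u p (n.factorization p)
      ≤ 0.065 * y / u - 0.21 * y / u := by
    rw [mul_sum]
    refine (sum_le_sum fun p hp ↦ exp_mul_robinExcess_le hu0 hyx (by linarith)
      (Nat.mem_primesLE.1 hp).2).trans ?_
    rw [sum_sub_distrib, ← sum_div]
    refine sub_le_sub ?_ h2
    gcongr
    refine h3.trans ?_
    have h5 := log_le_mul_sqrt (y := y) (by linarith)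
    have h6 := Real.log_nonneg (x := y) (by linarith)
    have h7 := Real.log_two_lt_d9
    have hr : 17.8 ≤ √y := Real.le_sqrt_of_sq_le (by norm_num; linarith)
    have hr2 := Real.sq_sqrt (by linarith : 0 ≤ y)
    have h8 : Real.log y ^ 2 ≤ (0.3242 * √y) ^ 2 := by gcongr
    nlinarith
  have h5 : x * (mertensRemainder u / u) ≤ 0.12 * y / u := by
    refine (mul_le_mul_of_nonneg_left h1 hx0.le).trans ?_
    have e1 : Real.exp (-u / 2) = s⁻¹ := by rw [neg_div, Real.exp_neg]
    have e2 : Real.exp (-u) = (s ^ 2)⁻¹ := by rw [Real.exp_neg, hsx]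
    have e3 : x * (2 * ((1 / u + 1 / u ^ 2) * (0.048 * s⁻¹ + 1.84 * (s ^ 2)⁻¹)))
        = 2 * (1 + 1 / u) * (0.048 * s + 1.84) / u := by
      rw [← hsx]
      have : s ≠ 0 := by positivity
      field_simp
    rw [e1, e2, e3]
    refine div_le_div_of_nonneg_right ?_ hu0.le
    have h6 : 1 / u ≤ 1 / 11.5 := by gcongr
    have h7 : 2 * (1 + 1 / u) ≤ 2.174 := by linarith
    have h8 : 0.048 * s + 1.84 ≤ 0.0539 * y := by linarith
    have h9 := mul_le_mul h7 h8 (by positivity) (by norm_num)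
    linarith
  have h6 : x * (mertensRemainder u / u
      + ∑ p ∈ Nat.primesLE N, robinExcess u p (n.factorization p)) ≤ 0 := by
    have h7 : 0 ≤ y / u := by positivity
    rw [mul_div_assoc] at h4 h5
    rw [mul_div_assoc] at h4
    linarith
  have h7 := nonpos_of_mul_nonpos_right h6 hx0
  linarith

end

/-! ### Linear bounds for the logarithm of the abundancy index -/

section

open Finset

/-- The sum `p + p ^ 2 + ⋯ + p ^ (i + 1)`. -/
def powSum (p : ℕ) : ℕ → ℕ
  | 0 => p
  | i + 1 => p * (powSum p i + 1)

lemma powSum_pos {p : ℕ} (hp : 0 < p) (i : ℕ) : 0 < powSum p i := by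
  cases i with
  | zero => exact hp
  | succ i => exact Nat.mul_pos hp (Nat.succ_pos _)

lemma powSum_le_powSum {p q i j : ℕ} (hp : 0 < p) (hpq : p ≤ q) (hij : i ≤ j) :
    powSum p i ≤ powSum q j := by
  have h1 : powSum p i ≤ powSum p j := by
    induction hij with
    | refl => rfl
    | step _ ih => exact ih.trans ((Nat.le_succ _).trans (Nat.le_mul_of_pos_left _ hp))
  refine h1.trans ?_
  clear h1 hij
  induction j with
  | zero => exact hpq
  | succ j ih => exact Nat.mul_le_mul hpq (Nat.succ_le_succ ih)

lemma powSum_mul_add (p i : ℕ) : (powSum p i : ℝ) * (p - 1) + p = (p : ℝ) ^ (i + 2) := by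
  induction i with
  | zero => simp only [powSum]; ring
  | succ i ih =>
    rw [powSum, pow_succ, ← ih]
    push_cast
    ring

lemma logSigmaPow_eq_sum {p : ℕ} (hp : p.Prime) (a : ℕ) :
    logSigmaPow p a = ∑ i ∈ range a, Real.log (1 + 1 / powSum p i) := by
  induction a with
  | zero => simp [logSigmaPow_zero]
  | succ a ih =>
    rw [sum_range_succ, ← ih, logSigmaPow, logSigmaPow]
    obtain ⟨h1, h2⟩ := hp.inv_pow_mem a
    obtain ⟨h3, h4⟩ := hp.inv_pow_mem (a + 1)
    have hD : (0 : ℝ) < powSum p a := by exact_mod_cast powSum_pos hp.pos a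
    have hp0 : (p : ℝ) ≠ 0 := by exact_mod_cast hp.ne_zero
    suffices h : 1 - (p : ℝ)⁻¹ ^ (a + 1 + 1) =
        (1 - (p : ℝ)⁻¹ ^ (a + 1)) * (1 + 1 / powSum p a) by
      rw [h, Real.log_mul (by linarith) (by positivity)]
      ring
    have h5 := powSum_mul_add p a
    rw [pow_succ _ (a + 1), inv_pow]
    have hX : (p : ℝ) ^ (a + 1) ≠ 0 := pow_ne_zero _ hp0
    rw [pow_succ _ (a + 1)] at h5
    field_simp
    linear_combination h5

/-- The gain in `log (σ(n) / n) - ε log n` from the `(i + 1)`-st factor `p` of `n`. -/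
noncomputable def powGain (ε : ℝ) (p i : ℕ) : ℝ :=
  Real.log (1 + 1 / powSum p i) - ε * Real.log p

lemma powGain_le_powGain {ε : ℝ} (hε : 0 ≤ ε) {p q i j : ℕ} (hp : 0 < p) (hpq : p ≤ q)
    (hij : i ≤ j) : powGain ε q j ≤ powGain ε p i := by
  have h1 : (powSum p i : ℝ) ≤ powSum q j := by exact_mod_cast powSum_le_powSum hp hpq hij
  have h2 : (0 : ℝ) < powSum p i := by exact_mod_cast powSum_pos hp i
  have hp' : (0 : ℝ) < p := by exact_mod_cast hp
  have hq' : (p : ℝ) ≤ q := by exact_mod_cast hpq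
  unfold powGain
  gcongr

/-- The total positive gain from the second to the `(J + 1)`-st factor `p`. -/
noncomputable def powExcess (J : ℕ) (ε : ℝ) (p : ℕ) : ℝ :=
  ∑ i ∈ range J, max 0 (powGain ε p (i + 1))

lemma sum_powGain_le {J : ℕ} {ε : ℝ} {p : ℕ} (h : ∀ i, J ≤ i → powGain ε p (i + 1) ≤ 0) (a : ℕ) :
    ∑ i ∈ range a, powGain ε p (i + 1) ≤ powExcess J ε p := by
  have h1 : ∑ i ∈ range a, powGain ε p (i + 1) ≤
      ∑ i ∈ range a, if i < J then max 0 (powGain ε p (i + 1)) else 0 := by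
    refine sum_le_sum fun i _ ↦ ?_
    split_ifs with hi
    · exact le_max_right _ _
    · exact h i (not_lt.1 hi)
  refine h1.trans ?_
  rw [← sum_filter, powExcess]
  refine sum_le_sum_of_subset_of_nonneg (fun i hi ↦ ?_) fun _ _ _ ↦ le_max_left _ _
  rw [mem_filter] at hi
  exact mem_range.2 hi.2

lemma log_sigma_div_le_add_sum {n : ℕ} (hn : n ≠ 0) {ε : ℝ} (T Q : Finset ℕ) {b c : ℕ → ℝ}
    (hb : ∀ p ∈ T, 0 ≤ b p) (hc : ∀ p ∈ Q, 0 ≤ c p)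
    (h : ∀ p a : ℕ, p.Prime → logSigmaPow p a - ε * (a * Real.log p)
      ≤ (if p ∈ T then b p else 0) + if p ∈ Q then c p else 0) :
    Real.log (ArithmeticFunction.sigma 1 n / n)
      ≤ ε * Real.log n + (∑ p ∈ T, b p + ∑ p ∈ Q, c p) := by
  have key (A : Finset ℕ) (f : ℕ → ℝ) (hf : ∀ p ∈ A, 0 ≤ f p) :
      ∑ p ∈ Nat.primesLE n, (if p ∈ A then f p else 0) ≤ ∑ p ∈ A, f p := by
    rw [← sum_filter]
    refine sum_le_sum_of_subset_of_nonneg (fun i hi ↦ ?_) fun i hi _ ↦ hf i hi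
    exact (mem_filter.1 hi).2
  rw [log_sigma_div_eq_sum hn le_rfl, log_eq_sum_factorization hn le_rfl, mul_sum,
    ← sub_le_iff_le_add', ← sum_sub_distrib]
  calc _ ≤ ∑ p ∈ Nat.primesLE n, ((if p ∈ T then b p else 0) + if p ∈ Q then c p else 0) :=
        sum_le_sum fun p hp ↦ h p _ (Nat.mem_primesLE.1 hp).2
    _ ≤ _ := by
      rw [sum_add_distrib]
      exact add_le_add (key T b hb) (key Q c hc)

/-- A linear bound for `log (σ(n) / n)` in terms of `log n`, of slope `ε`, obtained by optimizing
the exponent of every prime. -/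
lemma log_sigma_div_le_linear {n : ℕ} (hn : n ≠ 0) {ε : ℝ} (hε : 0 ≤ ε) {J P : ℕ}
    {T Q : Finset ℕ} (hT : ∀ p ∈ T, 0 < p ∧ p ≤ P) (hTP : ∀ p, p.Prime → p ≤ P → p ∈ T)
    (hP : 0 ≤ powGain ε P 0) (hP' : powGain ε (P + 1) 0 ≤ 0)
    (hQ : ∀ p ∈ Q, ∀ i, J ≤ i → powGain ε p (i + 1) ≤ 0)
    (hQ' : ∀ p, p.Prime → p ∉ Q → powGain ε p 1 ≤ 0) :
    Real.log (ArithmeticFunction.sigma 1 n / n)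
      ≤ ε * Real.log n + (∑ p ∈ T, powGain ε p 0 + ∑ p ∈ Q, powExcess J ε p) := by
  have hT0 : ∀ p ∈ T, 0 ≤ powGain ε p 0 := fun p hp ↦
    hP.trans (powGain_le_powGain hε (hT p hp).1 (hT p hp).2 le_rfl)
  have hQ0 : ∀ p ∈ Q, 0 ≤ powExcess J ε p := fun p _ ↦ sum_nonneg fun _ _ ↦ le_max_left _ _
  refine log_sigma_div_le_add_sum hn T Q hT0 hQ0 fun p a hp ↦ ?_
  have e : logSigmaPow p a - ε * (a * Real.log p) = ∑ i ∈ range a, powGain ε p i := by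
    rw [logSigmaPow_eq_sum hp]
    simp only [powGain, sum_sub_distrib, sum_const, card_range, nsmul_eq_mul]
    ring
  rw [e]
  cases a with
  | zero =>
    rw [sum_range_zero]
    split_ifs with h1 h2 h2
    · exact add_nonneg (hT0 p h1) (hQ0 p h2)
    · exact add_nonneg (hT0 p h1) le_rfl
    · exact add_nonneg le_rfl (hQ0 p h2)
    · simp
  | succ a =>
    rw [sum_range_succ', add_comm]
    refine add_le_add ?_ ?_
    · split_ifs with h1
      · exact le_rfl
      · have : P + 1 ≤ p := by
          by_contra! h2
          exact h1 (hTP p hp (by omega))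
        exact (powGain_le_powGain hε (by omega) this le_rfl).trans hP'
    · split_ifs with h1
      · exact sum_powGain_le (hQ p h1) a
      · refine sum_nonpos fun i _ ↦ ?_
        exact (powGain_le_powGain hε hp.pos le_rfl (by omega)).trans (hQ' p hp h1)

lemma add_mul_le_log_log {c d y y₁ y₂ : ℝ} (h1 : 1 < y₁) (hy1 : y₁ ≤ y) (hy2 : y ≤ y₂)
    (H1 : c + d * y₁ ≤ Real.log (Real.log y₁)) (H2 : c + d * y₂ ≤ Real.log (Real.log y₂)) :
    c + d * y ≤ Real.log (Real.log y) := by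
  rcases hy1.eq_or_lt with rfl | hlt
  · exact H1
  have h12 : 0 < y₂ - y₁ := by linarith
  have l1 := Real.log_pos h1
  have l2 := Real.log_pos (h1.trans_le (hy1.trans hy2))
  set s := (y₂ - y) / (y₂ - y₁)
  set t := (y - y₁) / (y₂ - y₁)
  have hs : 0 ≤ s := div_nonneg (by linarith) h12.le
  have ht : 0 < t := div_pos (by linarith) h12
  have hst : s + t = 1 := by simp only [s, t]; field_simp; ring
  have hy : s * y₁ + t * y₂ = y := by simp only [s, t]; field_simp; ring
  have c1 := strictConcaveOn_log_Ioi.concaveOn.2 (Set.mem_Ioi.2 (by linarith : 0 < y₁))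
    (Set.mem_Ioi.2 (by linarith : 0 < y₂)) hs ht.le hst
  have c2 := strictConcaveOn_log_Ioi.concaveOn.2 (Set.mem_Ioi.2 l1) (Set.mem_Ioi.2 l2) hs ht.le hst
  simp only [smul_eq_mul] at c1 c2
  rw [hy] at c1
  have c3 := Real.log_le_log (by positivity) c1
  calc c + d * y = s * (c + d * y₁) + t * (c + d * y₂) := by
        rw [← hy]; linear_combination (-c) * hst
    _ ≤ s * Real.log (Real.log y₁) + t * Real.log (Real.log y₂) := by gcongr
    _ ≤ _ := c2.trans c3

end

/-! ### Certified bounds -/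

section

open Finset

/-- Rounded value of `10 ^ 15 * (2 z + 2 z ^ 3 / 3 + 2 z ^ 5 / 5)` for `z = a / b`. -/
def artLower (a b : ℕ) : ℕ :=
  2 * 10 ^ 15 * a / b + 2 * 10 ^ 15 * a ^ 3 / (3 * b ^ 3) + 2 * 10 ^ 15 * a ^ 5 / (5 * b ^ 5)

/-- An upper bound for `10 ^ 15 * log ((1 + z) / (1 - z))` for `z = a / b`. -/
def artUpper (a b : ℕ) : ℕ :=
  2 * 10 ^ 15 * a / b + 2 * 10 ^ 15 * a ^ 3 / (3 * b ^ 3) +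
    2 * 10 ^ 15 * a ^ 5 / (5 * b ^ 3 * (b ^ 2 - a ^ 2)) + 3

lemma cast_le_cast_div_add_one (m n : ℕ) : (m : ℝ) / n ≤ (m / n : ℕ) + 1 := by
  rw [← Nat.floor_div_eq_div (K := ℝ)]
  exact (Nat.lt_floor_add_one _).le

lemma sum_le_log_sub_log_le {z : ℝ} (h0 : 0 ≤ z) (h1 : z < 1) :
    2 * z + 2 * z ^ 3 / 3 + 2 * z ^ 5 / 5 ≤ Real.log (1 + z) - Real.log (1 - z) ∧
    Real.log (1 + z) - Real.log (1 - z)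
      ≤ 2 * z + 2 * z ^ 3 / 3 + 2 * z ^ 5 / (5 * (1 - z ^ 2)) := by
  have h := Real.hasSum_log_sub_log_of_abs_lt_one (x := z) (by rwa [abs_of_nonneg h0])
  have h3 := (hasSum_nat_add_iff' 2).2 h
  have h4 : HasSum (fun k : ℕ ↦ 2 * z ^ 5 / 5 * (z ^ 2) ^ k) (2 * z ^ 5 / 5 * (1 - z ^ 2)⁻¹) :=
    (hasSum_geometric_of_lt_one (by positivity) (by nlinarith)).mul_left _
  constructor
  · refine le_trans (le_of_eq ?_) (sum_le_hasSum (range 3) (fun i _ ↦ by positivity) h)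
    norm_num [sum_range_succ]
    ring
  · have h5 := hasSum_le (fun k ↦ ?_) h3 h4
    · rw [sub_le_iff_le_add'] at h5
      refine h5.trans (le_of_eq ?_)
      norm_num [sum_range_succ]
      rw [div_mul_eq_div_div, div_eq_mul_inv _ (1 - z ^ 2)]
      ring
    · push_cast
      rw [show 2 * z ^ 5 / 5 * (z ^ 2) ^ k = 2 * (1 / 5) * z ^ (2 * (k + 2) + 1) by ring]
      gcongr
      linarith [(Nat.cast_nonneg k : (0 : ℝ) ≤ k)]

section

variable {x y : ℕ}

lemma log_sub_log_eq (hx : 0 < x) (hxy : x ≤ y) :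
    Real.log y - Real.log x = Real.log (1 + ((y - x : ℕ) : ℝ) / (y + x : ℕ)) -
      Real.log (1 - ((y - x : ℕ) : ℝ) / (y + x : ℕ)) := by
  have hx' : (0 : ℝ) < x := by exact_mod_cast hx
  have hy' : (0 : ℝ) < y := by exact_mod_cast hx.trans_le hxy
  push_cast [Nat.cast_sub hxy]
  have e1 : 1 + ((y : ℝ) - x) / (y + x) = 2 / (y + x) * y := by field_simp; ring
  have e2 : 1 - ((y : ℝ) - x) / (y + x) = 2 / (y + x) * x := by field_simp; ring
  rw [e1, e2, Real.log_mul (by positivity) hy'.ne', Real.log_mul (by positivity) hx'.ne']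
  ring

lemma artLower_le (hx : 0 < x) (hxy : x ≤ y) :
    (artLower (y - x) (y + x) : ℝ) ≤ 10 ^ 15 * (Real.log y - Real.log x) := by
  rw [log_sub_log_eq hx hxy]
  set a := y - x
  set b := y + x
  have hb : (0 : ℝ) < b := by exact_mod_cast (by omega : 0 < b)
  have hab : (a : ℝ) < b := by exact_mod_cast (by omega : a < b)
  clear_value a b
  have h := (sum_le_log_sub_log_le (z := a / b) (by positivity) ((div_lt_one hb).2 hab)).1
  refine le_trans ?_ (mul_le_mul_of_nonneg_left h (by positivity))
  have h1 := Nat.cast_div_le (α := ℝ) (m := 2 * 10 ^ 15 * a) (n := b)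
  have h2 := Nat.cast_div_le (α := ℝ) (m := 2 * 10 ^ 15 * a ^ 3) (n := 3 * b ^ 3)
  have h3 := Nat.cast_div_le (α := ℝ) (m := 2 * 10 ^ 15 * a ^ 5) (n := 5 * b ^ 5)
  rw [artLower, Nat.cast_add, Nat.cast_add]
  refine (add_le_add (add_le_add h1 h2) h3).trans (le_of_eq ?_)
  push_cast
  field_simp
  ring

lemma le_artUpper (hx : 0 < x) (hxy : x ≤ y) :
    10 ^ 15 * (Real.log y - Real.log x) ≤ artUpper (y - x) (y + x) := by
  rw [log_sub_log_eq hx hxy]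
  set a := y - x
  set b := y + x
  have hb : (0 : ℝ) < b := by exact_mod_cast (by omega : 0 < b)
  have hab' : a < b := by omega
  clear_value a b
  have hab : (a : ℝ) < b := by exact_mod_cast hab'
  have h := (sum_le_log_sub_log_le (z := a / b) (by positivity) ((div_lt_one hb).2 hab)).2
  refine (mul_le_mul_of_nonneg_left h (by positivity)).trans ?_
  have h1 := cast_le_cast_div_add_one (2 * 10 ^ 15 * a) b
  have h2 := cast_le_cast_div_add_one (2 * 10 ^ 15 * a ^ 3) (3 * b ^ 3)
  have h3 := cast_le_cast_div_add_one (2 * 10 ^ 15 * a ^ 5) (5 * b ^ 3 * (b ^ 2 - a ^ 2))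
  have hsq : (0 : ℝ) < b ^ 2 - a ^ 2 := by nlinarith [(Nat.cast_nonneg a : (0 : ℝ) ≤ a)]
  rw [artUpper, Nat.cast_add, Nat.cast_add, Nat.cast_add]
  refine le_trans (le_of_eq ?_) ((add_le_add (add_le_add h1 h2) h3).trans (le_of_eq (by
    push_cast; ring)))
  push_cast [Nat.cast_sub (Nat.pow_le_pow_left hab'.le 2)]
  have : 1 - ((a : ℝ) / b) ^ 2 = (b ^ 2 - a ^ 2) / b ^ 2 := by field_simp
  rw [this]
  field_simp
  ring

end

lemma artLower_one_le {D : ℕ} (hD : 0 < D) :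
    (artLower 1 (2 * D + 1) : ℝ) ≤ 10 ^ 15 * Real.log (1 + 1 / D) := by
  have h := artLower_le hD (Nat.le_succ D)
  rw [show D.succ - D = 1 by omega, show D.succ + D = 2 * D + 1 by omega] at h
  have hD' : (0 : ℝ) < D := by exact_mod_cast hD
  rw [← Real.log_div (by positivity) hD'.ne'] at h
  rw [show 1 + 1 / (D : ℝ) = (D.succ : ℕ) / D by push_cast; field_simp]
  exact h

lemma le_artUpper_one {D : ℕ} (hD : 0 < D) :
    10 ^ 15 * Real.log (1 + 1 / D) ≤ artUpper 1 (2 * D + 1) := by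
  have h := le_artUpper hD (Nat.le_succ D)
  rw [show D.succ - D = 1 by omega, show D.succ + D = 2 * D + 1 by omega] at h
  have hD' : (0 : ℝ) < D := by exact_mod_cast hD
  rw [← Real.log_div (by positivity) hD'.ne'] at h
  rw [show 1 + 1 / (D : ℝ) = (D.succ : ℕ) / D by push_cast; field_simp]
  exact h

/-- Application of `f` to `n`, arranged such that kernel reduction evaluates `n` first. -/
def forceNat {α : Type} (n : ℕ) (f : ℕ → α) : α := Nat.rec (f 0) (fun m _ ↦ f (m + 1)) n

@[simp] lemma forceNat_eq {α : Type} (n : ℕ) (f : ℕ → α) : forceNat n f = f n := by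
  cases n <;> rfl

/-- Bounds, scaled by `10 ^ 15`, for the logarithm of a prime and for the sums of `log (1 + 1 / p)`
and of `log p` over the primes up to it. -/
structure PrimeSums where
  prime : ℕ
  logLower : ℕ
  logUpper : ℕ
  sigmaUpper : ℕ
  thetaLower : ℕ

namespace PrimeSums

/-- Passes the bounds that include the next prime `m` to `f`. -/
def next (s : PrimeSums) (m : ℕ) (f : PrimeSums → Bool) : Bool :=
  forceNat (s.logLower + artLower (m - s.prime) (m + s.prime)) fun l ↦
  forceNat (s.logUpper + artUpper (m - s.prime) (m + s.prime)) fun u ↦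
  forceNat (s.sigmaUpper + artUpper 1 (2 * m + 1)) fun a ↦
  forceNat (s.thetaLower + l) fun t ↦ f ⟨m, l, u, a, t⟩

/-- Passes to `f` the bounds that include all of `m + 2, m + 4, …, m + 2 * n` that are
coprime to `M`. -/
def advance (M n : ℕ) : ℕ → PrimeSums → (PrimeSums → Bool) → Bool :=
  Nat.rec (fun _ s f ↦ f s)
    (fun _ ih m s f ↦ forceNat (m + 2) fun m ↦
      bif Nat.beq (Nat.gcd M m) 1 then s.next m fun s ↦ ih m s f else ih m s f) n

/-- The bounds `s` are correct for a set of natural numbers up to `m` containing all primes up to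
`m`. -/
structure Valid (m : ℕ) (s : PrimeSums) : Prop where
  pos : 0 < s.prime
  le : s.prime ≤ m
  logLower_le : (s.logLower : ℝ) ≤ 10 ^ 15 * Real.log s.prime
  le_logUpper : 10 ^ 15 * Real.log s.prime ≤ s.logUpper
  exists_finset : ∃ T : Finset ℕ, (∀ p ∈ T, 0 < p ∧ p ≤ s.prime) ∧
    (∀ p, p.Prime → p ≤ m → p ∈ T) ∧
    10 ^ 15 * ∑ p ∈ T, Real.log (1 + 1 / p) ≤ s.sigmaUpper ∧
    (s.thetaLower : ℝ) ≤ 10 ^ 15 * ∑ p ∈ T, Real.log p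

variable {m : ℕ} {s : PrimeSums}

lemma Valid.next (h : s.Valid m) {k : ℕ} (hmk : m < k) (hk : ∀ p, p.Prime → m < p → p < k → False)
    {f : PrimeSums → Bool} (hf : s.next k f = true) : ∃ s', Valid k s' ∧ f s' = true := by
  simp only [PrimeSums.next, forceNat_eq] at hf
  refine ⟨_, ?_, hf⟩
  have hsk : s.prime ≤ k := h.le.trans hmk.le
  have h1 := artLower_le h.pos hsk
  have h2 := le_artUpper h.pos hsk
  have h3 := le_artUpper_one (D := k) (by omega)
  have h4 := h.logLower_le
  have h5 := h.le_logUpper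
  obtain ⟨T, hT, hTm, hA, ht⟩ := h.exists_finset
  have hkT : k ∉ T := fun hk ↦ by
    have := (hT k hk).2
    have := h.le
    omega
  refine ⟨by simp only; omega, le_rfl, ?_, ?_, insert k T, fun p hp ↦ ?_, fun p hp hpk ↦ ?_, ?_, ?_⟩
  · push_cast
    linarith
  · push_cast
    linarith
  · rcases mem_insert.1 hp with rfl | hp
    · exact ⟨by omega, le_rfl⟩
    · exact ⟨(hT p hp).1, (hT p hp).2.trans hsk⟩
  · rw [mem_insert]
    rcases hpk.eq_or_lt with rfl | hpk
    · exact .inl rfl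
    · exact .inr (hTm p hp (not_lt.1 fun hlt ↦ hk p hp hlt hpk))
  · rw [sum_insert hkT]
    push_cast
    linarith
  · rw [sum_insert hkT]
    push_cast
    linarith

lemma Valid.advance {M : ℕ} {f : PrimeSums → Bool} (n : ℕ) (hm : Odd m) (h1 : 1 < m)
    (hM : ∀ p, p.Prime → m < p → M.Coprime p) (h : s.Valid m) (hf : s.advance M n m f = true) :
    ∃ s', Valid (m + 2 * n) s' ∧ f s' = true := by
  induction n generalizing m s with
  | zero => exact ⟨s, h, hf⟩
  | succ n ih =>
    have hodd : Odd (m + 2) := hm.add_even even_two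
    have hp (p : ℕ) (hp : p.Prime) (hmp : m < p) (hpm : p < m + 2) : False := by
      obtain rfl : p = m + 1 := by omega
      exact Nat.not_even_iff_odd.2 (hp.odd_of_ne_two (by omega)) hm.add_one
    have hM' (p : ℕ) (hp : p.Prime) (hmp : m + 2 < p) : M.Coprime p := hM p hp (by omega)
    change forceNat (m + 2) (fun m ↦ bif Nat.beq (Nat.gcd M m) 1 then
      s.next m fun s ↦ s.advance M n m f else s.advance M n m f) = true at hf
    rw [forceNat_eq] at hf
    rw [show m + 2 * (n + 1) = m + 2 + 2 * n by ring]
    cases hg : Nat.beq (Nat.gcd M (m + 2)) 1 with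
    | true =>
      rw [hg, cond_true] at hf
      obtain ⟨s', hs', hf'⟩ := h.next (by omega) hp hf
      exact ih hodd (by omega) hM' hs' hf'
    | false =>
      rw [hg, cond_false] at hf
      refine ih hodd (by omega) hM' ⟨h.pos, by linarith [h.le], h.logLower_le, h.le_logUpper, ?_⟩ hf
      obtain ⟨T, hT, hTm, hA⟩ := h.exists_finset
      refine ⟨T, hT, fun p hp' hpm ↦ hTm p hp' (not_lt.1 fun hlt ↦ ?_), hA⟩
      rcases hpm.eq_or_lt with rfl | hpm
      · exact Nat.ne_of_beq_eq_false hg (hM _ hp' hlt)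
      · exact hp p hp' hlt hpm

end PrimeSums

/-- Adds to `t` scaled bounds for the positive values among `powGain K⁻¹ p`, starting with the one
belonging to `D`, and passes the result to `f`. -/
def powerTail (K p l : ℕ) : ℕ → ℕ → ℕ → (ℕ → Bool) → Bool
  | 0, _, _, _ => false
  | n + 1, D, t, f => forceNat (K * artUpper 1 (2 * D + 1)) fun u ↦
      bif u.ble l then f t else
      forceNat (p * (D + 1)) fun D ↦ forceNat (t + (u - l)) fun t ↦
      powerTail K p l n D t f

/-- Adds to `t` scaled bounds for `powExcess 30 K⁻¹ p` for all `p` in a list and passes the result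
to `f`. -/
def primeTail (K : ℕ) : List ℕ → ℕ → ℕ → ℕ → (ℕ → Bool) → Bool
  | [], q, l, t, f => Nat.ble (K * artUpper 1 (2 * (q * (q + 1)) + 1)) l && f t
  | p :: ps, q, l, t, f =>
      forceNat (l + artLower (p - q) (p + q)) fun l ↦
      powerTail K p l 30 (p * (p + 1)) t fun t ↦ primeTail K ps p l t f

section

variable {K : ℕ}

lemma powGain_mul_le (hK : 0 < K) {p l : ℕ} (hp : 0 < p) (hl : (l : ℝ) ≤ 10 ^ 15 * Real.log p)
    (i : ℕ) : K * 10 ^ 15 * powGain (K : ℝ)⁻¹ p i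
      ≤ ((K * artUpper 1 (2 * powSum p i + 1) : ℕ) : ℝ) - l := by
  have h := le_artUpper_one (powSum_pos hp i)
  have hK' : (0 : ℝ) < K := by exact_mod_cast hK
  have h' := mul_le_mul_of_nonneg_left h hK'.le
  have e : K * 10 ^ 15 * powGain (K : ℝ)⁻¹ p i =
      K * (10 ^ 15 * Real.log (1 + 1 / powSum p i)) - 10 ^ 15 * Real.log p := by
    unfold powGain
    field_simp
  rw [e]
  push_cast
  linarith

lemma powGain_nonpos_of_le (hK : 0 < K) {p l : ℕ} (hp : 0 < p)
    (hl : (l : ℝ) ≤ 10 ^ 15 * Real.log p) {i : ℕ}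
    (h : K * artUpper 1 (2 * powSum p i + 1) ≤ l) : powGain (K : ℝ)⁻¹ p i ≤ 0 := by
  have h1 := powGain_mul_le hK hp hl i
  have h2 : ((K * artUpper 1 (2 * powSum p i + 1) : ℕ) : ℝ) ≤ l := by exact_mod_cast h
  have hK' : (0 : ℝ) < K := by exact_mod_cast hK
  by_contra! h3
  have : 0 < K * 10 ^ 15 * powGain (K : ℝ)⁻¹ p i := by positivity
  linarith

lemma powerTail_spec (hK : 0 < K) {p l : ℕ} (hp : 0 < p) (hl : (l : ℝ) ≤ 10 ^ 15 * Real.log p)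
    {f : ℕ → Bool} (J i t : ℕ) (hf : powerTail K p l J (powSum p i) t f = true) :
    ∃ t', f t' = true ∧
      t + K * 10 ^ 15 * ∑ r ∈ range J, max 0 (powGain (K : ℝ)⁻¹ p (r + i)) ≤ t' ∧
      ∀ r, J ≤ r → powGain (K : ℝ)⁻¹ p (r + i) ≤ 0 := by
  have hK' : (0 : ℝ) < K := by exact_mod_cast hK
  induction J generalizing i t with
  | zero => simp [powerTail] at hf
  | succ J ih =>
    simp only [powerTail, forceNat_eq] at hf
    cases hu : (K * artUpper 1 (2 * powSum p i + 1)).ble l with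
    | true =>
      rw [hu, cond_true] at hf
      have h1 := powGain_nonpos_of_le hK hp hl (Nat.le_of_ble_eq_true hu)
      have h2 (r : ℕ) : powGain (K : ℝ)⁻¹ p (r + i) ≤ 0 :=
        (powGain_le_powGain (by positivity) hp le_rfl (by omega)).trans h1
      exact ⟨t, hf, by simp [max_eq_left (h2 _)], fun r _ ↦ h2 r⟩
    | false =>
      rw [hu, cond_false] at hf
      obtain ⟨t', ht', h1, h2⟩ := ih (i + 1) _ hf
      refine ⟨t', ht', ?_, fun r hr ↦ ?_⟩
      · have h3 := powGain_mul_le hK hp hl i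
        have hlt : l < K * artUpper 1 (2 * powSum p i + 1) := by
          by_contra! h
          rw [Nat.ble_eq_true_of_le h] at hu
          exact Bool.noConfusion hu
        rw [← Nat.cast_sub hlt.le] at h3
        have h4 : K * 10 ^ 15 * max 0 (powGain (K : ℝ)⁻¹ p i)
            ≤ ((K * artUpper 1 (2 * powSum p i + 1) - l : ℕ) : ℝ) := by
          rw [mul_max_of_nonneg _ _ (by positivity), mul_zero]
          exact max_le (Nat.cast_nonneg _) h3
        rw [sum_range_succ', mul_add, zero_add]
        simp only [add_right_comm _ 1 i]
        simp only [← add_assoc] at h1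
        push_cast at h1 h4 ⊢
        linarith
      · obtain ⟨r, rfl⟩ : ∃ r', r = r' + 1 := ⟨r - 1, by omega⟩
        rw [add_right_comm]
        exact h2 r (by omega)

lemma primeTail_spec (hK : 0 < K) {f : ℕ → Bool} (ps : List ℕ) {q l t : ℕ} (hq : 0 < q)
    (hps : (q :: ps).IsChain (· ≤ ·)) (hl : (l : ℝ) ≤ 10 ^ 15 * Real.log q)
    (hf : primeTail K ps q l t f = true) :
    ∃ t', f t' = true ∧
      t + K * 10 ^ 15 * ∑ p ∈ ps.toFinset, powExcess 30 (K : ℝ)⁻¹ p ≤ t' ∧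
      (∀ p ∈ ps, ∀ i, 30 ≤ i → powGain (K : ℝ)⁻¹ p (i + 1) ≤ 0) ∧
      ∀ p, (∀ r ∈ q :: ps, r ≤ p) → powGain (K : ℝ)⁻¹ p 1 ≤ 0 := by
  induction ps generalizing q l t with
  | nil =>
    rw [primeTail, Bool.and_eq_true] at hf
    refine ⟨t, hf.2, by simp, by simp, fun p hp ↦ ?_⟩
    exact (powGain_le_powGain (by positivity) hq (hp q (by simp)) le_rfl).trans
      (powGain_nonpos_of_le hK hq hl (i := 1) (Nat.le_of_ble_eq_true hf.1))
  | cons p ps ih =>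
    rw [List.isChain_cons_cons] at hps
    simp only [primeTail, forceNat_eq] at hf
    have hp : 0 < p := hq.trans_le hps.1
    have hl' : ((l + artLower (p - q) (p + q) : ℕ) : ℝ) ≤ 10 ^ 15 * Real.log p := by
      have := artLower_le hq hps.1
      push_cast
      linarith
    obtain ⟨t₁, h1, h2, h3⟩ := powerTail_spec hK hp hl' 30 1 t hf
    obtain ⟨t', h4, h5, h6, h7⟩ := ih hp hps.2 hl' h1
    refine ⟨t', h4, ?_, ?_, fun r hr ↦ h7 r fun x hx ↦ hr x (List.mem_cons_of_mem _ hx)⟩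
    · have h8 : ∑ r ∈ (p :: ps).toFinset, powExcess 30 (K : ℝ)⁻¹ r ≤
          powExcess 30 (K : ℝ)⁻¹ p + ∑ r ∈ ps.toFinset, powExcess 30 (K : ℝ)⁻¹ r := by
        rw [List.toFinset_cons]
        by_cases h : p ∈ ps.toFinset
        · rw [insert_eq_of_mem h]
          exact le_add_of_nonneg_left (sum_nonneg fun _ _ ↦ le_max_left _ _)
        · rw [sum_insert h]
      have h9 := mul_le_mul_of_nonneg_left h8 (by positivity : (0 : ℝ) ≤ K * 10 ^ 15)
      have h10 : t + K * 10 ^ 15 * powExcess 30 (K : ℝ)⁻¹ p ≤ t₁ := h2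
      linarith
    · rintro r hr i hi
      rcases List.mem_cons.1 hr with rfl | hr
      · exact h3 i hi
      · exact h6 r hr i hi

end

/-- The primes below `450`. -/
def primeTable : List ℕ :=
  [2, 3, 5, 7, 11, 13, 17, 19, 23, 29, 31, 37, 41, 43, 47, 53, 59, 61, 67, 71, 73, 79, 83, 89, 97,
   101, 103, 107, 109, 113, 127, 131, 137, 139, 149, 151, 157, 163, 167, 173, 179, 181, 191, 193,
   197, 199, 211, 223, 227, 229, 233, 239, 241, 251, 257, 263, 269, 271, 277, 281, 283, 293, 307,
   311, 313, 317, 331, 337, 347, 349, 353, 359, 367, 373, 379, 383, 389, 397, 401, 409, 419, 421,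
   431, 433, 439, 443, 449]

lemma lt_of_mem_primeTable {p : ℕ} (hp : p ∈ primeTable) : p < 450 := by
  revert p
  decide +kernel

lemma mem_primeTable {p : ℕ} (hp : p.Prime) (h : p < 450) : p ∈ primeTable := by
  have key : ∀ p < 450, p ∈ primeTable ∨ p < 2 ∨
      ∃ d ∈ [2, 3, 5, 7, 11, 13, 17, 19], d ∣ p ∧ d ≠ p := by
    decide +kernel
  rcases key p h with h1 | h1 | ⟨d, hd, hdp, hne⟩
  · exact h1
  · exact absurd hp.two_le (not_le.2 h1)
  · rcases (Nat.dvd_prime hp).1 hdp with rfl | h2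
    · simp at hd
    · exact absurd h2 hne

/-- A range of values of `log n + γ`, ending at `y`, on which the bound of slope `1 / K` for
`log (σ(n) / n)` is used. It requires sieving another `len` odd numbers with the sieve given by
`modulus`. -/
structure RobinBlock where
  len : ℕ
  modulus : ℕ
  K : ℕ
  y : ℕ

/-- Verifies the bounds for `log (σ(n) / n)` for successive ranges of `log n + γ`, starting at `y`,
where `ly` and `lly` are scaled bounds for `log y` and `log (log y)`. -/
def checkBlocks : List RobinBlock → ℕ → ℕ → ℕ → ℕ → PrimeSums → Bool
  | [], _, _, _, _, _ => true
  | b :: bs, m, y, ly, lly, s =>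
    forceNat (ly + artLower (b.y - y) (b.y + y)) fun ly' ↦
    forceNat (lly + artLower (ly' - ly) (ly' + ly)) fun lly' ↦
    forceNat b.modulus fun M ↦
    Nat.ble 1 b.K && (Nat.ble y b.y && (Nat.beq ((min m 317).factorial % M) 0 &&
    s.advance M b.len m fun s ↦
    Nat.ble s.logUpper (b.K * artLower 1 (2 * s.prime + 1)) &&
    (Nat.ble (b.K * artUpper 1 (2 * (s.prime + 1) + 1)) s.logLower &&
    primeTail b.K primeTable 1 0 0 fun t ↦
    Nat.ble (y * 10 ^ 15 + b.K * s.sigmaUpper + t)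
      (b.K * (577200000000000 + lly) + 577200000000000 + s.thetaLower) &&
    (Nat.ble (b.y * 10 ^ 15 + b.K * s.sigmaUpper + t)
      (b.K * (577200000000000 + lly') + 577200000000000 + s.thetaLower) &&
    checkBlocks bs (m + 2 * b.len) b.y ly' lly' s))))

lemma log_sigma_div_le_of_primeSums {K m t : ℕ} {s : PrimeSums} (hK : 0 < K) (hs : s.Valid m)
    {Q : Finset ℕ} (hQ : ∀ p ∈ Q, ∀ i, 30 ≤ i → powGain (K : ℝ)⁻¹ p (i + 1) ≤ 0)
    (hQ' : ∀ p, p.Prime → p ∉ Q → powGain (K : ℝ)⁻¹ p 1 ≤ 0)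
    (hQt : K * 10 ^ 15 * ∑ p ∈ Q, powExcess 30 (K : ℝ)⁻¹ p ≤ t)
    (hl : s.logUpper ≤ K * artLower 1 (2 * s.prime + 1))
    (hu : K * artUpper 1 (2 * (s.prime + 1) + 1) ≤ s.logLower) {n : ℕ} (hn : n ≠ 0) :
    10 ^ 15 * (K * Real.log (ArithmeticFunction.sigma 1 n / n)) ≤
      10 ^ 15 * Real.log n + K * s.sigmaUpper - s.thetaLower + t := by
  have hK' : (0 : ℝ) < K := by exact_mod_cast hK
  obtain ⟨T, hT, hTm, hA, ht⟩ := hs.exists_finset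
  have h1 : 0 ≤ powGain (K : ℝ)⁻¹ s.prime 0 := by
    have h2 := artLower_one_le hs.pos
    have h3 : (s.logUpper : ℝ) ≤ K * artLower 1 (2 * s.prime + 1) := by exact_mod_cast hl
    have h4 := mul_le_mul_of_nonneg_left h2 hK'.le
    have h5 := hs.le_logUpper
    rw [powGain, powSum, sub_nonneg, inv_mul_le_iff₀ hK']
    linarith
  have h2 : powGain (K : ℝ)⁻¹ (s.prime + 1) 0 ≤ 0 := by
    refine powGain_nonpos_of_le (l := s.logLower) hK (Nat.succ_pos _) (hs.logLower_le.trans ?_) hu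
    have : (0 : ℝ) < s.prime := by exact_mod_cast hs.pos
    push_cast
    gcongr
    linarith
  have h3 := log_sigma_div_le_linear hn (inv_nonneg.2 hK'.le) hT
    (fun p hp hps ↦ hTm p hp (hps.trans hs.le)) h1 h2 hQ hQ'
  have h4 : ∑ p ∈ T, powGain (K : ℝ)⁻¹ p 0 =
      ∑ p ∈ T, Real.log (1 + 1 / p) - (K : ℝ)⁻¹ * ∑ p ∈ T, Real.log p := by
    simp only [powGain, powSum, sum_sub_distrib, mul_sum]
  rw [h4] at h3
  have h5 := mul_le_mul_of_nonneg_left h3 hK'.le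
  have h6 : K * ((K : ℝ)⁻¹ * Real.log n + (∑ p ∈ T, Real.log (1 + 1 / p) -
      (K : ℝ)⁻¹ * ∑ p ∈ T, Real.log p + ∑ p ∈ Q, powExcess 30 (K : ℝ)⁻¹ p)) =
      Real.log n + K * ∑ p ∈ T, Real.log (1 + 1 / p) - ∑ p ∈ T, Real.log p +
        K * ∑ p ∈ Q, powExcess 30 (K : ℝ)⁻¹ p := by
    field_simp
    ring
  rw [h6] at h5
  have h7 := mul_le_mul_of_nonneg_left hA hK'.le
  linarith

/-- Scaled bounds for `log y` and `log (log y)`. -/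
structure LogBounds (y ly lly : ℕ) : Prop where
  pos : 0 < ly
  log_le : (ly : ℝ) ≤ 10 ^ 15 * Real.log y
  log_log_le : (lly : ℝ) ≤ 10 ^ 15 * (Real.log ly - Real.log (10 ^ 15))

namespace LogBounds

variable {y ly lly : ℕ}

lemma log_pos (h : LogBounds y ly lly) : 0 < Real.log y := by
  have h1 : (0 : ℝ) < ly := by exact_mod_cast h.pos
  have := h.log_le
  by_contra! h2
  linarith

lemma y_pos (h : LogBounds y ly lly) : 0 < y := by
  rcases Nat.eq_zero_or_pos y with rfl | hy
  · simpa using h.log_pos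
  · exact hy

lemma le_log_log (h : LogBounds y ly lly) : (lly : ℝ) ≤ 10 ^ 15 * Real.log (Real.log y) := by
  have h1 : (0 : ℝ) < ly := by exact_mod_cast h.pos
  refine h.log_log_le.trans ?_
  rw [← Real.log_div h1.ne' (by positivity)]
  gcongr
  rw [div_le_iff₀' (by positivity)]
  exact h.log_le

lemma next (h : LogBounds y ly lly) {z lz llz : ℕ} (hyz : y ≤ z)
    (hlz : lz = ly + artLower (z - y) (z + y)) (hllz : llz = lly + artLower (lz - ly) (lz + ly)) :
    LogBounds z lz llz := by
  subst hllz
  have hle : ly ≤ lz := by omega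
  have h1 := artLower_le h.y_pos hyz
  have h2 := artLower_le h.pos hle
  have h3 := h.log_le
  have h4 := h.log_log_le
  refine ⟨h.pos.trans_le hle, ?_, ?_⟩
  · rw [hlz]
    push_cast
    linarith
  · push_cast
    linarith

end LogBounds

lemma checkBlocks_spec (bs : List RobinBlock) {m y ly lly : ℕ} {s : PrimeSums} (hm : Odd m)
    (hm1 : 1 < m) (hs : s.Valid m) (hy : LogBounds y ly lly)
    (hf : checkBlocks bs m y ly lly s = true) {n : ℕ} (hn : n ≠ 0)
    (hyn : (y : ℝ) ≤ Real.log n + Real.eulerMascheroniConstant) {b : RobinBlock} (hb : b ∈ bs)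
    (hbn : Real.log n + Real.eulerMascheroniConstant ≤ b.y) :
    Real.log (ArithmeticFunction.sigma 1 n / n) ≤ Real.eulerMascheroniConstant +
      Real.log (Real.log (Real.log n + Real.eulerMascheroniConstant)) := by
  induction bs generalizing m y ly lly s with
  | nil => simp at hb
  | cons c bs ih =>
    simp only [checkBlocks, forceNat_eq, Bool.and_eq_true] at hf
    obtain ⟨hK, hyc, hM, hf⟩ := hf
    have hK := Nat.le_of_ble_eq_true hK
    have hyc := Nat.le_of_ble_eq_true hyc
    have hM := Nat.dvd_of_mod_eq_zero (Nat.eq_of_beq_eq_true hM)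
    obtain ⟨s', hs', hf⟩ := hs.advance c.len hm hm1 (fun p hp hmp ↦ by
      refine ((Nat.Prime.coprime_iff_not_dvd hp).2 fun h ↦ ?_).symm
      have := (hp.dvd_factorial).1 (h.trans hM)
      omega) hf
    simp only [Bool.and_eq_true] at hf
    obtain ⟨hl, hu, hf⟩ := hf
    obtain ⟨t, hf, ht, hQ, hQ'⟩ := primeTail_spec hK primeTable one_pos (by decide +kernel)
      (by simp) hf
    simp only [Bool.and_eq_true] at hf
    obtain ⟨he1, he2, hf⟩ := hf
    have hc := hy.next hyc rfl rfl
    by_cases hb' : b ∈ bs ∧ (c.y : ℝ) ≤ Real.log n + Real.eulerMascheroniConstant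
    · exact ih (hm.add_even (even_two_mul _)) (by omega) hs' hc hf hb'.2 hb'.1
    have hcn : Real.log n + Real.eulerMascheroniConstant ≤ c.y := by
      rcases List.mem_cons.1 hb with rfl | h
      · exact hbn
      · exact (not_le.1 fun h' ↦ hb' ⟨h, h'⟩).le
    have hK' : (0 : ℝ) < c.K := by exact_mod_cast hK
    have h1 := log_sigma_div_le_of_primeSums hK hs' (Q := primeTable.toFinset)
      (fun p hp ↦ hQ p (List.mem_toFinset.1 hp))
      (fun p hp hpQ ↦ hQ' p fun r hr ↦ by
        have h2 : ¬ p < 450 := fun h ↦ hpQ (List.mem_toFinset.2 (mem_primeTable hp h))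
        rcases List.mem_cons.1 hr with rfl | hr
        · exact hp.one_le
        · have := lt_of_mem_primeTable hr
          omega)
      (by simpa using ht) (Nat.le_of_ble_eq_true hl) (Nat.le_of_ble_eq_true hu) hn
    have hγ := eulerMascheroniConstant_gt_d4
    set γ := Real.eulerMascheroniConstant
    have he (z llz : ℕ) (h : Nat.ble (z * 10 ^ 15 + c.K * s'.sigmaUpper + t)
        (c.K * (577200000000000 + llz) + 577200000000000 + s'.thetaLower) = true)
        (hz : (llz : ℝ) ≤ 10 ^ 15 * Real.log (Real.log z)) :
        (c.K * s'.sigmaUpper - s'.thetaLower + t) / (c.K * 10 ^ 15) - γ - (c.K : ℝ)⁻¹ * γ +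
          (c.K : ℝ)⁻¹ * z ≤ Real.log (Real.log z) := by
      have h2 : ((z * 10 ^ 15 + c.K * s'.sigmaUpper + t : ℕ) : ℝ) ≤
          ((c.K * (577200000000000 + llz) + 577200000000000 + s'.thetaLower : ℕ) : ℝ) := by
        exact_mod_cast Nat.le_of_ble_eq_true h
      push_cast at h2
      have h3 := mul_le_mul_of_nonneg_left hz hK'.le
      have h4 := mul_le_mul_of_nonneg_left hγ.le hK'.le
      rw [← sub_nonneg]
      have e : Real.log (Real.log z) - ((c.K * s'.sigmaUpper - s'.thetaLower + t) /
          (c.K * 10 ^ 15) - γ - (c.K : ℝ)⁻¹ * γ + (c.K : ℝ)⁻¹ * z) =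
          (c.K * (10 ^ 15 * Real.log (Real.log z)) + 10 ^ 15 * (c.K * γ) + 10 ^ 15 * γ +
            s'.thetaLower - (z * 10 ^ 15 + c.K * s'.sigmaUpper + t)) / (c.K * 10 ^ 15) := by
        field_simp
        ring
      rw [e]
      refine div_nonneg ?_ (by positivity)
      linarith
    have h2 := add_mul_le_log_log ((Real.log_pos_iff (Nat.cast_nonneg _)).1 hy.log_pos) hyn hcn
      (he _ _ he1 hy.le_log_log) (he _ _ he2 hc.le_log_log)
    have h3 : Real.log (ArithmeticFunction.sigma 1 n / n) ≤
        (10 ^ 15 * Real.log n + c.K * s'.sigmaUpper - s'.thetaLower + t) / (c.K * 10 ^ 15) := by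
      rw [le_div_iff₀ (by positivity)]
      linarith
    have e : (10 ^ 15 * Real.log n + c.K * s'.sigmaUpper - s'.thetaLower + t) / (c.K * 10 ^ 15) =
        (c.K * s'.sigmaUpper - s'.thetaLower + t) / (c.K * 10 ^ 15) + (c.K : ℝ)⁻¹ * Real.log n := by
      field_simp
      ring
    linarith

end

/-! ### Robin's inequality for numbers of medium size -/

section

open Finset

/-- The product of the primes up to `317`. -/
def smallPrimorial : ℕ := (primeTable.take 66).prod

/-- The blocks covering all values of `log n + γ` between `6` and `106163`. -/
def robinBlocks : List RobinBlock :=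
  [⟨2, 6, 15, 8⟩, ⟨2, 6, 28, 11⟩, ⟨1, 6, 36, 15⟩, ⟨3, 6, 59, 21⟩, ⟨6, 30030, 110, 29⟩,
   ⟨6, 30030, 165, 41⟩, ⟨9, 30030, 254, 57⟩, ⟨11, 30030, 371, 80⟩, ⟨15, 30030, 539, 112⟩,
   ⟨22, 30030, 799, 157⟩, ⟨27, 30030, 1134, 220⟩, ⟨41, 6469693230, 1670, 308⟩,
   ⟨54, 6469693230, 2409, 431⟩, ⟨78, 6469693230, 3528, 603⟩, ⟨106, 6469693230, 5117, 844⟩,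
   ⟨141, smallPrimorial, 7319, 1182⟩, ⟨201, smallPrimorial, 10587, 1655⟩,
   ⟨273, smallPrimorial, 15201, 2317⟩, ⟨377, smallPrimorial, 21812, 3244⟩,
   ⟨525, smallPrimorial, 31358, 4443⟩, ⟨675, smallPrimorial, 44053, 5943⟩,
   ⟨825, smallPrimorial, 60046, 7765⟩, ⟨1018, smallPrimorial, 80328, 10016⟩,
   ⟨1220, smallPrimorial, 105250, 12652⟩, ⟨1440, smallPrimorial, 135343, 15799⟩,
   ⟨1707, smallPrimorial, 171770, 19488⟩, ⟨2008, smallPrimorial, 215467, 23846⟩,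
   ⟨2324, smallPrimorial, 266969, 28799⟩, ⟨2655, smallPrimorial, 326813, 34494⟩,
   ⟨3043, smallPrimorial, 396498, 40970⟩, ⟨3425, smallPrimorial, 476106, 48204⟩,
   ⟨3853, smallPrimorial, 566920, 56402⟩, ⟨4302, smallPrimorial, 669659, 65420⟩,
   ⟨4764, smallPrimorial, 784850, 75475⟩, ⟨5306, smallPrimorial, 914665, 86680⟩,
   ⟨5892, smallPrimorial, 1060443, 99049⟩, ⟨3432, smallPrimorial, 1146061, 106163⟩]

set_option maxRecDepth 100000 in
lemma checkBlocks_robinBlocks :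
    checkBlocks robinBlocks 3 6 1791755693933333 583190000000000
      ⟨3, 1098608513633333, 1098613847466669, 693148882410110, 1791755693933333⟩ = true := by
  decide +kernel

lemma valid_three : PrimeSums.Valid 3
    ⟨3, 1098608513633333, 1098613847466669, 693148882410110, 1791755693933333⟩ := by
  have l2 := Real.log_two_gt_d9
  have l2' := Real.log_two_lt_d9
  have h1 := artLower_le (x := 2) (y := 3) (by norm_num) (by norm_num)
  have h2 := le_artUpper (x := 2) (y := 3) (by norm_num) (by norm_num)
  have h3 := le_artUpper_one (D := 2) (by norm_num)
  have h4 := le_artUpper_one (D := 3) (by norm_num)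
  norm_num [artLower, artUpper] at h1 h2 h3 h4
  refine ⟨by norm_num, le_rfl, ?_, ?_, {2, 3}, ?_, fun p hp h ↦ ?_, ?_, ?_⟩
  · norm_num
    linarith
  · norm_num
    linarith
  · simp
  · interval_cases p <;> simp_all +decide
  · norm_num
    linarith
  · norm_num
    linarith

lemma logBounds_six : LogBounds 6 1791755693933333 583190000000000 := by
  have l2 := Real.log_two_gt_d9
  have h1 := artLower_le (x := 2) (y := 3) (by norm_num) (by norm_num)
  have h2 := artLower_le (x := 10 ^ 15) (y := 1338000000000000) (by norm_num) (by norm_num)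
  have h3 := artLower_le (x := 1338000000000000) (y := 1791755693933333) (by norm_num) (by norm_num)
  norm_num [artLower] at h1 h2 h3
  have e : Real.log 6 = Real.log 2 + Real.log 3 := by
    rw [← Real.log_mul (by norm_num) (by norm_num)]
    norm_num
  refine ⟨by norm_num, ?_, ?_⟩
  · norm_num [e]
    linarith
  · norm_num
    linarith

theorem log_sigma_div_le_of_small {n : ℕ} (h1 : 6 ≤ Real.log n + Real.eulerMascheroniConstant)
    (h2 : Real.log n ≤ 10 ^ 5) :
    Real.log (ArithmeticFunction.sigma 1 n / n) ≤ Real.eulerMascheroniConstant +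
      Real.log (Real.log (Real.log n + Real.eulerMascheroniConstant)) := by
  have hγ := Real.eulerMascheroniConstant_lt_two_thirds
  have hn : n ≠ 0 := by
    rintro rfl
    norm_num at h1
    linarith
  refine checkBlocks_spec robinBlocks (by decide) (by norm_num) valid_three logBounds_six
    checkBlocks_robinBlocks hn (by exact_mod_cast h1) (b := ⟨3432, smallPrimorial, 1146061, 106163⟩)
    (by simp [robinBlocks]) ?_
  push_cast
  linarith

end

/-! ### Lagarias's criterion -/

section

open Finset

lemma log_add_eulerMascheroniConstant_le_harmonic {n : ℕ} (hn : 0 < n) :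
    Real.log (n + 1 / 2) + Real.eulerMascheroniConstant ≤ harmonic n ∧
    Real.log n + Real.eulerMascheroniConstant ≤ harmonic n := by
  have h := eulerMascheroniConstant_le_harmonic_sub n
  have hn' : (0 : ℝ) < n := by exact_mod_cast hn
  have h2 : Real.log n ≤ Real.log (n + 1 / 2) := Real.log_le_log hn' (by linarith)
  constructor <;> linarith

/-- Verifies Lagarias's inequality for `k` consecutive natural numbers starting with `n`, given
scaled lower bounds `h` and `l` for the harmonic number and its logarithm. -/
def checkLagarias : ℕ → ℕ → ℕ → ℕ → Bool
  | 0, _, _, _ => true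
  | k + 1, n, h, l =>
    Nat.ble (200 * 10 ^ 15 * ∑ d ∈ n.divisors, d) (200 * h + 178 * (2 * n + 1) * l) &&
    forceNat (h + 10 ^ 15 / (n + 1)) fun h' ↦
    forceNat (l + artLower (h' - h) (h' + h)) fun l' ↦ checkLagarias k (n + 1) h' l'

lemma checkLagarias_two_hundred_fifty_five : checkLagarias 255 1 (10 ^ 15) 0 = true := by
  decide +kernel

lemma le_exp_eulerMascheroniConstant : 1.78 ≤ Real.exp Real.eulerMascheroniConstant := by
  have h := Real.sum_le_exp_of_nonneg (x := 0.5772) (by norm_num) 6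
  refine le_trans ?_ (h.trans (Real.exp_le_exp.2 eulerMascheroniConstant_gt_d4.le))
  norm_num [sum_range_succ, Nat.factorial]

lemma checkLagarias_spec (k : ℕ) {n h l : ℕ} (hn : 0 < n) (hh : 0 < h)
    (hh' : (h : ℝ) ≤ 10 ^ 15 * harmonic n)
    (hl : (l : ℝ) ≤ 10 ^ 15 * (Real.log h - Real.log (10 ^ 15)))
    (hf : checkLagarias k n h l = true) {m : ℕ} (hnm : n ≤ m) (hm : m < n + k) :
    (ArithmeticFunction.sigma 1 m : ℝ) ≤
      (harmonic m : ℝ) + Real.exp (harmonic m : ℝ) * Real.log (harmonic m : ℝ) := by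
  induction k generalizing n h l with
  | zero => omega
  | succ k ih =>
    simp only [checkLagarias, forceNat_eq, Bool.and_eq_true] at hf
    rcases hnm.eq_or_lt with rfl | hlt
    · have h1 : ((200 * 10 ^ 15 * ∑ d ∈ n.divisors, d : ℕ) : ℝ) ≤
          (200 * h + 178 * (2 * n + 1) * l : ℕ) := by
        exact_mod_cast Nat.le_of_ble_eq_true hf.1
      rw [← ArithmeticFunction.sigma_one_apply] at h1
      push_cast at h1
      have hh0 : (0 : ℝ) < h := by exact_mod_cast hh
      have h2 : (l : ℝ) ≤ 10 ^ 15 * Real.log (harmonic n) := by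
        refine hl.trans ?_
        rw [← Real.log_div hh0.ne' (by positivity)]
        gcongr
        rwa [div_le_iff₀' (by positivity)]
      have h3 : 1.78 * (n + 1 / 2) ≤ Real.exp (harmonic n : ℝ) := by
        refine le_trans ?_ (Real.exp_le_exp.2 (log_add_eulerMascheroniConstant_le_harmonic hn).1)
        rw [Real.exp_add, Real.exp_log (by positivity), mul_comm]
        gcongr
        exact le_exp_eulerMascheroniConstant
      have h4 : 1.78 * (n + 1 / 2) * l ≤
          Real.exp (harmonic n : ℝ) * (10 ^ 15 * Real.log (harmonic n)) := by gcongr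
      linarith
    · obtain ⟨-, hf⟩ := hf
      have h1 : ((10 ^ 15 / (n + 1) : ℕ) : ℝ) ≤ 10 ^ 15 * (1 / (n + 1)) := by
        rw [mul_one_div]
        exact_mod_cast Nat.cast_div_le (α := ℝ) (m := 10 ^ 15) (n := n + 1)
      set d := 10 ^ 15 / (n + 1)
      clear_value d
      have h2 := artLower_le hh (Nat.le_add_right h d)
      refine ih n.succ_pos (by omega) ?_ ?_ hf hlt (by omega)
      · rw [harmonic_succ_real]
        push_cast
        linarith
      · push_cast at h2 ⊢
        linarith

lemma sigma_le_of_lt {n : ℕ} (hn : 0 < n) (h : n < 256) : (ArithmeticFunction.sigma 1 n : ℝ) ≤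
    (harmonic n : ℝ) + Real.exp (harmonic n : ℝ) * Real.log (harmonic n : ℝ) :=
  checkLagarias_spec 255 one_pos (by positivity) (by norm_num [harmonic]) (by norm_num)
    checkLagarias_two_hundred_fifty_five hn (by omega)

lemma sigma_le_of_log_sigma_div_le {n : ℕ} (hn : 0 < n) {y : ℝ} (h1 : 1 < y) (hy : y ≤ harmonic n)
    (h : Real.log (ArithmeticFunction.sigma 1 n / n) ≤
      Real.eulerMascheroniConstant + Real.log (Real.log y)) :
    (ArithmeticFunction.sigma 1 n : ℝ) ≤
      (harmonic n : ℝ) + Real.exp (harmonic n : ℝ) * Real.log (harmonic n : ℝ) := by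
  have hn' : (0 : ℝ) < n := by exact_mod_cast hn
  have hs : (0 : ℝ) < ArithmeticFunction.sigma 1 n := by
    exact_mod_cast ArithmeticFunction.sigma_pos 1 n hn.ne'
  have h2 : Real.exp (Real.log n + Real.eulerMascheroniConstant) ≤ Real.exp (harmonic n : ℝ) :=
    Real.exp_le_exp.2 (log_add_eulerMascheroniConstant_le_harmonic hn).2
  rw [Real.log_le_iff_le_exp (by positivity), Real.exp_add, Real.exp_log (Real.log_pos h1),
    div_le_iff₀ hn'] at h
  rw [Real.exp_add, Real.exp_log hn'] at h2
  calc (ArithmeticFunction.sigma 1 n : ℝ)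
      ≤ n * Real.exp Real.eulerMascheroniConstant * Real.log y := by linarith
    _ ≤ Real.exp (harmonic n : ℝ) * Real.log (harmonic n : ℝ) := by
        have := Real.log_pos h1
        gcongr
    _ ≤ _ := le_add_of_nonneg_left (by linarith)

theorem sigma_le_of_riemannHypothesis (h : RiemannHypothesis) {n : ℕ} (hn : 0 < n) :
    (ArithmeticFunction.sigma 1 n : ℝ) ≤
      (harmonic n : ℝ) + Real.exp (harmonic n : ℝ) * Real.log (harmonic n : ℝ) := by
  have hγ := eulerMascheroniConstant_gt_d4
  have hH := (log_add_eulerMascheroniConstant_le_harmonic hn).2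
  rcases lt_or_ge n 256 with hn' | hn'
  · exact sigma_le_of_lt hn hn'
  rcases le_total (10 ^ 5) (Real.log n) with h5 | h5
  · refine sigma_le_of_log_sigma_div_le hn (y := Real.log n) (by linarith) (by linarith) ?_
    rw [add_comm]
    exact log_sigma_div_le_of_large h h5
  · have h6 : Real.log (256 : ℕ) ≤ Real.log n := by gcongr
    have e : Real.log (256 : ℕ) = 8 * Real.log 2 := by
      rw [show ((256 : ℕ) : ℝ) = 2 ^ 8 by norm_num, Real.log_pow]
      norm_num
    have h7 := Real.log_two_gt_d9
    exact sigma_le_of_log_sigma_div_le hn (by linarith) hH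
      (log_sigma_div_le_of_small (by linarith) h5)

end

/-- Lagarias's criterion (2002): the Riemann hypothesis holds if and only if
`σ(n) ≤ Hₙ + e^{Hₙ} log Hₙ` for every positive integer `n`. -/
theorem lagarias_criterion :
    RiemannHypothesis ↔
      ∀ n : ℕ, 0 < n →
        (ArithmeticFunction.sigma 1 n : ℝ) ≤
          (harmonic n : ℝ) +
            Real.exp (harmonic n : ℝ) * Real.log (harmonic n : ℝ) :=
  ⟨fun h _ hn ↦ sigma_le_of_riemannHypothesis h hn, riemannHypothesis_of_lagarias⟩
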